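/- arXiv:1803.09573 — 3 statements merged into one kernel-verified Lean document; each statement's English description precedes it below -/
import Mathlib

section
/- There is an integer n₀ such that for every integer n ≥ n₀, the number of (3,2)-colourings of any family 𝓕 ⊆ 2^[n] is at most 3^(C(n,⌊n/2⌋)). Moreover, equality holds if and only if 𝓕 is the family of all ⌊n/2⌋-element subsets of [n] or the family of all ⌈n/2⌉-element subsets of [n]. -/
/-- An `(r,k)`-colouring of a family `F` of subsets of `[n]`: an assignment of one of `r`
colours to each member of `F` such that no `k`-chain in `F` is monochromatic. -/
def IsRKColouring {n r : ℕ} (k : ℕ) (F : Finset (Finset (Fin n)))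
    (c : {A // A ∈ F} → Fin r) : Prop :=
  ∀ ch : Fin k → {A // A ∈ F},
    (∀ i j : Fin k, i < j → (ch i : Finset (Fin n)) ⊂ (ch j : Finset (Fin n))) →
    ∃ i j : Fin k, c (ch i) ≠ c (ch j)

/-- The number of `(r,k)`-colourings of the family `F ⊆ 2^[n]`. -/
noncomputable def numColourings (r k n : ℕ) (F : Finset (Finset (Fin n))) : ℕ :=
  Nat.card {c : {A // A ∈ F} → Fin r // IsRKColouring k F c}

/-- `F` contains no `k`-chain. -/
def kChainFree (k : ℕ) {n : ℕ} (F : Finset (Finset (Fin n))) : Prop :=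
  ¬ ∃ ch : Fin k → Finset (Fin n), (∀ i, ch i ∈ F) ∧
      ∀ i j : Fin k, i < j → ch i ⊂ ch j

/-- `m_{k-1}`, the size of the family of all subsets of `[n]` of size between
`⌊(n-k+2)/2⌋` and `⌊(n+k-2)/2⌋`. -/
def mSize (n k : ℕ) : ℕ := ∑ i ∈ Finset.Icc ((n - k + 2) / 2) ((n + k - 2) / 2), n.choose i

/-- `f(r,k;n)`: the maximum number of `(r,k)`-colourings over all families in `2^[n]`. -/
noncomputable def fMax (r k n : ℕ) : ℕ :=
  Finset.sup Finset.univ (fun F : Finset (Finset (Fin n)) => numColourings r k n F)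

/-- The number of comparable pairs in a family. -/
def cpairs {n : ℕ} (F : Finset (Finset (Fin n))) : ℕ :=
  ((F ×ˢ F).filter fun p => p.1 ⊂ p.2).card

/-- The weight `w_k(F)` of a set `F ⊆ [n]`. -/
noncomputable def wk (n k : ℕ) (F : Finset (Fin n)) : ℝ :=
  min ((n.choose F.card : ℝ))⁻¹ ((n.choose ((n - k) / 2) : ℝ))⁻¹

/-- The weight `w_k(𝓕)` of a family `𝓕 ⊆ 2^[n]`. -/
noncomputable def wkFam (n k : ℕ) (F : Finset (Finset (Fin n))) : ℝ :=
  ∑ A ∈ F, wk n k A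

namespace ErdosRothschild

open Finset

section Graph

variable {α : Type*} [DecidableEq α] (G : SimpleGraph α) [DecidableRel G.Adj]

/-- The ordered adjacent pairs of `G` inside `C`. -/
def adjPairs (C : Finset α) : Finset (α × α) :=
  (C ×ˢ C).filter fun p => G.Adj p.1 p.2

/-- The neighbours of `x` inside `F`. -/
def nbrs (F : Finset α) (x : α) : Finset α := F.filter fun y => G.Adj x y

/-- The proper 3-colourings of `G` on `F`, extended by `0` outside `F`. -/
def properColourings [Fintype α] (F : Finset α) : Finset (α → Fin 3) :=
  univ.filter fun c => (∀ x, x ∉ F → c x = 0) ∧ ∀ x ∈ F, ∀ y ∈ F, G.Adj x y → c x ≠ c y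

/-- The neighbourhood of the set `T` inside `F`. -/
def nbrsOf (F T : Finset α) : Finset α := F.filter fun x => ∃ t ∈ T, G.Adj t x

/-- The vertices of `F` that can lie in an independent set with fingerprint `T`, where the
vertices of `R` are required to have fewer than `d` neighbours left. -/
def container (F R : Finset α) (d : ℕ) (T : Finset α) : Finset α :=
  F.filter fun x => x ∉ nbrsOf G F T ∧ (x ∈ R → #(nbrs G F x \ nbrsOf G F T) < d)

/-- The subsets of `R` that expand by a factor of at least `d`. -/
def fingerprints (F R : Finset α) (d : ℕ) : Finset (Finset α) :=
  R.powerset.filter fun T => d * #T ≤ #(nbrsOf G F T)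

variable {G}

lemma card_properColourings_of_independent [Fintype α] {F : Finset α}
    (hF : ∀ x ∈ F, ∀ y ∈ F, ¬ G.Adj x y) : #(properColourings G F) = 3 ^ #F := by
  have : properColourings G F =
      Fintype.piFinset (fun x => if x ∈ F then (univ : Finset (Fin 3)) else {0}) := by
    ext c
    simp only [properColourings, mem_filter, mem_univ, true_and, Fintype.mem_piFinset]
    constructor
    · rintro ⟨h, -⟩ x
      by_cases hx : x ∈ F <;> simp [hx, h]
    · intro h
      refine ⟨fun x hx => by simpa [hx] using h x, fun x hx y hy hxy => (hF x hx y hy hxy).elim⟩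
  rw [this, Fintype.card_piFinset]
  have h2 : ∀ x, #(if x ∈ F then (univ : Finset (Fin 3)) else {0}) = if x ∈ F then 3 else 1 := by
    intro x; split_ifs <;> simp
  simp only [h2]
  rw [Finset.prod_ite_mem]
  simp

lemma card_properColourings_le_six_mul [Fintype α] {F : Finset α} {u v : α} (hu : u ∈ F) (hv : v ∈ F)
    (huv : G.Adj u v) :
    #(properColourings G F) ≤ 6 * #(properColourings G ((F.erase u).erase v)) := by
  have h6 : #((univ : Finset (Fin 3 × Fin 3)).filter fun p => p.1 ≠ p.2) = 6 := by decide
  rw [← h6, ← card_product]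
  refine card_le_card_of_injOn
    (fun c => ((c u, c v), fun x => if x = u ∨ x = v then 0 else c x)) ?_ ?_
  · intro c hc
    simp only [properColourings, coe_filter, mem_univ, true_and, Set.mem_ofPred_eq] at hc
    simp only [properColourings, coe_product, Set.mem_prod, coe_filter, mem_univ, true_and,
      Set.mem_ofPred_eq, mem_erase]
    refine ⟨hc.2 u hu v hv huv, fun x hx => ?_, fun x hx y hy hxy => ?_⟩
    · split_ifs with h
      · rfl
      · exact hc.1 x (by tauto)
    · rw [if_neg (by tauto), if_neg (by tauto)]
      exact hc.2 x hx.2.2 y hy.2.2 hxy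
  · intro c _ c' _ h
    simp only [Prod.mk.injEq] at h
    funext x
    by_cases hxu : x = u
    · rw [hxu]; exact h.1.1
    by_cases hxv : x = v
    · rw [hxv]; exact h.1.2
    simpa [hxu, hxv] using congrFun h.2 x

lemma card_adjPairs_insert_le (C : Finset α) (u : α) :
    #(adjPairs G (insert u C)) ≤ #(adjPairs G C) + 2 * #(nbrs G (insert u C) u) := by
  have : adjPairs G (insert u C) ⊆ adjPairs G C ∪
      ((nbrs G (insert u C) u).image (fun y => (u, y)) ∪
        (nbrs G (insert u C) u).image (fun y => (y, u))) := by
    rintro ⟨x, y⟩ h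
    simp only [adjPairs, nbrs, mem_filter, mem_product, mem_union, mem_image, Prod.mk.injEq] at h ⊢
    obtain ⟨⟨hx, hy⟩, hxy⟩ := h
    by_cases hxu : x = u
    · subst hxu
      exact Or.inr (Or.inl ⟨y, ⟨hy, hxy⟩, rfl, rfl⟩)
    by_cases hyu : y = u
    · subst hyu
      exact Or.inr (Or.inr ⟨x, ⟨hx, hxy.symm⟩, rfl, rfl⟩)
    exact Or.inl ⟨⟨mem_of_mem_insert_of_ne hx hxu, mem_of_mem_insert_of_ne hy hyu⟩, hxy⟩
  refine (card_le_card this).trans ((card_union_le _ _).trans ?_)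
  have h1 := card_union_le ((nbrs G (insert u C) u).image (fun y => (u, y)))
    ((nbrs G (insert u C) u).image (fun y => (y, u)))
  have h2 := card_image_le (s := nbrs G (insert u C) u) (f := fun y => (u, y))
  have h3 := card_image_le (s := nbrs G (insert u C) u) (f := fun y => (y, u))
  omega

lemma disjoint_container_nbrsOf {F R : Finset α} {d : ℕ} {T : Finset α} {x : α}
    (hx : x ∈ container G F R d T) : x ∉ nbrsOf G F T := (mem_filter.1 hx).2.1

lemma card_adjPairs_container_le {F R : Finset α} {d : ℕ} (T : Finset α)
    (hM : ∀ x ∈ F \ R, ∀ y ∈ F \ R, ¬ G.Adj x y) :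
    #(adjPairs G (container G F R d T)) ≤ 2 * (d * #R) := by
  set C := container G F R d T with hC
  have hCF : C ⊆ F := filter_subset _ _
  have hdeg : ∀ x ∈ R ∩ C, #(nbrs G C x) ≤ d := by
    intro x hx
    rw [mem_inter] at hx
    have := (mem_filter.1 hx.2).2.2 hx.1
    refine (card_le_card ?_).trans this.le
    intro y hy
    rw [nbrs, mem_filter] at hy
    exact mem_sdiff.2 ⟨mem_filter.2 ⟨hCF hy.1, hy.2⟩, disjoint_container_nbrsOf hy.1⟩
  have hsub : adjPairs G C ⊆
      ((R ∩ C).biUnion fun x => (nbrs G C x).image fun y => (x, y)) ∪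
      ((R ∩ C).biUnion fun x => (nbrs G C x).image fun y => (y, x)) := by
    rintro ⟨x, y⟩ h
    simp only [adjPairs, mem_filter, mem_product] at h
    obtain ⟨⟨hx, hy⟩, hxy⟩ := h
    simp only [mem_union, mem_biUnion, mem_image, nbrs, mem_filter, Prod.mk.injEq, mem_inter]
    by_cases hxR : x ∈ R
    · exact Or.inl ⟨x, ⟨hxR, hx⟩, y, ⟨hy, hxy⟩, rfl, rfl⟩
    by_cases hyR : y ∈ R
    · exact Or.inr ⟨y, ⟨hyR, hy⟩, x, ⟨hx, hxy.symm⟩, rfl, rfl⟩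
    exact (hM x (mem_sdiff.2 ⟨hCF hx, hxR⟩) y (mem_sdiff.2 ⟨hCF hy, hyR⟩) hxy).elim
  have hR : #(R ∩ C) * d ≤ d * #R := by
    rw [mul_comm]; exact Nat.mul_le_mul_left _ (card_le_card inter_subset_left)
  have h1 := card_biUnion_le_card_mul (R ∩ C) (fun x => (nbrs G C x).image fun y => (x, y)) d
    (fun x hx => card_image_le.trans (hdeg x hx))
  have h2 := card_biUnion_le_card_mul (R ∩ C) (fun x => (nbrs G C x).image fun y => (y, x)) d
    (fun x hx => card_image_le.trans (hdeg x hx))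
  have := (card_le_card hsub).trans (card_union_le _ _)
  omega

lemma exists_fingerprint {F R A : Finset α} {d : ℕ} (hd : 0 < d) (hA : A ⊆ F)
    (hind : ∀ x ∈ A, ∀ y ∈ A, ¬ G.Adj x y) :
    ∃ T ∈ fingerprints G F R d, A ⊆ container G F R d T := by
  obtain ⟨T, hT, hmax⟩ := exists_max_image ((fingerprints G F R d).filter (· ⊆ A)) card
    ⟨∅, by simp [fingerprints]⟩
  rw [mem_filter] at hT
  refine ⟨T, hT.1, fun x hx => mem_filter.2 ⟨hA hx, ?_, fun hxR => ?_⟩⟩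
  · intro h
    obtain ⟨t, ht, htx⟩ := (mem_filter.1 h).2
    exact hind t (hT.2 ht) x hx htx
  · by_contra! hlt
    have hxT : x ∉ T := by
      intro hxT
      have : nbrs G F x \ nbrsOf G F T = ∅ := by
        rw [sdiff_eq_empty_iff_subset]
        intro y hy
        rw [nbrs, mem_filter] at hy
        exact mem_filter.2 ⟨hy.1, x, hxT, hy.2⟩
      rw [this, card_empty] at hlt
      omega
    have hgood := mem_filter.1 hT.1
    have hins : insert x T ∈ (fingerprints G F R d).filter (· ⊆ A) := by
      refine mem_filter.2 ⟨mem_filter.2 ⟨?_, ?_⟩, insert_subset hx hT.2⟩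
      · exact mem_powerset.2 (insert_subset hxR (mem_powerset.1 hgood.1))
      · have hsub : nbrsOf G F T ∪ (nbrs G F x \ nbrsOf G F T) ⊆ nbrsOf G F (insert x T) := by
          intro y hy
          rw [mem_union] at hy
          rcases hy with hy | hy
          · obtain ⟨h1, t, ht, h2⟩ := mem_filter.1 hy
            exact mem_filter.2 ⟨h1, t, mem_insert_of_mem ht, h2⟩
          · obtain ⟨h1, h2⟩ := mem_filter.1 (mem_sdiff.1 hy).1
            exact mem_filter.2 ⟨h1, x, mem_insert_self _ _, h2⟩
        have := card_le_card hsub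
        rw [card_union_of_disjoint disjoint_sdiff] at this
        rw [card_insert_of_notMem hxT, mul_add]
        have := hgood.2
        omega
    have := hmax _ hins
    rw [card_insert_of_notMem hxT] at this
    omega

/-- The colours available at `x` when colour class `i` is confined to the container of `T i`. -/
def palette (G : SimpleGraph α) [DecidableRel G.Adj] (F R : Finset α) (d : ℕ)
    (T : Fin 3 → Finset α) (x : α) : Finset (Fin 3) :=
  univ.filter fun i => x ∈ container G F R d (T i)

lemma card_properColourings_le_sum_prod [Fintype α] {F R : Finset α} {d : ℕ} (hd : 0 < d) :
    #(properColourings G F) ≤ ∑ T ∈ Fintype.piFinset fun _ : Fin 3 => fingerprints G F R d,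
      ∏ x ∈ F, #(palette G F R d T x) := by
  have hsub : properColourings G F ⊆
      (Fintype.piFinset fun _ : Fin 3 => fingerprints G F R d).biUnion fun T =>
        Fintype.piFinset fun x => if x ∈ F then palette G F R d T x else {0} := by
    intro c hc
    obtain ⟨hc0, hc⟩ := (mem_filter.1 hc).2
    have hT : ∀ i, ∃ T ∈ fingerprints G F R d,
        F.filter (fun x => c x = i) ⊆ container G F R d T := fun i =>
      exists_fingerprint hd (filter_subset _ _) fun x hx y hy hxy => by
        rw [mem_filter] at hx hy
        exact hc x hx.1 y hy.1 hxy (hx.2.trans hy.2.symm)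
    choose T hT hcT using hT
    refine mem_biUnion.2 ⟨T, Fintype.mem_piFinset.2 hT, Fintype.mem_piFinset.2 fun x => ?_⟩
    split_ifs with hx
    · exact mem_filter.2 ⟨mem_univ _, hcT _ (mem_filter.2 ⟨hx, rfl⟩)⟩
    · simpa using hc0 x hx
  refine (card_le_card hsub).trans (card_biUnion_le.trans (sum_le_sum fun T _ => ?_))
  rw [Fintype.card_piFinset]
  have h2 : ∀ x, #(if x ∈ F then palette G F R d T x else {0}) =
      if x ∈ F then #(palette G F R d T x) else 1 := by
    intro x; split_ifs <;> simp
  simp only [h2]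
  rw [Finset.prod_ite_mem]
  simp

lemma sum_card_palette (F R : Finset α) (d : ℕ) (T : Fin 3 → Finset α) :
    ∑ x ∈ F, #(palette G F R d T x) = ∑ i, #(container G F R d (T i)) := by
  simp only [palette, card_filter]
  rw [sum_comm]
  refine sum_congr rfl fun i _ => ?_
  rw [← card_filter]
  congr 1
  ext x
  simp only [mem_filter, and_iff_right_iff_imp]
  exact fun h => (mem_filter.1 h).1

lemma card_nonfull_palette_ge {F R : Finset α} {d : ℕ} {T : Fin 3 → Finset α} (hd : 0 < d)
    (hRF : R ⊆ F) (hR : ∀ x ∈ R, 3 * d ≤ #(nbrs G F x)) (hT : ∀ i, T i ∈ fingerprints G F R d)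
    (hne : ∀ x ∈ F, palette G F R d T x ≠ ∅) :
    3 * #R + ∑ i, d * #(T i) ≤ 6 * #(F.filter fun x => palette G F R d T x ≠ univ) := by
  have h1 : #R ≤ #(F.filter fun x => palette G F R d T x ≠ univ) := by
    refine card_le_card fun x hx => mem_filter.2 ⟨hRF hx, fun hfull => ?_⟩
    have hsub : nbrs G F x ⊆ univ.biUnion fun i => nbrs G F x \ nbrsOf G F (T i) := by
      intro y hy
      obtain ⟨i, hi⟩ := nonempty_iff_ne_empty.2 (hne y (mem_filter.1 hy).1)
      exact mem_biUnion.2 ⟨i, mem_univ _, mem_sdiff.2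
        ⟨hy, disjoint_container_nbrsOf (mem_filter.1 hi).2⟩⟩
    have hlt : ∀ i ∈ (univ : Finset (Fin 3)), #(nbrs G F x \ nbrsOf G F (T i)) ≤ d - 1 := by
      intro i _
      have : i ∈ palette G F R d T x := hfull ▸ mem_univ i
      have := (mem_filter.1 (mem_filter.1 this).2).2.2 hx
      omega
    have h3 := (card_le_card hsub).trans (card_biUnion_le_card_mul _ _ _ hlt)
    have h4 := hR x hx
    simp only [card_univ, Fintype.card_fin] at h3
    omega
  have h2 : ∀ i, d * #(T i) ≤ #(F.filter fun x => palette G F R d T x ≠ univ) := by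
    intro i
    refine (mem_filter.1 (hT i)).2.trans (card_le_card fun x hx => mem_filter.2
      ⟨(mem_filter.1 hx).1, fun hfull => ?_⟩)
    have : i ∈ palette G F R d T x := hfull ▸ mem_univ i
    exact disjoint_container_nbrsOf (mem_filter.1 this).2 hx
  have h20 := h2 0
  have h21 := h2 1
  have h22 := h2 2
  rw [Fin.sum_univ_three]
  omega

end Graph


section Graph

variable {α : Type*} [DecidableEq α] {G : SimpleGraph α} [DecidableRel G.Adj]

lemma three_rpow_le {δ : ℝ} (hδ : δ ≤ 1 / 200) : (3 : ℝ) ^ δ ≤ 503 / 500 := by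
  have h : (3 : ℝ) ^ (1 / 200 : ℝ) ≤ 503 / 500 := by
    rw [one_div, Real.rpow_inv_le_iff_of_pos (by norm_num) (by norm_num) (by norm_num)]
    have : ((503 / 500 : ℝ)) ^ (200 : ℝ) = (503 / 500) ^ (200 : ℕ) := by
      rw [← Real.rpow_natCast]; norm_num
    rw [this]; norm_num
  exact (Real.rpow_le_rpow_of_exponent_le (by norm_num) hδ).trans h

/-- A palette of `k ≤ 3` colours has size at most `3 ^ (k / 3)`, with a saving if `k ≠ 3`. -/
lemma card_palette_le (S : Finset (Fin 3)) :
    (#S : ℝ) ≤ ((3 : ℝ) ^ (1 / 3 : ℝ)) ^ #S * (199 / 200) ^ (if S ≠ univ then 6 else 0) := by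
  set t : ℝ := (3 : ℝ) ^ (1 / 3 : ℝ) with ht
  have ht0 : 0 < t := by positivity
  have ht3 : t ^ 3 = 3 := by
    rw [ht, ← Real.rpow_natCast, ← Real.rpow_mul (by norm_num)]; norm_num
  by_cases hS : S = univ
  · simp [hS, ht3]
  rw [if_pos hS]
  have hcard : #S < 3 := by
    have := card_lt_card (ssubset_univ_iff.2 hS)
    simpa using this
  interval_cases h : #S
  · norm_num
  · rw [pow_one, Nat.cast_one]
    have : (1.1 : ℝ) ≤ t := le_of_pow_le_pow_left₀ (n := 3) (by norm_num) ht0.le (by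
      rw [ht3]; norm_num)
    nlinarith
  · have : (1.442 : ℝ) ≤ t := le_of_pow_le_pow_left₀ (n := 3) (by norm_num) ht0.le (by
      rw [ht3]; norm_num)
    have h2 : (1.442 : ℝ) ^ 2 ≤ t ^ 2 := by gcongr
    push_cast
    nlinarith

lemma prod_card_palette_le {F R : Finset α} {d : ℕ} {T : Fin 3 → Finset α} (hd : 0 < d)
    (hRF : R ⊆ F) (hR : ∀ x ∈ R, 3 * d ≤ #(nbrs G F x)) (hT : ∀ i, T i ∈ fingerprints G F R d) :
    ((∏ x ∈ F, #(palette G F R d T x) : ℕ) : ℝ) ≤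
      ((3 : ℝ) ^ (1 / 3 : ℝ)) ^ (∑ i, #(container G F R d (T i))) *
        ((199 / 200) ^ (3 * #R) * ∏ i, ((199 / 200) ^ d) ^ #(T i)) := by
  by_cases hne : ∀ x ∈ F, palette G F R d T x ≠ ∅
  · push_cast
    refine (prod_le_prod (fun _ _ => by positivity) fun x _ => card_palette_le _).trans ?_
    rw [prod_mul_distrib, prod_pow_eq_pow_sum, prod_pow_eq_pow_sum, sum_card_palette]
    gcongr
    simp only [← pow_mul]
    rw [prod_pow_eq_pow_sum, ← pow_add]
    refine pow_le_pow_of_le_one (by norm_num) (by norm_num) ?_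
    have := card_nonfull_palette_ge hd hRF hR hT hne
    rw [← sum_filter, sum_const, smul_eq_mul]
    omega
  · push Not at hne
    obtain ⟨x, hx, hx0⟩ := hne
    rw [prod_eq_zero hx (by rw [hx0, card_empty]), Nat.cast_zero]
    positivity

/-- The main bound when the vertices of low degree form an independent set. -/
lemma card_properColourings_lt_of_independent_sdiff [Fintype α] {F R : Finset α} {d : ℕ}
    (hd : 2000 ≤ d) {η N : ℝ} (hη : 0 ≤ η) (hηd : 2 * (η * d) ≤ 1 / 200)
    (hN : ∀ C ⊆ F, (#C : ℝ) ≤ N + η * #(adjPairs G C))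
    (hRF : R ⊆ F) (hR : ∀ x ∈ R, 3 * d ≤ #(nbrs G F x)) (hne : R.Nonempty)
    (hM : ∀ x ∈ F \ R, ∀ y ∈ F \ R, ¬ G.Adj x y) :
    (#(properColourings G F) : ℝ) < 3 ^ N := by
  have hd0 : 0 < d := by omega
  have hcont : ∀ T : Fin 3 → Finset α,
      ((3 : ℝ) ^ (1 / 3 : ℝ)) ^ (∑ i, #(container G F R d (T i))) ≤
        3 ^ N * (503 / 500) ^ #R := by
    intro T
    have h1 : ∀ i, (#(container G F R d (T i)) : ℝ) ≤ N + 2 * (η * d) * #R := by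
      intro i
      refine (hN (container G F R d (T i)) (filter_subset _ _)).trans ?_
      have : (#(adjPairs G (container G F R d (T i))) : ℝ) ≤ 2 * (d * #R) := by
        exact_mod_cast card_adjPairs_container_le (T i) hM
      nlinarith [mul_le_mul_of_nonneg_left this hη]
    rw [← Real.rpow_natCast, ← Real.rpow_mul (by norm_num)]
    calc (3 : ℝ) ^ (1 / 3 * ((∑ i, #(container G F R d (T i)) : ℕ) : ℝ))
        ≤ 3 ^ (N + 2 * (η * d) * #R) := by
          refine Real.rpow_le_rpow_of_exponent_le (by norm_num) ?_
          rw [Fin.sum_univ_three]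
          push_cast
          linarith [h1 0, h1 1, h1 2]
      _ = 3 ^ N * (3 ^ (2 * (η * d))) ^ #R := by
          rw [Real.rpow_add (by norm_num), Real.rpow_mul_natCast (by norm_num)]
      _ ≤ _ := by
          gcongr
          exact three_rpow_le hηd
  have hsum : ∑ T ∈ Fintype.piFinset fun _ : Fin 3 => fingerprints G F R d,
      ∏ i, (((199 / 200 : ℝ)) ^ d) ^ #(T i) ≤ ((1 + (199 / 200) ^ d) ^ #R) ^ 3 := by
    rw [sum_prod_piFinset (fingerprints G F R d) fun _ T => ((199 / 200 : ℝ) ^ d) ^ #T]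
    rw [prod_const, card_univ, Fintype.card_fin]
    gcongr
    calc _ ≤ ∑ T ∈ R.powerset, ((199 / 200 : ℝ) ^ d) ^ #T :=
          sum_le_sum_of_subset_of_nonneg (filter_subset _ _) fun _ _ _ => by positivity
      _ = _ := by
          rw [add_comm, ← sum_pow_mul_eq_add_pow]
          simp
  have hbase : (503 / 500 : ℝ) * (199 / 200) ^ 3 * (1 + (199 / 200) ^ d) ^ 3 < 1 := by
    have h1 : (199 / 200 : ℝ) ^ d ≤ 1 / 10000 := by
      refine (pow_le_pow_of_le_one (by norm_num) (by norm_num) hd).trans ?_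
      rw [show 2000 = 200 * 10 from rfl, pow_mul]
      have : (199 / 200 : ℝ) ^ 200 ≤ 0.37 := by norm_num
      exact (pow_le_pow_left₀ (by positivity) this 10).trans (by norm_num)
    have h2 : (1 + (199 / 200 : ℝ) ^ d) ^ 3 ≤ (1 + 1 / 10000) ^ 3 := by gcongr
    calc _ ≤ (503 / 500 : ℝ) * (199 / 200) ^ 3 * (1 + 1 / 10000) ^ 3 := by gcongr
      _ < 1 := by norm_num
  calc (#(properColourings G F) : ℝ)
      ≤ ∑ T ∈ Fintype.piFinset fun _ : Fin 3 => fingerprints G F R d,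
          ((∏ x ∈ F, #(palette G F R d T x) : ℕ) : ℝ) := by
        exact_mod_cast card_properColourings_le_sum_prod hd0
    _ ≤ ∑ T ∈ Fintype.piFinset fun _ : Fin 3 => fingerprints G F R d,
          3 ^ N * (503 / 500) ^ #R *
            ((199 / 200) ^ (3 * #R) * ∏ i, ((199 / 200) ^ d) ^ #(T i)) := by
        refine sum_le_sum fun T hT => ?_
        refine (prod_card_palette_le hd0 hRF hR (Fintype.mem_piFinset.1 hT)).trans ?_
        gcongr
        exact hcont T
    _ ≤ 3 ^ N * (503 / 500) ^ #R *
            ((199 / 200) ^ (3 * #R) * ((1 + (199 / 200) ^ d) ^ #R) ^ 3) := by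
        rw [← mul_sum, ← mul_sum]
        gcongr
    _ = 3 ^ N * ((503 / 500 : ℝ) * (199 / 200) ^ 3 * (1 + (199 / 200) ^ d) ^ 3) ^ #R := by
        rw [mul_pow, mul_pow, ← pow_mul, ← pow_mul, ← pow_mul, mul_comm #R 3]
        ring
    _ < 3 ^ N * 1 := by
        gcongr
        exact pow_lt_one₀ (by positivity) hbase hne.card_pos.ne'
    _ = 3 ^ N := mul_one _

/-- A graph in which every vertex set `C` spanning `e` ordered edges has size at most
`N + η e` has fewer than `3 ^ N` proper 3-colourings, unless it has no edges. -/
theorem card_properColourings_lt [Fintype α] {d : ℕ} (hd : 2000 ≤ d) {η : ℝ} (hη : 0 ≤ η)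
    (hηd : 2 * (η * d) ≤ 1 / 200) (F : Finset α) (N : ℝ)
    (hN : ∀ C ⊆ F, (#C : ℝ) ≤ N + η * #(adjPairs G C))
    (hedge : ∃ x ∈ F, ∃ y ∈ F, G.Adj x y) :
    (#(properColourings G F) : ℝ) < 3 ^ N := by
  induction hm : #F using Nat.strong_induction_on generalizing F N with
  | _ m ih =>
  set R := F.filter fun x => 3 * d ≤ #(nbrs G F x) with hRdef
  by_cases hM : ∀ x ∈ F \ R, ∀ y ∈ F \ R, ¬ G.Adj x y
  · refine card_properColourings_lt_of_independent_sdiff hd hη hηd hN (filter_subset _ _)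
      (fun x hx => (mem_filter.1 hx).2) ?_ hM
    by_contra hR
    obtain ⟨x, hx, y, hy, hxy⟩ := hedge
    exact hM x (mem_sdiff.2 ⟨hx, fun h => hR ⟨x, h⟩⟩) y (mem_sdiff.2 ⟨hy, fun h => hR ⟨y, h⟩⟩) hxy
  push Not at hM
  obtain ⟨u, hu, v, hv, huv⟩ := hM
  have hlow : ∀ x ∈ F \ R, x ∈ F ∧ #(nbrs G F x) ≤ 3 * d := by
    intro x hx
    rw [mem_sdiff, hRdef, mem_filter] at hx
    exact ⟨hx.1, by by_contra h; exact hx.2 ⟨hx.1, by omega⟩⟩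
  obtain ⟨huF, hud⟩ := hlow u hu
  obtain ⟨hvF, hvd⟩ := hlow v hv
  set F' := (F.erase u).erase v with hF'
  have hne : u ≠ v := huv.ne
  have hcard : #F' < m := by
    rw [← hm]
    exact (card_le_card (erase_subset _ _)).trans_lt (card_erase_lt_of_mem huF)
  have hN' : ∀ C ⊆ F', (#C : ℝ) ≤ (N - 2 + 12 * (η * d)) + η * #(adjPairs G C) := by
    intro C hC
    have huC : u ∉ C := fun h => by simpa [hF'] using hC h
    have hvC : v ∉ insert u C := by
      rw [mem_insert, not_or]
      exact ⟨hne.symm, fun h => by simpa [hF'] using hC h⟩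
    have hCF : C ⊆ F := hC.trans ((erase_subset _ _).trans (erase_subset _ _))
    have hsub : insert u C ⊆ F := insert_subset huF hCF
    have hsub' : insert v (insert u C) ⊆ F := insert_subset hvF hsub
    have h1 := hN _ hsub'
    have h2 := card_adjPairs_insert_le (G := G) C u
    have h3 := card_adjPairs_insert_le (G := G) (insert u C) v
    have h4 : #(nbrs G (insert u C) u) ≤ #(nbrs G F u) :=
      card_le_card (filter_subset_filter _ hsub)
    have h5 : #(nbrs G (insert v (insert u C)) v) ≤ #(nbrs G F v) :=
      card_le_card (filter_subset_filter _ hsub')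
    have h6 : (#(adjPairs G (insert v (insert u C))) : ℝ) ≤ #(adjPairs G C) + 12 * d := by
      exact_mod_cast (by omega :
        #(adjPairs G (insert v (insert u C))) ≤ #(adjPairs G C) + 12 * d)
    rw [card_insert_of_notMem hvC, card_insert_of_notMem huC] at h1
    push_cast at h1
    nlinarith [mul_le_mul_of_nonneg_left h6 hη]
  have hF'le : (#(properColourings G F') : ℝ) ≤ 3 ^ (N - 2 + 12 * (η * d)) := by
    by_cases hedge' : ∃ x ∈ F', ∃ y ∈ F', G.Adj x y
    · exact (ih _ hcard F' _ hN' hedge' rfl).le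
    · push Not at hedge'
      rw [card_properColourings_of_independent hedge']
      push_cast
      rw [← Real.rpow_natCast]
      refine Real.rpow_le_rpow_of_exponent_le (by norm_num) ?_
      have : adjPairs G F' = ∅ := by
        rw [adjPairs, filter_eq_empty_iff]
        rintro ⟨x, y⟩ hxy
        rw [mem_product] at hxy
        exact hedge' x hxy.1 y hxy.2
      simpa [this] using hN' F' subset_rfl
  calc (#(properColourings G F) : ℝ) ≤ 6 * #(properColourings G F') := by
        exact_mod_cast card_properColourings_le_six_mul huF hvF huv
    _ ≤ 6 * 3 ^ (N - 2 + 12 * (η * d)) := by gcongr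
    _ = 3 ^ N * (6 / 9 * (3 ^ (2 * (η * d))) ^ 6) := by
        rw [← Real.rpow_mul_natCast (by norm_num), Real.rpow_add (by norm_num),
          Real.rpow_sub (by norm_num)]
        norm_num
        ring_nf
    _ ≤ 3 ^ N * (6 / 9 * (503 / 500) ^ 6) := by
        gcongr
        exact three_rpow_le hηd
    _ < 3 ^ N * 1 := by
        gcongr
        norm_num
    _ = 3 ^ N := mul_one _

end Graph


section Boolean

open Numbering
open scoped Nat

variable {X : Type*} [DecidableEq X]

/-- The pairs `A ⊂ B` in a family. -/
def strictPairs (C : Finset (Finset X)) : Finset (Finset X × Finset X) :=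
  (C ×ˢ C).filter fun p => p.1 ⊂ p.2

/-- The comparability graph of the Boolean lattice. -/
def comparabilityGraph (X : Type*) : SimpleGraph (Finset X) where
  Adj u v := u ⊂ v ∨ v ⊂ u
  symm := ⟨fun _ _ h => h.symm⟩
  loopless := ⟨fun u h => h.elim (ssubset_irrefl u) (ssubset_irrefl u)⟩

instance : DecidableRel (comparabilityGraph X).Adj :=
  fun u v => inferInstanceAs (Decidable (u ⊂ v ∨ v ⊂ u))

lemma card_strictPairs_erase_add_le {C : Finset (Finset X)} {x : Finset X} (hx : x ∈ C) :
    #(strictPairs (C.erase x)) + #(nbrs (comparabilityGraph X) C x) ≤ #(strictPairs C) := by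
  have hinj : Set.InjOn (fun y => if y ⊂ x then (y, x) else (x, y))
      (nbrs (comparabilityGraph X) C x : Set (Finset X)) := by
    intro y hy y' hy' h
    have h1 : x ⊂ y ∨ y ⊂ x := (mem_filter.1 (mem_coe.1 hy)).2
    have h2 : x ⊂ y' ∨ y' ⊂ x := (mem_filter.1 (mem_coe.1 hy')).2
    dsimp only at h
    split_ifs at h with h3 h4 h4
    · exact (Prod.mk.inj h).1
    · exact (h3.ne (Prod.mk.inj h).1).elim
    · exact (h4.ne (Prod.mk.inj h).1.symm).elim
    · exact (Prod.mk.inj h).2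
  rw [← card_image_of_injOn hinj, ← card_union_of_disjoint]
  · refine card_le_card (union_subset ?_ ?_)
    · intro p hp
      obtain ⟨hp, hlt⟩ := mem_filter.1 hp
      obtain ⟨h1, h2⟩ := mem_product.1 hp
      exact mem_filter.2 ⟨mem_product.2 ⟨mem_of_mem_erase h1, mem_of_mem_erase h2⟩, hlt⟩
    · intro p hp
      obtain ⟨y, hy, rfl⟩ := mem_image.1 hp
      obtain ⟨hyC, hadj⟩ := mem_filter.1 hy
      have hadj : x ⊂ y ∨ y ⊂ x := hadj
      split_ifs with h
      · exact mem_filter.2 ⟨mem_product.2 ⟨hyC, hx⟩, h⟩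
      · exact mem_filter.2 ⟨mem_product.2 ⟨hx, hyC⟩, hadj.resolve_right h⟩
  · rw [disjoint_left]
    intro p hp hp'
    obtain ⟨y, -, rfl⟩ := mem_image.1 hp'
    have := mem_product.1 (mem_filter.1 hp).1
    split_ifs at this
    · exact (mem_erase.1 this.2).1 rfl
    · exact (mem_erase.1 this.1).1 rfl

lemma two_mul_card_strictPairs_le (C : Finset (Finset X)) :
    2 * #(strictPairs C) ≤ #(adjPairs (comparabilityGraph X) C) := by
  rw [two_mul]
  nth_rw 2 [← card_map (Equiv.prodComm _ _).toEmbedding]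
  rw [← card_union_of_disjoint]
  · refine card_le_card (union_subset ?_ ?_)
    · intro p hp
      obtain ⟨hp, hlt⟩ := mem_filter.1 hp
      exact mem_filter.2 ⟨hp, Or.inl hlt⟩
    · intro p hp
      obtain ⟨q, hq, rfl⟩ := mem_map.1 hp
      obtain ⟨hq, hlt⟩ := mem_filter.1 hq
      obtain ⟨h1, h2⟩ := mem_product.1 hq
      exact mem_filter.2 ⟨mem_product.2 ⟨h2, h1⟩, Or.inr hlt⟩
  · rw [disjoint_left]
    intro p hp hp'
    obtain ⟨q, hq, rfl⟩ := mem_map.1 hp'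
    exact ssubset_asymm (mem_filter.1 hp).2 (mem_filter.1 hq).2

variable [Fintype X]

lemma mul_factorial_mul_factorial_le {a b : ℕ} (ha : 0 < a) (hab : a < b) :
    b * (a ! * (b - a)!) ≤ b ! := by
  have h : ∀ b, a < b → b ≤ b.choose a := by
    intro b hb
    induction b, hb using Nat.le_induction with
    | base => simp
    | succ b hb ih =>
      obtain ⟨a, rfl⟩ := Nat.exists_eq_succ_of_ne_zero ha.ne'
      rw [Nat.choose_succ_succ]
      have : 0 < b.choose a := Nat.choose_pos (by omega)
      simp only [Nat.succ_eq_add_one] at *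
      omega
  rw [← Nat.choose_mul_factorial_mul_factorial hab.le, mul_assoc]
  exact Nat.mul_le_mul_right _ (h b hab)

lemma card_prefixed_inter_prefixed_le {u v : Finset X} (huv : u ⊆ v) :
    #(prefixed u ∩ prefixed v) ≤ (#u)! * (#v - #u)! * (Fintype.card X - #v)! := by
  set u' : Finset v := univ.filter fun x => (x : X) ∈ u with hu'
  have hcard : #u' = #u := by
    rw [hu', ← card_map (Function.Embedding.subtype _)]
    congr 1
    ext x
    simp only [mem_map, mem_filter, mem_univ, true_and, Function.Embedding.subtype_apply,
      Subtype.exists, exists_and_right, exists_eq_right]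
    exact ⟨fun ⟨_, h⟩ => h, fun h => ⟨huv h, h⟩⟩
  have hsub : prefixed u ∩ prefixed v ⊆
      (prefixed u' ×ˢ (univ : Finset (Numbering ↑(vᶜ)))).image
        fun p => ((prefixedEquiv v).symm p : Numbering X) := by
    intro f hf
    rw [mem_inter] at hf
    refine mem_image.2 ⟨prefixedEquiv v ⟨f, hf.2⟩, ?_, by rw [Equiv.symm_apply_apply]⟩
    refine mem_product.2 ⟨mem_prefixed.2 fun x => ?_, mem_univ _⟩
    rw [hcard, hu', mem_filter]
    simpa [prefixedEquiv] using mem_prefixed.1 hf.1 x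
  refine (card_le_card hsub).trans (card_image_le.trans ?_)
  rw [card_product, card_prefixed, hcard, card_univ, Fintype.card_numbering, Fintype.card_coe,
    Fintype.card_coe, card_compl]

lemma card_mul_card_prefixed_inter_le_right {u v : Finset X} (huv : u ⊂ v) (hu : u ≠ ∅) :
    #v * #(prefixed u ∩ prefixed v) ≤ #(prefixed v) := by
  rw [card_prefixed]
  calc _ ≤ #v * ((#u)! * (#v - #u)! * (Fintype.card X - #v)!) :=
        Nat.mul_le_mul_left _ (card_prefixed_inter_prefixed_le huv.subset)
    _ = #v * ((#u)! * (#v - #u)!) * (Fintype.card X - #v)! := by ring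
    _ ≤ _ := Nat.mul_le_mul_right _ (mul_factorial_mul_factorial_le
        (card_pos.2 (nonempty_iff_ne_empty.2 hu)) (card_lt_card huv))

lemma card_mul_card_prefixed_inter_le_left {u v : Finset X} (huv : u ⊂ v) (hv : v ≠ univ) :
    (Fintype.card X - #u) * #(prefixed u ∩ prefixed v) ≤ #(prefixed u) := by
  have h1 := card_lt_card huv
  have h2 : #v < Fintype.card X := (card_lt_iff_ne_univ v).2 hv
  rw [card_prefixed]
  calc _ ≤ (Fintype.card X - #u) * ((#u)! * (#v - #u)! * (Fintype.card X - #v)!) :=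
        Nat.mul_le_mul_left _ (card_prefixed_inter_prefixed_le huv.subset)
    _ = (#u)! * ((Fintype.card X - #u) *
          ((#v - #u)! * (Fintype.card X - #u - (#v - #u))!)) := by
        rw [show Fintype.card X - #u - (#v - #u) = Fintype.card X - #v by omega]
        ring
    _ ≤ _ := Nat.mul_le_mul_left _ (mul_factorial_mul_factorial_le (by omega) (by omega))

/-- A chain of `t` sets contains at least `t - 1` comparable pairs; averaged over all maximal
chains. -/
lemma sum_card_prefixed_le (C : Finset (Finset X)) :
    ∑ v ∈ C, #(prefixed v) ≤
      (Fintype.card X)! + ∑ p ∈ strictPairs C, #(prefixed p.1 ∩ prefixed p.2) := by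
  have hchain : ∀ f : Numbering X, #(C.filter fun v => f ∈ prefixed v) ≤
      1 + #((strictPairs C).filter fun p => f ∈ prefixed p.1 ∩ prefixed p.2) := by
    intro f
    rcases (C.filter fun v => f ∈ prefixed v).eq_empty_or_nonempty with h | h
    · rw [h, card_empty]
      exact Nat.zero_le _
    obtain ⟨w, hw, hmin⟩ := exists_min_image _ card h
    rw [← card_erase_add_one hw, add_comm]
    refine Nat.add_le_add_left (card_le_card_of_injOn (fun v => (w, v)) ?_ ?_) 1
    · intro v hv
      have hv' := mem_erase.1 (mem_coe.1 hv)
      have hvC := mem_filter.1 hv'.2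
      have hwC := mem_filter.1 hw
      refine mem_coe.2 (mem_filter.2 ⟨mem_filter.2 ⟨mem_product.2 ⟨hwC.1, hvC.1⟩, ?_⟩,
        mem_inter.2 ⟨hwC.2, hvC.2⟩⟩)
      exact ((mem_prefixed.1 hwC.2).subset_of_card_le_card (mem_prefixed.1 hvC.2)
        (hmin v hv'.2)).ssubset_of_ne hv'.1.symm
    · intro v _ v' _ h
      exact (Prod.mk.inj h).2
  have hs : ∀ S : Finset (Numbering X), #S = ∑ f : Numbering X, if f ∈ S then 1 else 0 := by
    intro S; simp
  calc ∑ v ∈ C, #(prefixed v) = ∑ f : Numbering X, #(C.filter fun v => f ∈ prefixed v) := by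
        simp_rw [hs, card_filter]
        exact sum_comm
    _ ≤ ∑ f : Numbering X,
          (1 + #((strictPairs C).filter fun p => f ∈ prefixed p.1 ∩ prefixed p.2)) :=
        sum_le_sum fun f _ => hchain f
    _ = _ := by
        rw [sum_add_distrib]
        congr 1
        · simp
        · simp_rw [hs, card_filter]
          exact sum_comm

lemma card_prefixed_mul_choose (v : Finset X) :
    #(prefixed v) * (Fintype.card X).choose #v = (Fintype.card X)! := by
  rw [card_prefixed, ← Nat.choose_mul_factorial_mul_factorial v.card_le_univ]
  ring

lemma card_mul_le_of_low_degree {C : Finset (Finset X)} (h0 : ∅ ∉ C) (h1 : univ ∉ C)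
    (hdeg : ∀ x ∈ C, 2 * #(nbrs (comparabilityGraph X) C x) ≤ Fintype.card X) :
    #C * Fintype.card X ≤
      (Fintype.card X).choose (Fintype.card X / 2) * Fintype.card X + 2 * #(strictPairs C) := by
  set n := Fintype.card X with hn
  set N := n.choose (n / 2) with hN
  let e : Finset X × Finset X → Finset X := fun p => if n ≤ 2 * #p.2 then p.2 else p.1
  have heC : ∀ p ∈ strictPairs C, e p ∈ C := by
    intro p hp
    have := mem_product.1 (mem_filter.1 hp).1
    simp only [e]
    split_ifs
    exacts [this.2, this.1]
  have hpair : ∀ p ∈ strictPairs C,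
      n * #(prefixed p.1 ∩ prefixed p.2) ≤ 2 * #(prefixed (e p)) := by
    intro p hp
    obtain ⟨hpC, hlt⟩ := mem_filter.1 hp
    obtain ⟨hp1, hp2⟩ := mem_product.1 hpC
    simp only [e]
    split_ifs with h
    · have := card_mul_card_prefixed_inter_le_right hlt (fun h => h0 (h ▸ hp1))
      nlinarith
    · have := card_mul_card_prefixed_inter_le_left hlt (fun h => h1 (h ▸ hp2))
      have hc := card_lt_card hlt
      have : n ≤ 2 * (n - #p.1) := by omega
      nlinarith
  have hfib : ∀ v ∈ C, #((strictPairs C).filter fun p => e p = v) ≤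
      #(nbrs (comparabilityGraph X) C v) := by
    intro v hv
    refine card_le_card_of_injOn (fun p => if p.2 = v then p.1 else p.2) ?_ ?_
    · intro p hp
      obtain ⟨hp, hpv⟩ := mem_filter.1 (mem_coe.1 hp)
      obtain ⟨hpC, hlt⟩ := mem_filter.1 hp
      obtain ⟨hp1, hp2⟩ := mem_product.1 hpC
      refine mem_coe.2 (mem_filter.2 ?_)
      dsimp only
      split_ifs with h
      · exact ⟨hp1, Or.inr (h ▸ hlt)⟩
      · have : p.1 = v := by
          simp only [e] at hpv
          split_ifs at hpv
          · exact (h hpv).elim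
          · exact hpv
        exact ⟨hp2, Or.inl (this ▸ hlt)⟩
    · have key : ∀ p, p ∈ (strictPairs C).filter (fun p => e p = v) → p.1 ⊂ p.2 ∧
          (p.2 = v ∨ p.1 = v) := by
        intro p hp
        obtain ⟨hp, hpv⟩ := mem_filter.1 hp
        refine ⟨(mem_filter.1 hp).2, ?_⟩
        simp only [e] at hpv
        split_ifs at hpv
        exacts [Or.inl hpv, Or.inr hpv]
      rintro ⟨a, b⟩ hp ⟨a', b'⟩ hp' h
      obtain ⟨hlt, hor⟩ := key _ (mem_coe.1 hp)
      obtain ⟨hlt', hor'⟩ := key _ (mem_coe.1 hp')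
      dsimp only at *
      split_ifs at h with h1 h2 h2
      · rw [h, h1, h2]
      · obtain rfl := hor'.resolve_left h2
        subst h1 h
        exact (ssubset_asymm hlt hlt').elim
      · obtain rfl := hor.resolve_left h1
        subst h2 h
        exact (ssubset_asymm hlt hlt').elim
      · rw [h, hor.resolve_left h1, hor'.resolve_left h2]
  have hsum : ∑ p ∈ strictPairs C, #(prefixed (e p)) =
      ∑ v ∈ C, #((strictPairs C).filter fun p => e p = v) * #(prefixed v) := by
    rw [← sum_fiberwise_of_maps_to heC]
    refine sum_congr rfl fun v _ => ?_
    rw [sum_congr rfl (g := fun _ => #(prefixed v)) fun p hp => by rw [(mem_filter.1 hp).2],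
      sum_const, smul_eq_mul]
  have hcount : ∑ v ∈ C, #((strictPairs C).filter fun p => e p = v) = #(strictPairs C) :=
    (card_eq_sum_card_fiberwise heC).symm
  set m : Finset X → ℕ := fun v => #((strictPairs C).filter fun p => e p = v) with hm
  have hmain : n * ∑ v ∈ C, #(prefixed v) ≤ n * n ! + 2 * ∑ v ∈ C, m v * #(prefixed v) := by
    rw [← hsum, mul_sum (strictPairs C)]
    refine (Nat.mul_le_mul_left n (sum_card_prefixed_le C)).trans ?_
    rw [mul_add, mul_sum (strictPairs C)]
    exact Nat.add_le_add_left (sum_le_sum hpair) _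
  have hweight : (n ! : ℤ) * ∑ v ∈ C, ((n : ℤ) - 2 * m v) ≤ n ! * (N * n) := by
    calc (n ! : ℤ) * ∑ v ∈ C, ((n : ℤ) - 2 * m v)
        ≤ ∑ v ∈ C, (N : ℤ) * (#(prefixed v) * ((n : ℤ) - 2 * m v)) := by
          rw [mul_sum]
          refine sum_le_sum fun v hv => ?_
          have h2 : n ! ≤ N * #(prefixed v) := by
            rw [hn, ← card_prefixed_mul_choose v, mul_comm]
            exact Nat.mul_le_mul_right _ (Nat.choose_le_middle _ _)
          have h3 : 2 * m v ≤ n := (Nat.mul_le_mul_left 2 (hfib v hv)).trans (hdeg v hv)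
          have h2' : (n ! : ℤ) ≤ N * #(prefixed v) := by exact_mod_cast h2
          have h3' : (0 : ℤ) ≤ n - 2 * m v := by
            have : ((2 * m v : ℕ) : ℤ) ≤ n := by exact_mod_cast h3
            push_cast at this
            linarith
          rw [← mul_assoc]
          exact mul_le_mul_of_nonneg_right h2' h3'
      _ = N * (n * ∑ v ∈ C, (#(prefixed v) : ℤ) - 2 * ∑ v ∈ C, (m v : ℤ) * #(prefixed v)) := by
          rw [← mul_sum, mul_sum C _ (n : ℤ), mul_sum C _ (2 : ℤ), ← sum_sub_distrib]
          congr 1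
          exact sum_congr rfl fun v _ => by ring
      _ ≤ N * (n * n !) := by
          have : ((n * ∑ v ∈ C, #(prefixed v) : ℕ) : ℤ) ≤
              (n * n ! + 2 * ∑ v ∈ C, m v * #(prefixed v) : ℕ) := by exact_mod_cast hmain
          push_cast at this
          gcongr
          linarith
      _ = _ := by ring
  have hfin := le_of_mul_le_mul_left hweight (by exact_mod_cast Nat.factorial_pos n)
  rw [sum_sub_distrib, ← mul_sum, sum_const, nsmul_eq_mul] at hfin
  have hcount' : ∑ v ∈ C, (m v : ℤ) = #(strictPairs C) := by exact_mod_cast hcount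
  rw [hcount'] at hfin
  zify
  linarith

/-- Supersaturation for Sperner's theorem. -/
theorem card_mul_le_add_strictPairs (hX : 2 ≤ Fintype.card X) (C : Finset (Finset X)) :
    #C * Fintype.card X ≤
      (Fintype.card X).choose (Fintype.card X / 2) * Fintype.card X + 2 * #(strictPairs C) := by
  induction hm : #C using Nat.strong_induction_on generalizing C with
  | _ m ih =>
  subst hm
  by_cases hdeg : ∀ x ∈ C, 2 * #(nbrs (comparabilityGraph X) C x) ≤ Fintype.card X
  · have hbig : ∀ x ∈ C, (∀ y, y ≠ x → (comparabilityGraph X).Adj x y) →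
        #C * Fintype.card X ≤
          (Fintype.card X).choose (Fintype.card X / 2) * Fintype.card X +
            2 * #(strictPairs C) := by
      intro x hx hall
      have h1 : C.erase x ⊆ nbrs (comparabilityGraph X) C x := fun y hy =>
        mem_filter.2 ⟨mem_of_mem_erase hy, hall y (ne_of_mem_erase hy)⟩
      have h2 := card_le_card h1
      rw [card_erase_of_mem hx] at h2
      have h3 := hdeg x hx
      have h4 := Nat.choose_le_middle 1 (Fintype.card X)
      rw [Nat.choose_one_right] at h4
      have h5 : #C ≤ (Fintype.card X).choose (Fintype.card X / 2) := by omega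
      exact (Nat.mul_le_mul_right _ h5).trans (Nat.le_add_right _ _)
    by_cases h0 : ∅ ∈ C
    · exact hbig ∅ h0 fun y hy => Or.inl (empty_ssubset.2 (nonempty_iff_ne_empty.2 hy))
    by_cases h1 : univ ∈ C
    · exact hbig univ h1 fun y hy => Or.inr (ssubset_univ_iff.2 hy)
    exact card_mul_le_of_low_degree h0 h1 hdeg
  · push Not at hdeg
    obtain ⟨x, hx, hlt⟩ := hdeg
    have h1 := ih _ (card_erase_lt_of_mem hx) _ rfl
    have h2 := card_strictPairs_erase_add_le hx
    have h3 := card_erase_add_one hx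
    rw [← h3, add_mul]
    omega

lemma choose_lt_middle {n k : ℕ} (hk : k ≤ n) (h1 : k ≠ n / 2) (h2 : k ≠ (n + 1) / 2) :
    n.choose k < n.choose (n / 2) := by
  have low : ∀ k, k < n / 2 → n.choose k < n.choose (n / 2) := by
    intro k hk
    refine lt_of_lt_of_le ?_ (Nat.choose_le_middle (k + 1) n)
    have h := Nat.choose_succ_right_eq n k
    have hpos : 0 < n.choose k := Nat.choose_pos (by omega)
    have h3 : k + 1 < n - k := by omega
    by_contra! hle
    have := Nat.mul_le_mul_right (k + 1) hle
    have := Nat.mul_lt_mul_of_pos_left h3 hpos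
    omega
  rcases lt_or_ge k (n / 2) with h | h
  · exact low k h
  · rw [← Nat.choose_symm hk]
    exact low _ (by omega)

lemma exists_numbering_isPrefix_erase {v : Finset X} {y : X} (hy : y ∈ v) :
    ∃ f : Numbering X, IsPrefix f v ∧ IsPrefix f (v.erase y) := by
  have hpos : 0 < #(prefixed v) := by rw [card_prefixed]; positivity
  obtain ⟨f, hf⟩ := card_pos.1 hpos
  rw [mem_prefixed] at hf
  have hv : 0 < #v := card_pos.2 ⟨y, hy⟩
  have hlt : #v - 1 < Fintype.card X := by have := v.card_le_univ; omega
  have hfy := (hf y).1 hy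
  refine ⟨f.trans (Equiv.swap (f y) ⟨#v - 1, hlt⟩), fun x => ?_, fun x => ?_⟩
  · rw [hf x, Equiv.trans_apply]
    rcases eq_or_ne (f x) (f y) with h | h
    · rw [h, Equiv.swap_apply_left]
      exact ⟨fun _ => Nat.sub_lt hv one_pos, fun _ => hfy⟩
    · rcases eq_or_ne (f x) ⟨#v - 1, hlt⟩ with h' | h'
      · rw [h', Equiv.swap_apply_right]
        exact ⟨fun _ => hfy, fun _ => Nat.sub_lt hv one_pos⟩
      · rw [Equiv.swap_apply_of_ne_of_ne h h']
  · rw [card_erase_of_mem hy, mem_erase, hf x, Equiv.trans_apply]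
    rcases eq_or_ne x y with rfl | h
    · rw [Equiv.swap_apply_left]
      simp
    · have hne : f x ≠ f y := fun e => h (f.injective e)
      rcases eq_or_ne (f x) ⟨#v - 1, hlt⟩ with h' | h'
      · rw [h', Equiv.swap_apply_right]
        have : (f y : ℕ) ≠ #v - 1 := fun e => hne (h'.trans (Fin.ext e.symm))
        refine ⟨fun _ => by omega, fun _ => ⟨h, Nat.sub_lt hv one_pos⟩⟩
      · rw [Equiv.swap_apply_of_ne_of_ne hne h']
        have : (f x : ℕ) ≠ #v - 1 := fun e => h' (Fin.ext e)
        exact ⟨fun ⟨_, h2⟩ => by omega, fun h2 => ⟨h, by omega⟩⟩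

/-- Every maximal chain meets an antichain of maximum size. -/
lemma exists_mem_isPrefix_of_card_eq {C : Finset (Finset X)}
    (hC : IsAntichain (· ⊆ ·) (C : Set (Finset X)))
    (hmid : ∀ v ∈ C, (Fintype.card X).choose #v = (Fintype.card X).choose (Fintype.card X / 2))
    (hcard : #C = (Fintype.card X).choose (Fintype.card X / 2)) (f : Numbering X) :
    ∃ v ∈ C, IsPrefix f v := by
  have hpos : 0 < (Fintype.card X).choose (Fintype.card X / 2) :=
    Nat.choose_pos (Nat.div_le_self _ _)
  have hsum : ∑ v ∈ C, #(prefixed v) = (Fintype.card X)! := by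
    refine Nat.eq_of_mul_eq_mul_right hpos ?_
    rw [sum_mul, sum_congr rfl fun v hv => by rw [← hmid v hv, card_prefixed_mul_choose],
      sum_const, hcard, smul_eq_mul, mul_comm]
  have hdisj : (C : Set (Finset X)).PairwiseDisjoint prefixed := fun u hu v hv huv =>
    disjoint_prefixed_prefixed (hC hu hv huv) (hC hv hu huv.symm)
  have huniv : C.biUnion prefixed = univ := by
    rw [← card_eq_iff_eq_univ, card_biUnion hdisj, hsum, Fintype.card_numbering]
  obtain ⟨v, hv, hf⟩ := mem_biUnion.1 (huniv ▸ mem_univ f : f ∈ C.biUnion prefixed)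
  exact ⟨v, hv, mem_prefixed.1 hf⟩

lemma isPrefix_eq_of_card_eq {X : Type*} [Fintype X] {f : Numbering X} {u v : Finset X} (hu : IsPrefix f u)
    (hv : IsPrefix f v) (h : #u = #v) : u = v :=
  (hu.subset_of_card_le_card hv h.le).antisymm (hv.subset_of_card_le_card hu h.ge)

/-- The extremal families in Sperner's theorem are the middle layers. -/
theorem eq_powersetCard_of_card_eq_choose_middle {C : Finset (Finset X)}
    (hC : IsAntichain (· ⊆ ·) (C : Set (Finset X)))
    (hcard : #C = (Fintype.card X).choose (Fintype.card X / 2)) :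
    C = powersetCard (Fintype.card X / 2) univ ∨
      C = powersetCard ((Fintype.card X + 1) / 2) univ := by
  set n := Fintype.card X with hn
  have hpos : 0 < n.choose (n / 2) := Nat.choose_pos (Nat.div_le_self _ _)
  have hmid : ∀ v ∈ C, n.choose #v = n.choose (n / 2) := by
    by_contra! hex
    obtain ⟨w, hw, hwne⟩ := hex
    have hlym := lubell_yamamoto_meshalkin_inequality_sum_inv_choose (𝕜 := ℚ) hC
    have hlt : ∑ v ∈ C, ((n.choose (n / 2) : ℚ))⁻¹ < ∑ v ∈ C, ((n.choose #v : ℚ))⁻¹ := by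
      refine sum_lt_sum (fun v _ => ?_) ⟨w, hw, ?_⟩
      · have : 0 < n.choose #v := Nat.choose_pos v.card_le_univ
        gcongr
        exact Nat.choose_le_middle _ _
      · have : 0 < n.choose #w := Nat.choose_pos w.card_le_univ
        gcongr
        exact lt_of_le_of_ne (Nat.choose_le_middle _ _) hwne
    rw [sum_const, hcard, nsmul_eq_mul,
      mul_inv_cancel₀ (by exact_mod_cast hpos.ne')] at hlt
    exact absurd hlym (not_le.2 hlt)
  have hsize : ∀ v ∈ C, #v = n / 2 ∨ #v = (n + 1) / 2 := by
    intro v hv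
    by_contra! h
    exact (choose_lt_middle v.card_le_univ h.1 h.2).ne (hmid v hv)
  have hchoose : n.choose ((n + 1) / 2) = n.choose (n / 2) := by
    rw [← Nat.choose_symm (Nat.div_le_self n 2)]
    congr 1
    omega
  by_cases hup : ∃ v ∈ C, #v = (n + 1) / 2 ∧ #v ≠ n / 2
  · right
    obtain ⟨v, hv, hvc, hvne⟩ := hup
    have hstep : ∀ v ∈ C, #v = (n + 1) / 2 → ∀ x ∈ v, ∀ y, y ∉ v →
        insert y (v.erase x) ∈ C := by
      intro v hv hvc' x hx y hy
      have hyx : y ∉ v.erase x := fun h => hy (mem_of_mem_erase h)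
      obtain ⟨f, hf1, hf2⟩ := exists_numbering_isPrefix_erase (mem_insert_self y (v.erase x))
      rw [erase_insert hyx] at hf2
      obtain ⟨w, hw, hfw⟩ := exists_mem_isPrefix_of_card_eq hC hmid hcard f
      have hc1 : #(v.erase x) = #v - 1 := card_erase_of_mem hx
      have hc2 : #(insert y (v.erase x)) = #v - 1 + 1 := by rw [card_insert_of_notMem hyx, hc1]
      have hvpos : 0 < #v := card_pos.2 ⟨x, hx⟩
      rcases hsize w hw with h | h
      · have := isPrefix_eq_of_card_eq hfw hf2 (by omega)
        subst this
        exact (hC hw hv (fun e => by rw [e] at hc1; omega) (erase_subset _ _)).elim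
      · rwa [← isPrefix_eq_of_card_eq hfw hf1 (by omega)]
    have hall : ∀ w : Finset X, #w = (n + 1) / 2 → ∀ v ∈ C, #v = (n + 1) / 2 → w ∈ C := by
      intro w hw v hv hvc
      induction hm : #(w \ v) using Nat.strong_induction_on generalizing v with
      | _ m ih =>
      by_cases hsub : w ⊆ v
      · rwa [eq_of_subset_of_card_le hsub (hvc.trans hw.symm).le]
      obtain ⟨y, hyw, hyv⟩ := not_subset.1 hsub
      obtain ⟨x, hxv, hxw⟩ : ∃ x ∈ v, x ∉ w := not_subset.1 fun h =>
        hsub (eq_of_subset_of_card_le h (hw.trans hvc.symm).le).ge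
      have hyx : y ∉ v.erase x := fun h => hyv (mem_of_mem_erase h)
      refine ih _ ?_ (insert y (v.erase x)) (hstep v hv hvc x hxv y hyv) ?_ rfl
      · rw [← hm]
        refine card_lt_card (ssubset_iff_of_subset ?_ |>.2 ⟨y, mem_sdiff.2 ⟨hyw, hyv⟩, ?_⟩)
        · intro z hz
          rw [mem_sdiff, mem_insert, mem_erase] at hz
          refine mem_sdiff.2 ⟨hz.1, fun hzv => hz.2 (Or.inr ⟨?_, hzv⟩)⟩
          rintro rfl
          exact hxw hz.1
        · simp
      · rw [card_insert_of_notMem hyx, card_erase_add_one hxv, hvc]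
    refine (eq_of_subset_of_card_le (fun w hw => hall w (mem_powersetCard.1 hw).2 v hv hvc) ?_).symm
    rw [card_powersetCard, card_univ, ← hn, hchoose, hcard]
  · left
    push Not at hup
    refine eq_of_subset_of_card_le (fun w hw => mem_powersetCard.2 ⟨subset_univ _, ?_⟩) ?_
    · exact (hsize w hw).elim id (hup w hw)
    · rw [card_powersetCard, card_univ, ← hn, hcard]

end Boolean

lemma isRKColouring_two_iff {n r : ℕ} {F : Finset (Finset (Fin n))} {c : {A // A ∈ F} → Fin r} :
    IsRKColouring 2 F c ↔
      ∀ x y : {A // A ∈ F}, (x : Finset (Fin n)) ⊂ (y : Finset (Fin n)) → c x ≠ c y := by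
  constructor
  · intro h x y hxy heq
    obtain ⟨i, j, hij⟩ := h ![x, y] (by
      intro i j hij
      fin_cases i <;> fin_cases j <;> simp_all)
    fin_cases i <;> fin_cases j <;> simp_all
  · intro h ch hch
    exact ⟨0, 1, h _ _ (hch 0 1 (by decide))⟩

lemma numColourings_three_two_eq {n : ℕ} (F : Finset (Finset (Fin n))) :
    numColourings 3 2 n F = #(properColourings (comparabilityGraph (Fin n)) F) := by
  rw [← Fintype.card_coe, ← Nat.card_eq_fintype_card]
  refine Nat.card_congr
    { toFun c := ⟨fun A => if h : A ∈ F then c.1 ⟨A, h⟩ else 0, ?_⟩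
      invFun c := ⟨fun A => c.1 A.1, ?_⟩
      left_inv c := ?_
      right_inv c := ?_ }
  · refine mem_filter.2 ⟨mem_univ _, fun x hx => dif_neg hx, fun x hx y hy hxy => ?_⟩
    have hc := isRKColouring_two_iff.1 c.2
    dsimp only
    rw [dif_pos hx, dif_pos hy]
    exact hxy.elim (fun h => hc ⟨x, hx⟩ ⟨y, hy⟩ h) (fun h => (hc ⟨y, hy⟩ ⟨x, hx⟩ h).symm)
  · exact isRKColouring_two_iff.2 fun x y hxy =>
      (mem_filter.1 c.2).2.2 x.1 x.2 y.1 y.2 (Or.inl hxy)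
  · ext A
    simp
  · ext A
    by_cases hA : A ∈ F
    · simp [hA]
    · simp [hA, (mem_filter.1 c.2).2.1 A hA]

lemma card_powersetCard_middle {n : ℕ} :
    #(powersetCard (n / 2) (univ : Finset (Fin n))) = n.choose (n / 2) ∧
      #(powersetCard ((n + 1) / 2) (univ : Finset (Fin n))) = n.choose (n / 2) := by
  simp only [card_powersetCard, card_univ, Fintype.card_fin, true_and]
  rw [← Nat.choose_symm (Nat.div_le_self n 2)]
  congr 1
  omega

end ErdosRothschild

open ErdosRothschild Finset

/-- For all sufficiently large `n`, every family `𝓕 ⊆ 2^[n]` has at most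
`3^(C(n,⌊n/2⌋))` `(3,2)`-colourings, with equality iff `𝓕` is the family of all
`⌊n/2⌋`-subsets or all `⌈n/2⌉`-subsets of `[n]`. -/
theorem erdos_rothschild_three_colours :
    ∃ n₀ : ℕ, ∀ n : ℕ, n₀ ≤ n → ∀ F : Finset (Finset (Fin n)),
      numColourings 3 2 n F ≤ 3 ^ (n.choose (n / 2)) ∧
      (numColourings 3 2 n F = 3 ^ (n.choose (n / 2)) ↔
        F = Finset.powersetCard (n / 2) (Finset.univ : Finset (Fin n)) ∨
        F = Finset.powersetCard ((n + 1) / 2) (Finset.univ : Finset (Fin n))) := by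
  refine ⟨800000, fun n hn F => ?_⟩
  have hn0 : (0 : ℝ) < n := by
    have : 0 < n := by omega
    exact_mod_cast this
  have hcard : Fintype.card (Fin n) = n := Fintype.card_fin n
  rw [numColourings_three_two_eq]
  by_cases hedge : ∃ x ∈ F, ∃ y ∈ F, (comparabilityGraph (Fin n)).Adj x y
  · have hlt : #(properColourings (comparabilityGraph (Fin n)) F) < 3 ^ n.choose (n / 2) := by
      have h := card_properColourings_lt (d := 2000) le_rfl (η := 1 / n) (by positivity)
        (by
          have : (800000 : ℝ) ≤ n := by exact_mod_cast hn
          rw [one_div, inv_mul_eq_div, ← mul_div_assoc, div_le_div_iff₀ hn0 (by norm_num)]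
          push_cast
          linarith) F (n.choose (n / 2)) (fun C _ => by
          have h1 := card_mul_le_add_strictPairs (X := Fin n) (by omega) C
          have h2 := two_mul_card_strictPairs_le C
          rw [hcard] at h1
          have h3 : (#C : ℝ) * n ≤ n.choose (n / 2) * n +
              #(adjPairs (comparabilityGraph (Fin n)) C) := by
            exact_mod_cast h1.trans (Nat.add_le_add_left h2 _)
          rw [← mul_le_mul_iff_left₀ hn0, add_mul, mul_right_comm, one_div,
            inv_mul_cancel₀ hn0.ne', one_mul]
          exact h3) hedge
      rw [Real.rpow_natCast] at h
      exact_mod_cast h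
    refine ⟨hlt.le, fun h => (hlt.ne h).elim, fun h => ?_⟩
    obtain ⟨x, hx, y, hy, hxy⟩ := hedge
    have hxy : x ⊂ y ∨ y ⊂ x := hxy
    have hne : #x ≠ #y := by
      rcases hxy with h | h
      · exact (card_lt_card h).ne
      · exact (card_lt_card h).ne'
    rcases h with rfl | rfl <;>
    exact (hne ((mem_powersetCard.1 hx).2.trans (mem_powersetCard.1 hy).2.symm)).elim
  · push Not at hedge
    rw [card_properColourings_of_independent hedge]
    have hanti : IsAntichain (· ⊆ ·) (F : Set (Finset (Fin n))) := fun x hx y hy hne hsub =>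
      hedge x hx y hy (Or.inl (hsub.ssubset_of_ne hne))
    have hle := hanti.sperner
    rw [hcard] at hle
    refine ⟨Nat.pow_le_pow_right (by norm_num) hle, fun h => ?_, fun h => ?_⟩
    · have hF : #F = n.choose (n / 2) := Nat.pow_right_injective (by norm_num) h
      simpa only [hcard] using eq_powersetCard_of_card_eq_choose_middle hanti (by rw [hcard, hF])
    · congr 1
      rcases h with rfl | rfl
      · exact card_powersetCard_middle.1
      · exact card_powersetCard_middle.2
end

section
/- There exists an absolute constant C > 0 such that for all integers n and k with k ≥ 2 and n ≥ C·k⁴·log₂ k, the number of (2,k)-colourings of any family 𝓕 ⊆ 2^[n] is at most 2^(m_{k-1}). Moreover, equality holds if and only if 𝓕 is a k-chain-free family of maximum size, i.e. a family of m_{k-1} subsets of [n] containing no k-chain. -/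
namespace ErdosRothschild

open Finset

section Rank

variable {P : Type*} [PartialOrder P]

open Classical in
/-- The largest size of a chain in `T` all of whose members lie strictly below `a`. -/
noncomputable def chainRank (T : Finset P) (a : P) : ℕ :=
  ((T.filter (· < a)).powerset.filter fun C : Finset P => IsChain (· ≤ ·) (C : Set P)).sup card

lemma card_le_chainRank {T C : Finset P} {a : P} (hCT : C ⊆ T)
    (hC : IsChain (· ≤ ·) (C : Set P)) (hlt : ∀ x ∈ C, x < a) : C.card ≤ chainRank T a := by
  classical
  unfold chainRank
  refine Finset.le_sup (f := card) ?_
  simp only [mem_filter, mem_powerset]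
  exact ⟨fun x hx => mem_filter.2 ⟨hCT hx, hlt x hx⟩, hC⟩

lemma exists_chain_card_eq_chainRank (T : Finset P) (a : P) :
    ∃ C ⊆ T, IsChain (· ≤ ·) (C : Set P) ∧ (∀ x ∈ C, x < a) ∧ C.card = chainRank T a := by
  classical
  obtain ⟨C, hC, h⟩ := Finset.exists_mem_eq_sup
    ((T.filter (· < a)).powerset.filter fun C : Finset P => IsChain (· ≤ ·) (C : Set P))
    ⟨∅, by simp⟩ card
  simp only [mem_filter, mem_powerset] at hC
  exact ⟨C, fun x hx => (mem_filter.1 (hC.1 hx)).1, hC.2,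
    fun x hx => (mem_filter.1 (hC.1 hx)).2, h.symm⟩

lemma chainRank_mono (T : Finset P) {a b : P} (h : a ≤ b) : chainRank T a ≤ chainRank T b := by
  obtain ⟨C, h1, h2, h3, h4⟩ := exists_chain_card_eq_chainRank T a
  exact h4 ▸ card_le_chainRank h1 h2 fun x hx => (h3 x hx).trans_le h

open Classical in
lemma isChain_insert_of_lt {C : Finset P} {a : P} (hC : IsChain (· ≤ ·) (C : Set P))
    (hlt : ∀ x ∈ C, x < a) : IsChain (· ≤ ·) ((insert a C : Finset P) : Set P) := by
  rw [coe_insert]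
  exact hC.insert fun b hb _ => Or.inr (hlt b hb).le

lemma chainRank_lt_of_mem {T : Finset P} {a b : P} (ha : a ∈ T) (hab : a < b) :
    chainRank T a < chainRank T b := by
  classical
  obtain ⟨C, h1, h2, h3, h4⟩ := exists_chain_card_eq_chainRank T a
  have hn : a ∉ C := fun h => lt_irrefl _ (h3 a h)
  have := card_le_chainRank (T := T) (a := b) (C := insert a C)
    (insert_subset ha h1) (isChain_insert_of_lt h2 h3)
    (fun x hx => by
      rcases mem_insert.1 hx with rfl | hx
      · exact hab
      · exact (h3 x hx).trans hab)
  rw [card_insert_of_notMem hn] at this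
  omega

open Classical in
/-- If `v` and `v'` both lie in `S` and adjoining either of them raises the rank of `b` from `r`
although its own rank is `r`, then they coincide. -/
lemma eq_of_chainRank_erase {S : Finset P} {v v' b : P} {r : ℕ} (hv : v ∈ S) (hv' : v' ∈ S)
    (hvb' : v' < b)
    (h1 : chainRank (S.erase v) v = r) (h2 : chainRank (S.erase v) b = r)
    (h1' : chainRank (S.erase v') v' = r) (h2' : chainRank (S.erase v') b = r) : v = v' := by
  by_contra hne
  obtain ⟨C, c1, c2, c3, c4⟩ := exists_chain_card_eq_chainRank (S.erase v') v'
  by_cases hvC : v ∈ C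
  · obtain ⟨D, d1, d2, d3, d4⟩ := exists_chain_card_eq_chainRank (S.erase v) v
    have hvv' : v < v' := c3 v hvC
    have hD : D ⊆ S.erase v' := fun x hx =>
      mem_erase.2 ⟨((d3 x hx).trans hvv').ne, (mem_erase.1 (d1 hx)).2⟩
    have e1 : r ≤ chainRank (S.erase v') v := by
      rw [← h1, ← d4]; exact card_le_chainRank hD d2 d3
    have e2 := chainRank_lt_of_mem (T := S.erase v') (mem_erase.2 ⟨hne, hv⟩) hvv'
    omega
  · have hC : C ⊆ S.erase v := fun x hx =>
      mem_erase.2 ⟨fun h => hvC (h ▸ hx), (mem_erase.1 (c1 hx)).2⟩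
    have e1 : r ≤ chainRank (S.erase v) v' := by
      rw [← h1', ← c4]; exact card_le_chainRank hC c2 c3
    have e2 := chainRank_lt_of_mem (T := S.erase v) (mem_erase.2 ⟨Ne.symm hne, hv'⟩) hvb'
    omega

lemma chainRank_congr {S T : Finset P} {a : P} (h : ∀ x < a, x ∈ S ↔ x ∈ T) :
    chainRank S a = chainRank T a := by
  classical
  unfold chainRank
  have : S.filter (· < a) = T.filter (· < a) := by
    ext x; simp only [mem_filter]
    constructor
    · rintro ⟨h1, h2⟩; exact ⟨(h x h2).1 h1, h2⟩
    · rintro ⟨h1, h2⟩; exact ⟨(h x h2).2 h1, h2⟩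
  rw [this]

end Rank

section Declared

variable {P : Type*} [PartialOrder P]

open Classical in
/-- The number of members of `C` that lie above `v`, including `v` itself. -/
noncomputable def upCount (C : Finset P) (v : P) : ℕ := #{u ∈ C | v ≤ u}

/-- On the chain `C`, the sample `T` of one colour class suggests that `v` does not have that
colour. -/
def Declared (k : ℕ) (C T : Finset P) (v : P) : Prop :=
  v ∈ C ∧ k ≤ upCount C v + chainRank T v ∧
    ∀ b ∈ C, v < b → (∀ d ∈ C, v < d → b ≤ d) → chainRank T b = chainRank T v

lemma exists_next {C : Finset P} (hC : IsChain (· ≤ ·) (C : Set P)) {v w : P}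
    (hw : w ∈ C) (hvw : v < w) : ∃ b ∈ C, v < b ∧ ∀ d ∈ C, v < d → b ≤ d := by
  classical
  obtain ⟨b, hb, hmin⟩ := Finset.exists_minimal (s := C.filter (v < ·)) ⟨w, by simp [hw, hvw]⟩
  simp only [mem_filter] at hb
  refine ⟨b, hb.1, hb.2, fun d hd hvd => ?_⟩
  rcases hC.total hb.1 hd with h | h
  · exact h
  · exact hmin (by simp [hd, hvd]) h

lemma upCount_next {C : Finset P} {v b : P} (hv : v ∈ C)
    (hvb : v < b) (hnext : ∀ d ∈ C, v < d → b ≤ d) : upCount C v = upCount C b + 1 := by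
  classical
  unfold upCount
  have : C.filter (v ≤ ·) = insert v (C.filter (b ≤ ·)) := by
    ext d
    simp only [mem_filter, mem_insert]
    constructor
    · rintro ⟨h1, h2⟩
      rcases h2.eq_or_lt with h | h
      · exact Or.inl h.symm
      · exact Or.inr ⟨h1, hnext d h1 h⟩
    · rintro (rfl | ⟨h1, h2⟩)
      · exact ⟨hv, le_rfl⟩
      · exact ⟨h1, hvb.le.trans h2⟩
  rw [this, card_insert_of_notMem]
  simp only [mem_filter, not_and]
  exact fun _ h => absurd hvb (not_lt_of_ge h)

lemma Declared.exists_next {k : ℕ} {C T : Finset P} {v : P} (hC : IsChain (· ≤ ·) (C : Set P))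
    (h : Declared k C T v) (hr : chainRank T v + 2 ≤ k) :
    ∃ b ∈ C, v < b ∧ (∀ d ∈ C, v < d → b ≤ d) ∧ chainRank T b = chainRank T v := by
  classical
  obtain ⟨hvC, hk, hn⟩ := h
  have hex : ∃ w ∈ C, v < w := by
    by_contra hno
    push Not at hno
    have : upCount C v ≤ 1 := by
      unfold upCount
      rw [card_le_one]
      have : ∀ a ∈ C.filter (v ≤ ·), a = v := fun a ha => by
        simp only [mem_filter] at ha
        by_contra hne
        exact hno a ha.1 (lt_of_le_of_ne ha.2 (Ne.symm hne))
      intro a ha b hb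
      rw [this a ha, this b hb]
    omega
  obtain ⟨w, hw, hvw⟩ := hex
  obtain ⟨b, hb, hvb, hnext⟩ := ErdosRothschild.exists_next hC hw hvw
  exact ⟨b, hb, hvb, hnext, hn b hb hvb hnext⟩

lemma Declared.notMem {k : ℕ} {C T : Finset P} {v : P} (hC : IsChain (· ≤ ·) (C : Set P))
    (h : Declared k C T v) (hr : chainRank T v + 2 ≤ k) : v ∉ T := fun hv => by
  obtain ⟨b, -, hvb, -, hb⟩ := h.exists_next hC hr
  exact (chainRank_lt_of_mem hv hvb).ne' hb

open Classical in
lemma upCount_add_chainRank_le {k : ℕ} {C T : Finset P} (hC : IsChain (· ≤ ·) (C : Set P))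
    (hT : ∀ v, chainRank T v < k) {v : P} (hv : v ∈ C) :
    upCount C v + chainRank T v + 1 ≤ k + #{u ∈ C | v ≤ u ∧ Declared k C T u} := by
  induction h : upCount C v using Nat.strong_induction_on generalizing v with
  | _ m ih =>
  subst h
  by_cases hex : ∃ w ∈ C, v < w
  · obtain ⟨w, hw, hvw⟩ := hex
    obtain ⟨b, hb, hvb, hnext⟩ := exists_next hC hw hvw
    have hU := upCount_next hv hvb hnext
    have hih := ih _ (by omega) hb rfl
    have hmono := chainRank_mono T hvb.le
    have hsub : ({u ∈ C | b ≤ u ∧ Declared k C T u} : Finset P) ⊆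
        {u ∈ C | v ≤ u ∧ Declared k C T u} := fun u hu => by
      simp only [mem_filter] at hu ⊢
      exact ⟨hu.1, hvb.le.trans hu.2.1, hu.2.2⟩
    have hcard := card_le_card hsub
    rcases hmono.lt_or_eq with hlt | heq
    · omega
    by_cases hk : k ≤ upCount C v + chainRank T v
    · have hdec : Declared k C T v := by
        refine ⟨hv, hk, fun b' hb' hvb' hnext' => ?_⟩
        have : b' = b := le_antisymm (hnext' b hb hvb) (hnext b' hb' hvb')
        rw [this, heq]
      have hss : insert v ({u ∈ C | b ≤ u ∧ Declared k C T u} : Finset P) ⊆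
          {u ∈ C | v ≤ u ∧ Declared k C T u} :=
        insert_subset (by simp [hv, hdec]) hsub
      have hc := card_le_card hss
      rw [card_insert_of_notMem] at hc
      · omega
      · simp only [mem_filter, not_and]
        exact fun _ h => absurd hvb (not_lt_of_ge h)
    · omega
  · push Not at hex
    have hU : upCount C v = 1 := by
      unfold upCount
      rw [card_eq_one]
      refine ⟨v, ?_⟩
      ext u
      simp only [mem_filter, mem_singleton]
      constructor
      · rintro ⟨h1, h2⟩
        by_contra hne
        exact hex u h1 (lt_of_le_of_ne h2 (Ne.symm hne))
      · rintro rfl; exact ⟨hv, le_rfl⟩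
    have h1 := hT v
    by_cases hk : k ≤ upCount C v + chainRank T v
    · have hdec : Declared k C T v := ⟨hv, hk, fun b hb hvb => absurd hvb (hex b hb)⟩
      have : 0 < #{u ∈ C | v ≤ u ∧ Declared k C T u} :=
        card_pos.2 ⟨v, by simp [hv, hdec]⟩
      omega
    · omega

open Classical in
lemma card_add_one_le_declared {k : ℕ} (hk : 0 < k) {C T : Finset P}
    (hC : IsChain (· ≤ ·) (C : Set P)) (hT : ∀ v, chainRank T v < k) :
    C.card + 1 ≤ k + #{u ∈ C | Declared k C T u} := by
  rcases C.eq_empty_or_nonempty with rfl | hne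
  · simp; omega
  obtain ⟨v, hv, hmin⟩ := Finset.exists_minimal hne
  have hall : ∀ u ∈ C, v ≤ u := fun u hu => by
    rcases hC.total hv hu with h | h
    · exact h
    · exact hmin hu h
  have h := upCount_add_chainRank_le hC hT hv
  have hU : upCount C v = C.card := by
    unfold upCount
    rw [filter_true_of_mem hall]
  have hc : #{u ∈ C | v ≤ u ∧ Declared k C T u} ≤ #{u ∈ C | Declared k C T u} :=
    card_le_card fun u hu => by
      simp only [mem_filter] at hu ⊢
      exact ⟨hu.1, hu.2.2⟩
  omega

open Classical in
lemma card_rank_window_le {k : ℕ} {C T : Finset P} (hC : IsChain (· ≤ ·) (C : Set P))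
    (hT : ∀ v, chainRank T v < k) {b : P} (hb : b ∈ C) :
    #{r ∈ range k | r + 1 ≤ chainRank T b ∧ k ≤ upCount C b + r + 1} ≤
      #{u ∈ C | Declared k C T u} := by
  have h := upCount_add_chainRank_le hC hT hb
  have hc : #{u ∈ C | b ≤ u ∧ Declared k C T u} ≤ #{u ∈ C | Declared k C T u} :=
    card_le_card fun u hu => by
      simp only [mem_filter] at hu ⊢
      exact ⟨hu.1, hu.2.2⟩
  have hs : ({r ∈ range k | r + 1 ≤ chainRank T b ∧ k ≤ upCount C b + r + 1} : Finset ℕ) ⊆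
      Ico (k - 1 - upCount C b) (chainRank T b) := fun r hr => by
    simp only [mem_filter, mem_range, mem_Ico] at hr ⊢
    omega
  have hs' := card_le_card hs
  rw [Nat.card_Ico] at hs'
  have := hT b
  omega

end Declared

section Sample

variable {P : Type*} [Fintype P]

/-- The weight of `S` as a random sample containing each element with probability `1/4`,
scaled by `4 ^ |P|`. -/
noncomputable def sampleWeight (S : Finset P) : ℝ := 3 ^ (Fintype.card P - #S)

lemma sampleWeight_pos (S : Finset P) : 0 < sampleWeight S := by
  unfold sampleWeight; positivity

lemma sum_sampleWeight : ∑ S : Finset P, sampleWeight S = 4 ^ Fintype.card P := by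
  have h := Finset.sum_pow_mul_eq_add_pow (1 : ℝ) 3 (univ : Finset P)
  simp only [one_pow, one_mul, powerset_univ, card_univ] at h
  rw [show (4 : ℝ) = 1 + 3 by norm_num, ← h]
  rfl

lemma sampleWeight_erase [DecidableEq P] {S : Finset P} {v : P} (hv : v ∈ S) :
    sampleWeight (S.erase v) = 3 * sampleWeight S := by
  unfold sampleWeight
  have h1 := card_erase_add_one hv
  have h2 := card_le_univ S
  rw [show Fintype.card P - #(S.erase v) = Fintype.card P - #S + 1 by omega, pow_succ]
  ring

lemma sum_notMem_eq_sum_mem [DecidableEq P] (v : P) (f : Finset P → ℝ) :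
    ∑ S : Finset P, (if v ∉ S then f S else 0) =
      ∑ S : Finset P, if v ∈ S then f (S.erase v) else 0 := by
  rw [← sum_filter, ← sum_filter]
  refine sum_bij' (fun S _ => insert v S) (fun S _ => S.erase v) ?_ ?_ ?_ ?_ ?_
  · intro S _; simp
  · intro S _; simp
  · intro S hS
    simp only [mem_filter] at hS
    exact erase_insert hS.2
  · intro S hS
    simp only [mem_filter] at hS
    exact insert_erase hS.2
  · intro S hS
    simp only [mem_filter] at hS
    rw [erase_insert hS.2]

lemma sum_notMem_of_erase_eq [DecidableEq P] (v : P) (f : Finset P → ℝ)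
    (hf : ∀ S, f (S.erase v) = f S) :
    ∑ S : Finset P, (if v ∉ S then sampleWeight S * f S else 0) =
      3 / 4 * ∑ S : Finset P, sampleWeight S * f S := by
  have h := sum_notMem_eq_sum_mem v (fun S => sampleWeight S * f S)
  have h2 : ∑ S : Finset P, (if v ∈ S then sampleWeight (S.erase v) * f (S.erase v) else 0) =
      3 * ∑ S : Finset P, if v ∈ S then sampleWeight S * f S else 0 := by
    rw [mul_sum]
    refine sum_congr rfl fun S _ => ?_
    split_ifs with hv
    · rw [sampleWeight_erase hv, hf]; ring
    · simp
  have h3 : ∑ S : Finset P, sampleWeight S * f S =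
      ∑ S : Finset P, (if v ∉ S then sampleWeight S * f S else 0) +
      ∑ S : Finset P, if v ∈ S then sampleWeight S * f S else 0 := by
    rw [← sum_add_distrib]
    refine sum_congr rfl fun S _ => ?_
    by_cases hv : v ∈ S <;> simp [hv]
  rw [h3]
  linarith

end Sample

section FalseDeclarations

variable {P : Type*} [PartialOrder P]

/-- The members of `S` coloured `x`. -/
def colourClass (c : P → Bool) (x : Bool) (S : Finset P) : Finset P := S.filter (c · = x)

omit [PartialOrder P] in
lemma mem_colourClass {c : P → Bool} {x : Bool} {S : Finset P} {v : P} :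
    v ∈ colourClass c x S ↔ v ∈ S ∧ c v = x := by simp [colourClass]

omit [PartialOrder P] in
lemma colourClass_erase [DecidableEq P] (c : P → Bool) (x : Bool) (S : Finset P) (v : P) :
    colourClass c x (S.erase v) = (colourClass c x S).erase v := by
  ext u; simp only [mem_colourClass, mem_erase]; tauto

variable [Fintype P]

open Classical in
lemma sum_toggle_le (c : P → Bool) (x : Bool) (b : P) (r : ℕ) :
    ∑ v : P, ∑ S : Finset P, (if v ∉ S then sampleWeight S *
        (if v < b ∧ c v = x ∧ chainRank (colourClass c x S) v = r ∧
          chainRank (colourClass c x S) b = r then 1 else 0) else 0) ≤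
      3 * ∑ S : Finset P, sampleWeight S *
        (if r + 1 ≤ chainRank (colourClass c x S) b then 1 else 0) := by
  calc _ = ∑ v : P, ∑ S : Finset P, (if v ∈ S then sampleWeight (S.erase v) *
        (if v < b ∧ c v = x ∧ chainRank (colourClass c x (S.erase v)) v = r ∧
          chainRank (colourClass c x (S.erase v)) b = r then 1 else 0) else 0) :=
        sum_congr rfl fun v _ => sum_notMem_eq_sum_mem v fun S => sampleWeight S *
          (if v < b ∧ c v = x ∧ chainRank (colourClass c x S) v = r ∧
          chainRank (colourClass c x S) b = r then 1 else 0)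
    _ = ∑ S : Finset P, ∑ v : P, 3 * sampleWeight S *
        (if v ∈ S ∧ v < b ∧ c v = x ∧ chainRank (colourClass c x (S.erase v)) v = r ∧
          chainRank (colourClass c x (S.erase v)) b = r then 1 else 0) := by
        rw [sum_comm]
        refine sum_congr rfl fun S _ => sum_congr rfl fun v _ => ?_
        by_cases hv : v ∈ S
        · simp only [hv, if_true, true_and, sampleWeight_erase hv]
        · simp [hv]
    _ ≤ _ := by
        rw [mul_sum]
        refine sum_le_sum fun S _ => ?_
        rw [← mul_sum, ← mul_assoc]
        refine mul_le_mul_of_nonneg_left ?_ (by have := sampleWeight_pos S; positivity)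
        rw [sum_boole]
        have hkey : ∀ v : P, v ∈ S ∧ v < b ∧ c v = x ∧
            chainRank (colourClass c x (S.erase v)) v = r ∧
            chainRank (colourClass c x (S.erase v)) b = r →
            r + 1 ≤ chainRank (colourClass c x S) b := by
          rintro v ⟨h1, h2, h3, h4, h5⟩
          have h6 := chainRank_lt_of_mem (mem_colourClass.2 ⟨h1, h3⟩) h2
          have h7 : chainRank (colourClass c x (S.erase v)) v =
              chainRank (colourClass c x S) v := by
            refine chainRank_congr fun u hu => ?_
            rw [colourClass_erase, mem_erase]
            exact and_iff_right hu.ne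
          omega
        split_ifs with hr
        · norm_cast
          rw [card_le_one]
          intro v hv v' hv'
          simp only [mem_filter, mem_univ, true_and, colourClass_erase] at hv hv'
          obtain ⟨h1, h2, h3, h4, h5⟩ := hv
          obtain ⟨h1', h2', h3', h4', h5'⟩ := hv'
          exact eq_of_chainRank_erase (mem_colourClass.2 ⟨h1, h3⟩)
            (mem_colourClass.2 ⟨h1', h3'⟩) h2' h4 h5 h4' h5'
        · rw [filter_false_of_mem fun v _ hv => hr (hkey v hv)]
          simp

variable {Ω : Type*} [Fintype Ω]

open Classical in
/-- The number of pairs `(ω, v)` with `v` declared on the chain of `ω`. -/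
noncomputable def declaredCount (k : ℕ) (ch : Ω → Finset P) (T : Finset P) : ℝ :=
  ∑ ω, (#{u ∈ ch ω | Declared k (ch ω) T u} : ℝ)

open Classical in
/-- The number of pairs `(ω, v)` with `v` wrongly declared not to have
colour `x`. -/
noncomputable def falseCount (k : ℕ) (ch : Ω → Finset P) (c : P → Bool) (x : Bool)
    (S : Finset P) : ℝ :=
  ∑ ω, (#{u ∈ ch ω | Declared k (ch ω) (colourClass c x S) u ∧ c u = x} : ℝ)

open Classical in
lemma card_false_le {k : ℕ} {C : Finset P} (hC : IsChain (· ≤ ·) (C : Set P))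
    {c : P → Bool} {x : Bool} (S : Finset P)
    (hx : ∀ v, c v = x → chainRank (colourClass c x S) v + 2 ≤ k) :
    (#{u ∈ C | Declared k C (colourClass c x S) u ∧ c u = x} : ℝ) ≤
      ∑ b : P, ∑ r ∈ range k, ∑ v : P,
        (if v ∈ C ∧ b ∈ C ∧ k ≤ upCount C b + (r + 1) then 1 else 0) *
        (if v ∉ S then (if v < b ∧ c v = x ∧ chainRank (colourClass c x S) v = r ∧
          chainRank (colourClass c x S) b = r then 1 else 0) else 0) := by
  have hsw : ∀ f : P → ℕ → P → ℝ, ∑ b : P, ∑ r ∈ range k, ∑ v : P, f b r v =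
      ∑ v : P, ∑ b : P, ∑ r ∈ range k, f b r v := fun f => by
    rw [sum_comm]
    conv_rhs => rw [sum_comm]
    rw [sum_comm]
    refine sum_congr rfl fun b _ => sum_comm
  rw [hsw]
  have h0 : ∀ v b r, (0 : ℝ) ≤ (if v ∈ C ∧ b ∈ C ∧ k ≤ upCount C b + (r + 1) then 1 else 0) *
        (if v ∉ S then (if v < b ∧ c v = x ∧ chainRank (colourClass c x S) v = r ∧
          chainRank (colourClass c x S) b = r then 1 else 0) else 0) := by
    intro v b r
    refine mul_nonneg ?_ ?_ <;> split_ifs <;> norm_num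
  have : (#{u ∈ C | Declared k C (colourClass c x S) u ∧ c u = x} : ℝ) =
      ∑ v : P, if v ∈ C ∧ Declared k C (colourClass c x S) v ∧ c v = x
        then 1 else 0 := by
    rw [sum_boole]
    congr 2
    ext u; simp
  rw [this]
  refine sum_le_sum fun v _ => ?_
  by_cases hv : v ∈ C ∧ Declared k C (colourClass c x S) v ∧ c v = x
  · rw [if_pos hv]
    obtain ⟨hvC, hdec, hcv⟩ := hv
    have hr2 := hx v hcv
    have hvS : v ∉ S := fun h => hdec.notMem hC hr2 (mem_colourClass.2 ⟨h, hcv⟩)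
    obtain ⟨b, hb, hvb, hnext, hrb⟩ := hdec.exists_next hC hr2
    have hk := hdec.2.1
    have hU := upCount_next hvC hvb hnext
    set r := chainRank (colourClass c x S) v with hr
    calc (1 : ℝ) ≤ (if v ∈ C ∧ b ∈ C ∧ k ≤ upCount C b + (r + 1) then 1 else 0) *
        (if v ∉ S then (if v < b ∧ c v = x ∧ chainRank (colourClass c x S) v = r ∧
          chainRank (colourClass c x S) b = r then 1 else 0) else 0) := by
          rw [if_pos ⟨hvC, hb, by omega⟩, if_pos hvS, if_pos ⟨hvb, hcv, hr.symm, hrb⟩]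
          norm_num
      _ ≤ _ := le_trans (single_le_sum (f := fun r' => (if v ∈ C ∧ b ∈ C ∧
            k ≤ upCount C b + (r' + 1) then (1 : ℝ) else 0) *
            (if v ∉ S then (if v < b ∧ c v = x ∧ chainRank (colourClass c x S) v = r' ∧
            chainRank (colourClass c x S) b = r' then 1 else 0) else 0))
            (fun r' _ => h0 v b r') (mem_range.2 (by omega)))
          (single_le_sum (f := fun b' => ∑ r' ∈ range k, (if v ∈ C ∧ b' ∈ C ∧
            k ≤ upCount C b' + (r' + 1) then (1 : ℝ) else 0) *
            (if v ∉ S then (if v < b' ∧ c v = x ∧ chainRank (colourClass c x S) v = r' ∧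
            chainRank (colourClass c x S) b' = r' then 1 else 0) else 0))
            (fun b' _ => sum_nonneg fun r' _ => h0 v b' r') (mem_univ b))
  · rw [if_neg hv]
    exact sum_nonneg fun b _ => sum_nonneg fun r _ => h0 v b r

open Classical in
lemma sum_falseCount_le {k : ℕ} {L q : ℝ} (hq : 0 ≤ q) {ch : Ω → Finset P}
    (hch : ∀ ω, IsChain (· ≤ ·) (ch ω : Set P)) (hL : ∀ ω, (#(ch ω) : ℝ) ≤ L)
    (hτ : ∀ v b : P, v < b → ∀ j,
      (#{ω | v ∈ ch ω ∧ b ∈ ch ω ∧ k ≤ upCount (ch ω) b + j} : ℝ) ≤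
        q * #{ω | b ∈ ch ω ∧ k ≤ upCount (ch ω) b + j})
    {c : P → Bool} {x : Bool}
    (hk : ∀ S v, chainRank (colourClass c x S) v < k)
    (hx : ∀ S v, c v = x → chainRank (colourClass c x S) v + 2 ≤ k) :
    ∑ S : Finset P, sampleWeight S * falseCount k ch c x S ≤
      3 * q * L * ∑ S : Finset P, sampleWeight S * declaredCount k ch (colourClass c x S) := by
  set I : Finset P → P → ℕ → P → ℝ := fun S b r v =>
    (if v ∉ S then (if v < b ∧ c v = x ∧ chainRank (colourClass c x S) v = r ∧
          chainRank (colourClass c x S) b = r then 1 else 0) else 0) with hI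
  have hI0 : ∀ S b r v, 0 ≤ I S b r v := by
    intro S b r v
    simp only [hI]
    split_ifs <;> norm_num
  have h_pointwise : ∑ S : Finset P, sampleWeight S * falseCount k ch c x S ≤
      ∑ b : P, ∑ r ∈ range k, ∑ v : P, ∑ S : Finset P, sampleWeight S * I S b r v *
        (#{ω | v ∈ ch ω ∧ b ∈ ch ω ∧ k ≤ upCount (ch ω) b + (r + 1)} : ℝ) := by
    calc _ ≤ ∑ S : Finset P, sampleWeight S * ∑ ω, ∑ b : P, ∑ r ∈ range k, ∑ v : P,
          (if v ∈ ch ω ∧ b ∈ ch ω ∧ k ≤ upCount (ch ω) b + (r + 1) then 1 else 0) *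
            I S b r v := by
          refine sum_le_sum fun S _ => mul_le_mul_of_nonneg_left ?_ (sampleWeight_pos S).le
          exact sum_le_sum fun ω _ => card_false_le (hch ω) S (hx S)
      _ = ∑ S : Finset P, ∑ b : P, ∑ r ∈ range k, ∑ v : P, sampleWeight S * I S b r v *
        (#{ω | v ∈ ch ω ∧ b ∈ ch ω ∧ k ≤ upCount (ch ω) b + (r + 1)} : ℝ) := by
          refine sum_congr rfl fun S _ => ?_
          rw [sum_comm, mul_sum]
          refine sum_congr rfl fun b _ => ?_
          rw [sum_comm, mul_sum]
          refine sum_congr rfl fun r _ => ?_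
          rw [sum_comm, mul_sum]
          refine sum_congr rfl fun v _ => ?_
          rw [← sum_mul, sum_boole]
          ring
      _ = _ := by
          rw [sum_comm]
          refine sum_congr rfl fun b _ => ?_
          rw [sum_comm]
          refine sum_congr rfl fun r _ => ?_
          rw [sum_comm]
  have h_toggle : ∑ b : P, ∑ r ∈ range k, ∑ v : P, ∑ S : Finset P, sampleWeight S * I S b r v *
        (#{ω | v ∈ ch ω ∧ b ∈ ch ω ∧ k ≤ upCount (ch ω) b + (r + 1)} : ℝ) ≤
      ∑ b : P, ∑ r ∈ range k, (q * #{ω | b ∈ ch ω ∧ k ≤ upCount (ch ω) b + (r + 1)}) *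
        (3 * ∑ S : Finset P, sampleWeight S *
        (if r + 1 ≤ chainRank (colourClass c x S) b then 1 else 0)) := by
    refine sum_le_sum fun b _ => sum_le_sum fun r _ => ?_
    refine le_trans ?_ (mul_le_mul_of_nonneg_left (sum_toggle_le c x b r) (by positivity))
    rw [mul_sum]
    refine sum_le_sum fun v _ => ?_
    rw [mul_sum]
    refine sum_le_sum fun S _ => ?_
    by_cases hvb : v < b
    · have h1 := hτ v b hvb (r + 1)
      have h2 : (if v ∉ S then sampleWeight S *
        (if v < b ∧ c v = x ∧ chainRank (colourClass c x S) v = r ∧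
          chainRank (colourClass c x S) b = r then 1 else 0) else 0) =
          sampleWeight S * I S b r v := by
        simp only [hI]; split_ifs <;> simp
      rw [h2, mul_comm]
      exact mul_le_mul_of_nonneg_right h1 (mul_nonneg (sampleWeight_pos S).le (hI0 _ _ _ _))
    · simp [hI, hvb]
  refine (h_pointwise.trans h_toggle).trans ?_
  have h_swap : ∑ b : P, ∑ r ∈ range k, (q * #{ω | b ∈ ch ω ∧ k ≤ upCount (ch ω) b + (r + 1)}) *
        (3 * ∑ S : Finset P, sampleWeight S *
        (if r + 1 ≤ chainRank (colourClass c x S) b then 1 else 0)) =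
      3 * q * ∑ S : Finset P, sampleWeight S * ∑ ω, ∑ b : P, ∑ r ∈ range k,
        (if b ∈ ch ω ∧ k ≤ upCount (ch ω) b + (r + 1) then 1 else 0) *
        (if r + 1 ≤ chainRank (colourClass c x S) b then 1 else 0) := by
    have : ∀ S : Finset P, sampleWeight S * ∑ ω, ∑ b : P, ∑ r ∈ range k,
        (if b ∈ ch ω ∧ k ≤ upCount (ch ω) b + (r + 1) then (1 : ℝ) else 0) *
        (if r + 1 ≤ chainRank (colourClass c x S) b then 1 else 0) =
        ∑ b : P, ∑ r ∈ range k, (#{ω | b ∈ ch ω ∧ k ≤ upCount (ch ω) b + (r + 1)} : ℝ) *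
          (sampleWeight S * (if r + 1 ≤ chainRank (colourClass c x S) b then 1 else 0)) := by
      intro S
      rw [sum_comm, mul_sum]
      refine sum_congr rfl fun b _ => ?_
      rw [sum_comm, mul_sum]
      refine sum_congr rfl fun r _ => ?_
      rw [← sum_mul, sum_boole]
      ring
    simp_rw [this]
    conv_rhs => rw [sum_comm, mul_sum]
    refine sum_congr rfl fun b _ => ?_
    conv_rhs => rw [sum_comm, mul_sum]
    refine sum_congr rfl fun r _ => ?_
    rw [← mul_sum]
    ring
  rw [h_swap, mul_assoc (3 * q) L]
  refine mul_le_mul_of_nonneg_left ?_ (by positivity)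
  rw [mul_sum]
  refine sum_le_sum fun S _ => ?_
  rw [mul_left_comm]
  refine mul_le_mul_of_nonneg_left ?_ (sampleWeight_pos S).le
  unfold declaredCount
  rw [mul_sum]
  refine sum_le_sum fun ω _ => ?_
  set D : ℝ := (#{u ∈ ch ω | Declared k (ch ω) (colourClass c x S) u} : ℝ) with hD
  calc _ ≤ ∑ b : P, if b ∈ ch ω then D else 0 := by
        refine sum_le_sum fun b _ => ?_
        split_ifs with hb
        · have h := card_rank_window_le (hch ω) (hk S) hb
          have h' : (#{r ∈ range k | r + 1 ≤ chainRank (colourClass c x S) b ∧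
              k ≤ upCount (ch ω) b + r + 1} : ℝ) ≤ D := by rw [hD]; exact_mod_cast h
          refine le_trans (le_of_eq ?_) h'
          rw [card_filter]
          push_cast
          refine sum_congr rfl fun r _ => ?_
          by_cases h1 : r + 1 ≤ chainRank (colourClass c x S) b <;>
            by_cases h2 : k ≤ upCount (ch ω) b + r + 1 <;> simp [hb, h1, h2, ← add_assoc]
        · simp [hb]
    _ = #(ch ω) * D := by rw [← sum_filter, sum_const, nsmul_eq_mul]; simp
    _ ≤ L * D := mul_le_mul_of_nonneg_right (hL ω) (by positivity)

end FalseDeclarations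

section Coding

lemma mul_log_two_le_log {a b : ℝ} (ha : 0 ≤ a) (ha1 : a ≤ 1) (hb : 0 ≤ b) (hb1 : b ≤ 1) :
    (4 / 5 * a - 2 * b) * Real.log 2 ≤ Real.log (1 + 3 / 4 * (a - b)) := by
  have hl2 : 0 < Real.log 2 := Real.log_pos (by norm_num)
  have hconc : ∀ y s : ℝ, 0 < y → 0 ≤ s → s ≤ 1 → s * Real.log y ≤ Real.log (1 + s * (y - 1)) := by
    intro y s hy hs hs1
    have h := strictConcaveOn_log_Ioi.concaveOn.2 (Set.mem_Ioi.2 zero_lt_one) (Set.mem_Ioi.2 hy)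
      (sub_nonneg.2 hs1) hs (by ring)
    simp only [smul_eq_mul, Real.log_one, mul_zero, zero_add] at h
    rwa [show 1 + s * (y - 1) = (1 - s) * 1 + s * y by ring]
  rcases le_total b a with h | h
  · have h1 := hconc (7 / 4) (a - b) (by norm_num) (by linarith) (by linarith)
    have h2 : 4 / 5 * Real.log 2 ≤ Real.log (7 / 4) := by
      have : Real.log ((2 : ℝ) ^ 4) ≤ Real.log ((7 / 4 : ℝ) ^ 5) :=
        Real.log_le_log (by norm_num) (by norm_num)
      rw [Real.log_pow, Real.log_pow] at this
      push_cast at this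
      linarith
    have h3 : (a - b) * (4 / 5 * Real.log 2) ≤ (a - b) * Real.log (7 / 4) :=
      mul_le_mul_of_nonneg_left h2 (by linarith)
    rw [show 1 + (a - b) * (7 / 4 - 1) = 1 + 3 / 4 * (a - b) by ring] at h1
    nlinarith
  · have h1 := hconc (1 / 4) (b - a) (by norm_num) (by linarith) (by linarith)
    have h2 : Real.log (1 / 4) = - (2 * Real.log 2) := by
      rw [one_div, Real.log_inv, show (4 : ℝ) = 2 ^ 2 by norm_num, Real.log_pow]
      push_cast; ring
    rw [show 1 + (b - a) * (1 / 4 - 1) = 1 + 3 / 4 * (a - b) by ring, h2] at h1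
    nlinarith

variable {P : Type*} [Fintype P] [DecidableEq P]

lemma sum_prod_one_add_sign (S V : Finset P) (hSV : Disjoint S V) (t : (P → Bool) → P → ℝ)
    (ht : ∀ c c' : P → Bool, (∀ u ∈ S, c u = c' u) → t c = t c') :
    ∑ c : P → Bool, ∏ v ∈ V, (1 + (if c v then -1 else 1) * t c v) = 2 ^ Fintype.card P := by
  induction V using Finset.induction_on with
  | empty => simp
  | insert v V hv ih =>
    rw [disjoint_insert_right] at hSV
    rw [← ih hSV.2]
    set flip : (P → Bool) → (P → Bool) := fun c => Function.update c v (!c v) with hflip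
    have hinv : Function.Involutive flip := fun c => by
      ext u
      by_cases hu : u = v
      · subst hu; simp [hflip]
      · simp [hflip, hu]
    have htf : ∀ c, t (flip c) = t c := fun c => ht _ _ fun u hu => by
      have : u ≠ v := fun h => hSV.1 (h ▸ hu)
      simp [hflip, this]
    set G : (P → Bool) → ℝ := fun c => ∏ v ∈ V, (1 + (if c v then -1 else 1) * t c v) with hG
    have hGf : ∀ c, G (flip c) = G c := fun c => by
      simp only [hG, htf]
      refine prod_congr rfl fun u hu => ?_
      have : u ≠ v := fun h => hv (h ▸ hu)
      simp [hflip, this]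
    set F : (P → Bool) → ℝ := fun c => (1 + (if c v then -1 else 1) * t c v) * G c with hF
    have h1 : ∑ c, F c = ∑ c, F (flip c) := (Equiv.sum_comp hinv.toPerm F).symm
    have h2 : ∀ c, F c + F (flip c) = 2 * G c := fun c => by
      simp only [hF, hGf, htf]
      have : flip c v = !c v := by simp [hflip]
      rw [this]
      cases c v <;> simp <;> ring
    have h3 : ∑ c, F c + ∑ c, F (flip c) = 2 * ∑ c, G c := by
      rw [← sum_add_distrib, mul_sum]
      exact sum_congr rfl fun c _ => h2 c
    have h4 : ∀ c : P → Bool,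
        ∏ u ∈ insert v V, (1 + (if c u then -1 else 1) * t c u) = F c := fun c => by
      rw [prod_insert hv]
    simp only [h4]
    linarith

lemma card_mul_log_le {α : Type*} (X : Finset α) (w : α → ℝ) (hw : ∀ a ∈ X, 0 < w a) {M : ℝ}
    (hM : 0 < M) (hsum : ∑ a ∈ X, w a ≤ M) (hX : X.Nonempty) :
    (#X : ℝ) * (Real.log #X - Real.log M) ≤ - ∑ a ∈ X, Real.log (w a) := by
  have hX0 : (0 : ℝ) < #X := by exact_mod_cast hX.card_pos
  have h1 : ∑ a ∈ X, (Real.log (w a) + (Real.log #X - Real.log M)) ≤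
      ∑ a ∈ X, (w a * (#X / M) - 1) := by
    refine sum_le_sum fun a ha => ?_
    have := Real.log_le_sub_one_of_pos (x := w a * (#X / M)) (by have := hw a ha; positivity)
    rw [Real.log_mul (hw a ha).ne' (by positivity), Real.log_div hX0.ne' hM.ne'] at this
    exact this
  rw [sum_add_distrib, sum_const, nsmul_eq_mul, sum_sub_distrib, ← sum_mul, sum_const,
    nsmul_eq_mul] at h1
  have h2 : (∑ a ∈ X, w a) * (#X / M) ≤ #X := by
    calc _ ≤ M * (#X / M) := mul_le_mul_of_nonneg_right hsum (by positivity)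
      _ = _ := by field_simp
  linarith

end Coding

section Entropy

variable {P : Type*} [Fintype P]

open Classical in
/-- If on the elements outside the sample `S` the colouring is predicted with bias
`ε c v * t S c v`, where `t S c` only depends on the colours seen on `S`, then the savings obtained
can be distributed over the elements of `P`. -/
lemma exists_weight_of_prediction (X : Finset (P → Bool)) (hX : X.Nonempty)
    (t : Finset P → (P → Bool) → P → ℝ)
    (ht : ∀ S (c c' : P → Bool), (∀ u ∈ S, c u = c' u) → t S c = t S c')
    (hpos : ∀ S c v, |t S c v| < 1) :
    ∃ g : P → ℝ, (∀ v, 0 ≤ g v ∧ g v ≤ 1) ∧ Real.log #X ≤ (∑ v, g v) * Real.log 2 ∧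
      ∀ W : P → ℝ, (∀ v, 0 ≤ W v) →
        (#X * 4 ^ Fintype.card P * Real.log 2) * ∑ v, W v * g v ≤
        (#X * 4 ^ Fintype.card P * Real.log 2) * ∑ v, W v -
        ∑ c ∈ X, ∑ v, W v * ∑ S : Finset P, (if v ∉ S then sampleWeight S *
          Real.log (1 + (if c v then -1 else 1) * t S c v) else 0) := by
  have hX0 : (0 : ℝ) < #X := by exact_mod_cast hX.card_pos
  have hl2 : 0 < Real.log 2 := Real.log_pos (by norm_num)
  set N := Fintype.card P
  set M : ℝ := #X * 4 ^ N * Real.log 2 with hM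
  have hM0 : 0 < M := by positivity
  set f : Finset P → (P → Bool) → P → ℝ := fun S c v => 1 + (if c v then -1 else 1) * t S c v
  have hf : ∀ S c v, 0 < f S c v ∧ f S c v ≤ 2 := fun S c v => by
    have := abs_lt.1 (hpos S c v)
    simp only [f]
    split_ifs <;> constructor <;> linarith
  set Q : (P → Bool) → P → ℝ := fun c v =>
    ∑ S : Finset P, (if v ∉ S then sampleWeight S * Real.log (f S c v) else 0)
  set σ : P → ℝ := fun v => (∑ c ∈ X, Q c v) / M
  have hσ : ∀ v, σ v ≤ 1 := fun v => by
    rw [div_le_one hM0]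
    calc ∑ c ∈ X, Q c v ≤ ∑ c ∈ X, 4 ^ N * Real.log 2 := by
          refine sum_le_sum fun c _ => ?_
          rw [← sum_sampleWeight, sum_mul]
          refine sum_le_sum fun S _ => ?_
          have hS := sampleWeight_pos S
          split_ifs
          · positivity
          · exact mul_le_mul_of_nonneg_left (Real.log_le_log (hf S c v).1 (hf S c v).2) hS.le
      _ = M := by rw [sum_const, nsmul_eq_mul, hM]; ring
  have hlog : ∀ V : Finset P, Real.log #X ≤ (N - ∑ v ∈ V, σ v) * Real.log 2 := by
    intro V
    have h1 : ∀ S : Finset P, (#X : ℝ) * (Real.log #X - N * Real.log 2) ≤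
        - ∑ c ∈ X, ∑ v ∈ V \ S, Real.log (f S c v) := by
      intro S
      have h2 := card_mul_log_le X (fun c => ∏ v ∈ V \ S, f S c v)
        (fun c _ => prod_pos fun v _ => (hf S c v).1) (M := 2 ^ N) (by positivity)
        (by
          rw [← sum_prod_one_add_sign S (V \ S) disjoint_sdiff (t S) (ht S)]
          refine sum_le_sum_of_subset_of_nonneg (subset_univ _) fun c _ _ =>
            prod_nonneg fun v _ => (hf S c v).1.le) hX
      rw [Real.log_pow] at h2
      refine h2.trans_eq ?_
      congr 1
      exact sum_congr rfl fun c _ => Real.log_prod fun v _ => (hf S c v).1.ne'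
    have h3 : ∑ S : Finset P, sampleWeight S * ((#X : ℝ) * (Real.log #X - N * Real.log 2)) ≤
        ∑ S : Finset P, sampleWeight S * - ∑ c ∈ X, ∑ v ∈ V \ S, Real.log (f S c v) :=
      sum_le_sum fun S _ => mul_le_mul_of_nonneg_left (h1 S) (sampleWeight_pos S).le
    have h4 : ∑ S : Finset P, sampleWeight S * - ∑ c ∈ X, ∑ v ∈ V \ S, Real.log (f S c v) =
        - (M * ∑ v ∈ V, σ v) := by
      have : M * ∑ v ∈ V, σ v = ∑ S : Finset P, ∑ c ∈ X, ∑ v ∈ V,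
          (if v ∉ S then sampleWeight S * Real.log (f S c v) else 0) := by
        rw [mul_sum]
        have : ∀ v, M * σ v = ∑ S : Finset P, ∑ c ∈ X,
            (if v ∉ S then sampleWeight S * Real.log (f S c v) else 0) := fun v => by
          simp only [σ, Q]
          rw [mul_div_cancel₀ _ hM0.ne', sum_comm]
        simp only [this]
        rw [sum_comm]
        exact sum_congr rfl fun S _ => sum_comm
      rw [this, ← sum_neg_distrib]
      refine sum_congr rfl fun S _ => ?_
      rw [mul_neg, mul_sum]
      congr 1
      refine sum_congr rfl fun c _ => ?_
      rw [← sum_filter, mul_sum]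
      refine sum_congr ?_ fun _ _ => rfl
      ext v; simp
    rw [h4, ← sum_mul, sum_sampleWeight] at h3
    have hpos : 0 < (4 : ℝ) ^ N * #X := by positivity
    refine le_of_mul_le_mul_left (a := (4 : ℝ) ^ N * #X) ?_ hpos
    rw [hM] at h3
    linarith
  refine ⟨fun v => 1 - max (σ v) 0, fun v => ⟨?_, ?_⟩, ?_, ?_⟩
  · have := hσ v
    simp [this]
  · have := le_max_right (σ v) 0
    linarith
  · refine (hlog {v | 0 ≤ σ v}).trans_eq ?_
    congr 1
    rw [sum_sub_distrib, sum_filter]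
    simp only [sum_const, card_univ, nsmul_eq_mul, mul_one]
    congr 1
    refine sum_congr rfl fun v _ => ?_
    split_ifs with h
    · rw [max_eq_left h]
    · rw [max_eq_right (le_of_not_ge h)]
  · intro W hW
    have h1 : ∑ v, W v * (1 - max (σ v) 0) ≤ ∑ v, W v - ∑ v, W v * σ v := by
      rw [← sum_sub_distrib]
      refine sum_le_sum fun v _ => ?_
      have := mul_le_mul_of_nonneg_left (le_max_left (σ v) 0) (hW v)
      linarith
    have h2 : M * ∑ v, W v * σ v = ∑ c ∈ X, ∑ v, W v * Q c v := by
      rw [mul_sum, sum_comm]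
      refine sum_congr rfl fun v _ => ?_
      simp only [σ]
      rw [← mul_sum]
      field_simp
    have h3 := mul_le_mul_of_nonneg_left h1 hM0.le
    rw [mul_sub, h2] at h3
    exact h3

end Entropy

section Abstract

variable {P : Type*} [PartialOrder P]

/-- `c` has no monochromatic chain of `k` elements. -/
def NoMonoChain (k : ℕ) (c : P → Bool) : Prop :=
  ∀ C : Finset P, IsChain (· ≤ ·) (C : Set P) → (∀ u ∈ C, ∀ v ∈ C, c u = c v) → #C < k

namespace NoMonoChain

variable {k : ℕ} {c : P → Bool}

lemma chainRank_add_two_le (h : NoMonoChain k c) {x : Bool} (S : Finset P) {v : P} (hv : c v = x) :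
    chainRank (colourClass c x S) v + 2 ≤ k := by
  classical
  obtain ⟨C, h1, h2, h3, h4⟩ := exists_chain_card_eq_chainRank (colourClass c x S) v
  have hx : ∀ u ∈ insert v C, c u = x := fun u hu => by
    rcases mem_insert.1 hu with rfl | hu
    · exact hv
    · exact (mem_colourClass.1 (h1 hu)).2
  have := h (insert v C) (isChain_insert_of_lt h2 h3) fun u hu w hw => (hx u hu).trans (hx w hw).symm
  rw [card_insert_of_notMem fun hC => lt_irrefl _ (h3 v hC)] at this
  omega

lemma chainRank_lt (h : NoMonoChain k c) (x : Bool) (S : Finset P) (v : P) :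
    chainRank (colourClass c x S) v < k := by
  obtain ⟨C, h1, h2, h3, h4⟩ := exists_chain_card_eq_chainRank (colourClass c x S) v
  rw [← h4]
  exact h C h2 fun u hu w hw =>
    (mem_colourClass.1 (h1 hu)).2.trans (mem_colourClass.1 (h1 hw)).2.symm

lemma card_chain_le (h : NoMonoChain k c) {C : Finset P} (hC : IsChain (· ≤ ·) (C : Set P)) :
    #C ≤ 2 * k := by
  have h1 : ∀ x, #(colourClass c x C) < k := fun x =>
    h _ (hC.mono fun u hu => (mem_colourClass.1 (mem_coe.1 hu)).1) fun u hu w hw =>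
      (mem_colourClass.1 hu).2.trans (mem_colourClass.1 hw).2.symm
  have h2 := card_filter_add_card_filter_not (s := C) (fun u => c u = true)
  have h3 : #{u ∈ C | ¬ c u = true} = #(colourClass c false C) := by
    unfold colourClass
    congr 1
    ext u; simp
  have := h1 true
  have := h1 false
  unfold colourClass at *
  omega

end NoMonoChain

variable [Fintype P] {Ω : Type*} [Fintype Ω]

open Classical in
/-- The number of chains on which `v` is declared. -/
noncomputable def declaredAt (k : ℕ) (ch : Ω → Finset P) (T : Finset P) (v : P) : ℝ :=
  #{ω | Declared k (ch ω) T v}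

omit [Fintype P] in
open Classical in
lemma declaredAt_le (k : ℕ) (ch : Ω → Finset P) (T : Finset P) (v : P) :
    declaredAt k ch T v ≤ #{ω | v ∈ ch ω} := by
  unfold declaredAt
  exact_mod_cast card_le_card fun ω hω => by
    simp only [mem_filter, mem_univ, true_and] at hω ⊢
    exact hω.1

open Classical in
lemma declaredCount_eq_sum (k : ℕ) (ch : Ω → Finset P) (T : Finset P) :
    declaredCount k ch T = ∑ v, declaredAt k ch T v := by
  unfold declaredCount declaredAt
  norm_cast
  simp only [card_filter]
  rw [sum_comm]
  refine sum_congr rfl fun ω _ => ?_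
  rw [← sum_subset (subset_univ (ch ω))]
  intro v _ hv
  rw [if_neg fun h => hv h.1]

open Classical in
lemma falseCount_eq_sum (k : ℕ) (ch : Ω → Finset P) (c : P → Bool) (x : Bool) (S : Finset P) :
    falseCount k ch c x S =
      ∑ v, if c v = x then declaredAt k ch (colourClass c x S) v else 0 := by
  unfold falseCount declaredAt
  norm_cast
  simp only [card_filter]
  have : ∀ v : P, (if c v = x then ∑ ω, (if Declared k (ch ω) (colourClass c x S) v then 1 else 0)
      else 0) = ∑ ω, if Declared k (ch ω) (colourClass c x S) v ∧ c v = x then 1 else 0 := by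
    intro v
    by_cases h : c v = x <;> simp [h]
  simp only [this]
  rw [sum_comm]
  refine sum_congr rfl fun ω _ => ?_
  rw [← sum_subset (subset_univ (ch ω))]
  intro v _ hv
  rw [if_neg fun h => hv h.1.1]

lemma sum_falseCount_eq (k : ℕ) (ch : Ω → Finset P) (c : P → Bool) (S : Finset P) :
    ∑ x, falseCount k ch c x S = ∑ v, declaredAt k ch (colourClass c (c v) S) v := by
  simp only [falseCount_eq_sum]
  rw [sum_comm]
  exact sum_congr rfl fun v _ => by simp

lemma sum_declaredAt_not (k : ℕ) (ch : Ω → Finset P) (c : P → Bool) (S : Finset P) :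
    ∑ v, declaredAt k ch (colourClass c (!c v) S) v =
      ∑ x, (declaredCount k ch (colourClass c x S) - falseCount k ch c x S) := by
  rw [sum_sub_distrib, sum_falseCount_eq, eq_sub_iff_add_eq, ← sum_add_distrib]
  simp only [declaredCount_eq_sum]
  rw [sum_comm]
  refine sum_congr rfl fun v _ => ?_
  cases c v <;> simp [add_comm]

open Classical in
lemma le_sum_log_of_noMonoChain {k : ℕ} {ch : Ω → Finset P} (hW : ∀ v, ∃ ω, v ∈ ch ω)
    (c : P → Bool) :
    Real.log 2 * ∑ x, ∑ S : Finset P, sampleWeight S *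
      (3 / 5 * declaredCount k ch (colourClass c x S) - 13 / 5 * falseCount k ch c x S) ≤
    ∑ v, (#{ω | v ∈ ch ω} : ℝ) * ∑ S : Finset P, (if v ∉ S then sampleWeight S *
      Real.log (1 + (if c v then -1 else 1) * (3 / 4 *
        (declaredAt k ch (colourClass c true S) v / #{ω | v ∈ ch ω} -
          declaredAt k ch (colourClass c false S) v / #{ω | v ∈ ch ω}))) else 0) := by
  have hl2 : 0 < Real.log 2 := Real.log_pos (by norm_num)
  set d : Bool → Finset P → P → ℝ := fun x S v => declaredAt k ch (colourClass c x S) v with hd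
  have hd0 : ∀ x S v, 0 ≤ d x S v := fun x S v => by simp only [hd, declaredAt]; positivity
  have hterm : ∀ v, Real.log 2 * (3 / 5 * ∑ S : Finset P, sampleWeight S * d (!c v) S v -
      2 * ∑ S : Finset P, sampleWeight S * d (c v) S v) ≤
      (#{ω | v ∈ ch ω} : ℝ) * ∑ S : Finset P, (if v ∉ S then sampleWeight S *
      Real.log (1 + (if c v then -1 else 1) * (3 / 4 *
        (d true S v / #{ω | v ∈ ch ω} - d false S v / #{ω | v ∈ ch ω}))) else 0) := by
    intro v
    have hWv : (0 : ℝ) < #{ω | v ∈ ch ω} := by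
      obtain ⟨ω, hω⟩ := hW v
      exact_mod_cast card_pos.2 ⟨ω, by simp [hω]⟩
    have hdW : ∀ x S, d x S v / #{ω | v ∈ ch ω} ≤ 1 := fun x S => by
      rw [div_le_one hWv]; exact declaredAt_le k ch _ v
    have herase : ∀ S, d (!c v) (S.erase v) v = d (!c v) S v := fun S => by
      simp only [hd]
      congr 1
      rw [colourClass_erase, erase_eq_of_notMem]
      simp [mem_colourClass]
    have h34 := sum_notMem_of_erase_eq v (fun S => d (!c v) S v) herase
    have hle : ∑ S : Finset P, (if v ∉ S then sampleWeight S * d (c v) S v else 0) ≤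
        ∑ S : Finset P, sampleWeight S * d (c v) S v := by
      refine sum_le_sum fun S _ => ?_
      split_ifs
      · exact mul_nonneg (sampleWeight_pos S).le (hd0 _ _ _)
      · exact le_rfl
    have hlow : ∑ S : Finset P, (if v ∉ S then sampleWeight S *
        ((4 / 5 * d (!c v) S v - 2 * d (c v) S v) * Real.log 2) else 0) ≤
        (#{ω | v ∈ ch ω} : ℝ) * ∑ S : Finset P, (if v ∉ S then sampleWeight S *
      Real.log (1 + (if c v then -1 else 1) * (3 / 4 *
        (d true S v / #{ω | v ∈ ch ω} - d false S v / #{ω | v ∈ ch ω}))) else 0) := by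
      rw [mul_sum]
      refine sum_le_sum fun S _ => ?_
      by_cases hv : v ∈ S
      · simp [hv]
      rw [if_pos hv, if_pos hv, mul_left_comm _ (sampleWeight S) (Real.log _)]
      refine mul_le_mul_of_nonneg_left ?_ (sampleWeight_pos S).le
      have h := mul_log_two_le_log (a := d (!c v) S v / #{ω | v ∈ ch ω})
        (b := d (c v) S v / #{ω | v ∈ ch ω}) (div_nonneg (hd0 _ _ _) hWv.le) (hdW _ _)
        (div_nonneg (hd0 _ _ _) hWv.le) (hdW _ _)
      have h' := mul_le_mul_of_nonneg_left h hWv.le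
      refine le_trans (le_of_eq ?_) (h'.trans (le_of_eq ?_))
      · field_simp
      · congr 2
        cases c v
        · simp
        · simp only [Bool.not_true, if_true]
          ring
    refine le_trans ?_ hlow
    have heq : ∑ S : Finset P, (if v ∉ S then sampleWeight S *
        ((4 / 5 * d (!c v) S v - 2 * d (c v) S v) * Real.log 2) else 0) =
        Real.log 2 * (4 / 5 * ∑ S : Finset P,
          (if v ∉ S then sampleWeight S * d (!c v) S v else 0) -
        2 * ∑ S : Finset P, (if v ∉ S then sampleWeight S * d (c v) S v else 0)) := by
      rw [mul_sum, mul_sum, ← sum_sub_distrib, mul_sum]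
      refine sum_congr rfl fun S _ => ?_
      split_ifs
      · simp
      · ring
    rw [heq, h34]
    refine mul_le_mul_of_nonneg_left ?_ hl2.le
    linarith
  refine le_trans (le_of_eq ?_) (sum_le_sum fun v _ => hterm v)
  rw [← mul_sum, sum_sub_distrib, ← mul_sum, ← mul_sum]
  congr 1
  rw [sum_comm, sum_comm (f := fun v S => sampleWeight S * d (!c v) S v),
    sum_comm (f := fun v S => sampleWeight S * d (c v) S v), mul_sum, mul_sum, ← sum_sub_distrib]
  refine sum_congr rfl fun S _ => ?_
  rw [← mul_sum, ← mul_sum, ← mul_sum]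
  simp only [hd]
  rw [sum_declaredAt_not, ← sum_falseCount_eq]
  simp only [sum_sub_distrib, ← mul_sum]
  ring

open Classical in
lemma exists_weight_of_noMonoChain {k : ℕ} (hk : 0 < k) {q : ℝ} (hq : 0 ≤ q) (hqk : 156 * q * k < 1)
    {ch : Ω → Finset P} (hch : ∀ ω, IsChain (· ≤ ·) (ch ω : Set P)) (hW : ∀ v, ∃ ω, v ∈ ch ω)
    (hτ : ∀ v b : P, v < b → ∀ j,
      (#{ω | v ∈ ch ω ∧ b ∈ ch ω ∧ k ≤ upCount (ch ω) b + j} : ℝ) ≤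
        q * #{ω | b ∈ ch ω ∧ k ≤ upCount (ch ω) b + j})
    (hlarge : ((k : ℝ) - 1) * Fintype.card Ω < ∑ v, (#{ω | v ∈ ch ω} : ℝ))
    (X : Finset (P → Bool)) (hX : X.Nonempty) (hval : ∀ c ∈ X, NoMonoChain k c) :
    ∃ g : P → ℝ, (∀ v, 0 ≤ g v ∧ g v ≤ 1) ∧ Real.log #X ≤ (∑ v, g v) * Real.log 2 ∧
      ∑ v, (#{ω | v ∈ ch ω} : ℝ) * g v < ((k : ℝ) - 1) * Fintype.card Ω := by
  have hX0 : (0 : ℝ) < #X := by exact_mod_cast hX.card_pos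
  have hl2 : 0 < Real.log 2 := Real.log_pos (by norm_num)
  have hdW : ∀ T v, 0 ≤ declaredAt k ch T v / #{ω | v ∈ ch ω} ∧
      declaredAt k ch T v / #{ω | v ∈ ch ω} ≤ 1 := fun T v => by
    have hWv : (0 : ℝ) < #{ω | v ∈ ch ω} := by
      obtain ⟨ω, hω⟩ := hW v
      exact_mod_cast card_pos.2 ⟨ω, by simp [hω]⟩
    refine ⟨div_nonneg ?_ hWv.le, (div_le_one hWv).2 (declaredAt_le k ch _ v)⟩
    unfold declaredAt
    positivity
  obtain ⟨g, hg, hlog, hsum⟩ := exists_weight_of_prediction X hX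
    (fun S c v => 3 / 4 *
        (declaredAt k ch (colourClass c true S) v / #{ω | v ∈ ch ω} -
          declaredAt k ch (colourClass c false S) v / #{ω | v ∈ ch ω}))
    (by
      intro S c c' h
      have hcl : ∀ x, colourClass c x S = colourClass c' x S := fun x => by
        ext u
        simp only [mem_colourClass]
        exact and_congr_right fun hu => by rw [h u hu]
      simp only [hcl])
    (by
      intro S c v
      have h1 := hdW (colourClass c true S) v
      have h2 := hdW (colourClass c false S) v
      rw [abs_lt]
      constructor <;> linarith)
  refine ⟨g, hg, hlog, ?_⟩
  have hsum' := hsum (fun v => (#{ω | v ∈ ch ω} : ℝ)) fun v => by positivity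
  set y : ℝ := ∑ v, (#{ω | v ∈ ch ω} : ℝ) - ((k : ℝ) - 1) * Fintype.card Ω with hy
  have hy0 : 0 < y := by rw [hy]; linarith
  set N := Fintype.card P
  have hdecl : ∀ c ∈ X, ∀ x S, y ≤ declaredCount k ch (colourClass c x S) := by
    intro c hc x S
    have h1 : ∑ v, (#{ω | v ∈ ch ω} : ℝ) = ∑ ω, (#(ch ω) : ℝ) := by
      norm_cast
      simp only [card_filter]
      rw [sum_comm]
      exact sum_congr rfl fun ω _ => by simp
    have h2 : ∑ ω, ((#(ch ω) : ℝ) - (k - 1)) ≤ declaredCount k ch (colourClass c x S) := by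
      unfold declaredCount
      refine sum_le_sum fun ω _ => ?_
      have h := card_add_one_le_declared hk (hch ω) ((hval c hc).chainRank_lt x S)
      have h' : (#(ch ω) : ℝ) + 1 ≤
          k + #{u ∈ ch ω | Declared k (ch ω) (colourClass c x S) u} := by exact_mod_cast h
      linarith
    rw [sum_sub_distrib, sum_const, card_univ, nsmul_eq_mul] at h2
    rw [hy, h1]
    linarith
  have hcol : ∀ c ∈ X, Real.log 2 * (4 ^ N * y) < Real.log 2 *
      ∑ x, ∑ S : Finset P, sampleWeight S *
      (3 / 5 * declaredCount k ch (colourClass c x S) - 13 / 5 * falseCount k ch c x S) := by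
    intro c hc
    refine mul_lt_mul_of_pos_left ?_ hl2
    have hx : ∀ x, 4 ^ N * y / 2 < ∑ S : Finset P, sampleWeight S *
        (3 / 5 * declaredCount k ch (colourClass c x S) - 13 / 5 * falseCount k ch c x S) := by
      intro x
      have hL : ∀ ω, (#(ch ω) : ℝ) ≤ 2 * k := fun ω => by
        exact_mod_cast (hval c hc).card_chain_le (hch ω)
      have h1 := sum_falseCount_le hq hch hL hτ (c := c) (x := x)
        (fun S => (hval c hc).chainRank_lt x S)
        (fun S v hv => (hval c hc).chainRank_add_two_le S hv)
      have h2 : 4 ^ N * y ≤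
          ∑ S : Finset P, sampleWeight S * declaredCount k ch (colourClass c x S) := by
        rw [← sum_sampleWeight, sum_mul]
        exact sum_le_sum fun S _ =>
          mul_le_mul_of_nonneg_left (hdecl c hc x S) (sampleWeight_pos S).le
      have h0 : 0 < 4 ^ N * y := by positivity
      have h3 : ∑ S : Finset P, sampleWeight S * (3 / 5 *
          declaredCount k ch (colourClass c x S) - 13 / 5 * falseCount k ch c x S) =
          3 / 5 * ∑ S : Finset P, sampleWeight S * declaredCount k ch (colourClass c x S) -
          13 / 5 * ∑ S : Finset P, sampleWeight S * falseCount k ch c x S := by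
        rw [mul_sum, mul_sum, ← sum_sub_distrib]
        exact sum_congr rfl fun S _ => by ring
      rw [h3]
      set D := ∑ S : Finset P, sampleWeight S * declaredCount k ch (colourClass c x S)
      nlinarith
    rw [Fintype.sum_bool]
    have := hx true
    have := hx false
    linarith
  have htot : #X * (Real.log 2 * (4 ^ N * y)) < ∑ c ∈ X, ∑ v, (#{ω | v ∈ ch ω} : ℝ) *
      ∑ S : Finset P, (if v ∉ S then sampleWeight S *
      Real.log (1 + (if c v then -1 else 1) * (3 / 4 *
        (declaredAt k ch (colourClass c true S) v / #{ω | v ∈ ch ω} -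
          declaredAt k ch (colourClass c false S) v / #{ω | v ∈ ch ω}))) else 0) := by
    rw [← nsmul_eq_mul, ← sum_const]
    exact sum_lt_sum_of_nonempty hX fun c hc =>
      (hcol c hc).trans_le (le_sum_log_of_noMonoChain hW c)
  have hM : 0 < (#X : ℝ) * 4 ^ N * Real.log 2 := by positivity
  refine lt_of_mul_lt_mul_left (a := (#X : ℝ) * 4 ^ N * Real.log 2) ?_ hM.le
  have hfin : (#X : ℝ) * 4 ^ N * Real.log 2 * (((k : ℝ) - 1) * Fintype.card Ω) =
      (#X : ℝ) * 4 ^ N * Real.log 2 * ∑ v, (#{ω | v ∈ ch ω} : ℝ) -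
        #X * (Real.log 2 * (4 ^ N * y)) := by rw [hy]; ring
  rw [hfin]
  linarith

end Abstract

section PrefixSymmetry

open Numbering

lemma le_choose {a b : ℕ} (ha : 0 < a) (hab : a < b) : b ≤ b.choose a := by
  induction b generalizing a with
  | zero => omega
  | succ b ih =>
    obtain ⟨a, rfl⟩ : ∃ a', a = a' + 1 := ⟨a - 1, by omega⟩
    rw [Nat.choose_succ_succ']
    rcases Nat.lt_or_ge (a + 1) b with h | h
    · have := ih (by omega : 0 < a + 1) h
      have := Nat.choose_pos (n := b) (k := a) (by omega)
      omega
    · obtain rfl : b = a + 1 := by omega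
      simp

variable {X : Type*} [Fintype X] [DecidableEq X]

lemma exists_perm_of_card_eq {s t B : Finset X} (hs : s ⊆ B) (ht : t ⊆ B) (h : #s = #t) :
    ∃ π : Equiv.Perm X, (∀ x ∉ B, π x = x) ∧ ∀ x, x ∈ s ↔ π x ∈ t := by
  have hcard : Fintype.card {x : B // x.1 ∈ s} = Fintype.card {x : B // x.1 ∈ t} := by
    have : ∀ r : Finset X, r ⊆ B → Fintype.card {x : B // x.1 ∈ r} = #r := fun r hr => by
      rw [Fintype.card_subtype, ← card_map (Function.Embedding.subtype _)]
      congr 1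
      ext x
      simp only [mem_map, mem_filter, mem_univ, true_and, Function.Embedding.subtype_apply,
        Subtype.exists, exists_and_right, exists_eq_right]
      exact ⟨fun h => h.2, fun h => ⟨hr h, h⟩⟩
    rw [this s hs, this t ht, h]
  let e := Fintype.equivOfCardEq hcard
  refine ⟨Equiv.Perm.ofSubtype e.extendSubtype, fun x hx =>
    Equiv.Perm.ofSubtype_apply_of_not_mem _ hx, fun x => ?_⟩
  by_cases hx : x ∈ B
  · have : Equiv.Perm.ofSubtype e.extendSubtype x = (e.extendSubtype ⟨x, hx⟩ : B) :=
      Equiv.Perm.ofSubtype_apply_coe _ (⟨x, hx⟩ : B)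
    rw [this]
    constructor
    · intro h
      exact e.extendSubtype_mem ⟨x, hx⟩ h
    · intro h
      by_contra hns
      exact e.extendSubtype_not_mem ⟨x, hx⟩ hns h
  · rw [Equiv.Perm.ofSubtype_apply_of_not_mem _ hx]
    exact ⟨fun h => absurd (hs h) hx, fun h => absurd (ht h) hx⟩

omit [DecidableEq X] in
lemma isPrefix_trans {π : Equiv.Perm X} {f : Numbering X} {s t : Finset X} (hst : #s = #t)
    (h : ∀ x, x ∈ s ↔ π x ∈ t) : IsPrefix (π.trans f) s ↔ IsPrefix f t := by
  unfold IsPrefix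
  constructor
  · intro H y
    have := H (π.symm y)
    rw [h] at this
    simpa [hst] using this
  · intro H x
    rw [h, H, hst]
    rfl

open Classical in
/-- Among the numberings with prefix `B` in an event only depending on the order outside `B`,
at most a fraction `1 / |B|` has a given proper nonempty subset of `B` as a prefix. -/
lemma card_mul_card_prefix_le {v B : Finset X} (hvB : v ⊂ B) (hv : v.Nonempty)
    (E : Numbering X → Prop)
    (hE : ∀ (π : Equiv.Perm X) f, (∀ x ∉ B, π x = x) → E f → E (π.trans f)) :
    #B * #{f | IsPrefix f v ∧ E f} ≤ #{f | E f} := by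
  have hle : ∀ v' ∈ powersetCard #v B, #{f | IsPrefix f v ∧ E f} ≤ #{f | IsPrefix f v' ∧ E f} := by
    intro v' hv'
    rw [mem_powersetCard] at hv'
    obtain ⟨π, h1, h2⟩ := exists_perm_of_card_eq hv'.1 hvB.subset hv'.2
    refine card_le_card_of_injOn (fun f => π.trans f) ?_ ?_
    · intro f hf
      simp only [coe_filter, mem_univ, true_and, Set.mem_ofPred_eq] at hf ⊢
      exact ⟨(isPrefix_trans hv'.2 h2).2 hf.1, hE π f h1 hf.2⟩
    · intro f _ g _ hfg
      ext x
      have := congrArg (fun e : Numbering X => e (π.symm x)) hfg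
      simpa using congrArg Fin.val this
  have hdisj : (↑(powersetCard #v B) : Set (Finset X)).PairwiseDisjoint
      fun v' => ({f | IsPrefix f v' ∧ E f} : Finset (Numbering X)) := by
    intro a ha b hb hab
    simp only [mem_coe, mem_powersetCard] at ha hb
    rw [Function.onFun, disjoint_left]
    intro f hfa hfb
    simp only [mem_filter, mem_univ, true_and] at hfa hfb
    exact hab (eq_of_subset_of_card_le (hfa.1.subset_of_card_le_card hfb.1 (by omega)) (by omega))
  calc #B * #{f | IsPrefix f v ∧ E f} ≤ (#B).choose #v * #{f | IsPrefix f v ∧ E f} :=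
        Nat.mul_le_mul_right _ (le_choose hv.card_pos (card_lt_card hvB))
    _ = ∑ v' ∈ powersetCard #v B, #{f | IsPrefix f v ∧ E f} := by
        rw [sum_const, card_powersetCard, smul_eq_mul]
    _ ≤ ∑ v' ∈ powersetCard #v B, #{f | IsPrefix f v' ∧ E f} := sum_le_sum hle
    _ = #((powersetCard #v B).biUnion fun v' => {f | IsPrefix f v' ∧ E f}) :=
        (card_biUnion hdisj).symm
    _ ≤ _ := card_le_card fun f hf => by
        simp only [mem_biUnion, mem_filter, mem_univ, true_and] at hf ⊢
        obtain ⟨v', -, -, h⟩ := hf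
        exact h

end PrefixSymmetry

section RandomChain

open Numbering

variable {n : ℕ} (F : Finset (Finset (Fin n)))

/-- The members of `F` on the maximal chain of prefixes of a numbering, except that of the small
members only those of one prescribed size are kept. -/
def prefixChain (ω : Numbering (Fin n) × Fin n) : Finset {A // A ∈ F} :=
  {A | IsPrefix ω.1 A.1 ∧ (n ≤ 4 * #A.1 ∨ #A.1 = ω.2)}

variable {F}

lemma mem_prefixChain {ω : Numbering (Fin n) × Fin n} {A : {A // A ∈ F}} :
    A ∈ prefixChain F ω ↔ IsPrefix ω.1 A.1 ∧ (n ≤ 4 * #A.1 ∨ #A.1 = ω.2) := by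
  simp [prefixChain]

lemma isChain_prefixChain (ω : Numbering (Fin n) × Fin n) :
    IsChain (· ≤ ·) (prefixChain F ω : Set {A // A ∈ F}) := by
  intro a ha b hb _
  rw [mem_coe, mem_prefixChain] at ha hb
  rcases le_total #a.1 #b.1 with h | h
  · exact Or.inl (ha.1.subset_of_card_le_card hb.1 h)
  · exact Or.inr (hb.1.subset_of_card_le_card ha.1 h)

open Classical in
lemma card_mem_prefixChain (hn : 0 < n) (A : {A // A ∈ F}) :
    (#{ω | A ∈ prefixChain F ω} : ℝ) = Fintype.card (Numbering (Fin n) × Fin n) *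
      (if n ≤ 4 * #A.1 then (n.choose #A.1 : ℝ)⁻¹ else (n * n.choose #A.1 : ℝ)⁻¹) := by
  have hA : #A.1 ≤ n := by simpa using card_le_univ A.1
  have hpre : (#(prefixed A.1) : ℝ) = n.factorial * (n.choose #A.1 : ℝ)⁻¹ := by
    rw [card_prefixed, Fintype.card_fin, ← Nat.choose_mul_factorial_mul_factorial hA]
    have : (0 : ℝ) < n.choose #A.1 := by exact_mod_cast Nat.choose_pos hA
    push_cast
    field_simp
  have hΩ : Fintype.card (Numbering (Fin n) × Fin n) = n.factorial * n := by
    simp [Fintype.card_prod, Fintype.card_numbering]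
  rw [hΩ]
  have hn' : (0 : ℝ) < n := by exact_mod_cast hn
  have hcn : #(univ : Finset (Fin n)) = n := by simp
  split_ifs with h
  · have : ({ω | A ∈ prefixChain F ω} : Finset (Numbering (Fin n) × Fin n)) =
        prefixed A.1 ×ˢ univ := by
      ext ω
      simp [mem_prefixChain, h]
    rw [this, card_product, hcn]
    push_cast
    rw [hpre]
    ring
  · have : ({ω | A ∈ prefixChain F ω} : Finset (Numbering (Fin n) × Fin n)) =
        prefixed A.1 ×ˢ {⟨#A.1, by omega⟩} := by
      ext ω
      simp only [mem_filter, mem_univ, true_and, mem_prefixChain, mem_product, mem_singleton,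
        Fin.ext_iff, mem_prefixed, h, false_or]
      exact and_congr_right fun _ => eq_comm
    rw [this, card_product, card_singleton, mul_one, hpre]
    push_cast
    field_simp

open Classical in
lemma upCount_prefixChain {b : {A // A ∈ F}} (hb : n ≤ 4 * #b.1) (ω : Numbering (Fin n) × Fin n) :
    upCount (prefixChain F ω) b = #{u : {A // A ∈ F} | IsPrefix ω.1 u.1 ∧ b ≤ u} := by
  unfold upCount
  congr 1
  ext u
  simp only [mem_filter, mem_univ, true_and, mem_prefixChain]
  constructor
  · rintro ⟨h1, h2⟩
    exact ⟨h1.1, h2⟩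
  · rintro ⟨h1, h2⟩
    have : #b.1 ≤ #u.1 := card_le_card h2
    exact ⟨⟨h1, Or.inl (by omega)⟩, h2⟩

open Classical in
lemma card_prefixChain_pair_le (hn : 0 < n) {k : ℕ} {v b : {A // A ∈ F}} (hvb : v < b) (j : ℕ) :
    (#{ω | v ∈ prefixChain F ω ∧ b ∈ prefixChain F ω ∧
        k ≤ upCount (prefixChain F ω) b + j} : ℝ) ≤
      4 / n * #{ω | b ∈ prefixChain F ω ∧ k ≤ upCount (prefixChain F ω) b + j} := by
  have hn' : (0 : ℝ) < n := by exact_mod_cast hn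
  have hcn : #(univ : Finset (Fin n)) = n := by simp
  have hss : v.1 ⊂ b.1 := hvb
  have hcard := card_lt_card hss
  rcases Nat.lt_or_ge (4 * #b.1) n with hb | hb
  · have : ({ω | v ∈ prefixChain F ω ∧ b ∈ prefixChain F ω ∧
        k ≤ upCount (prefixChain F ω) b + j} : Finset (Numbering (Fin n) × Fin n)) = ∅ := by
      refine filter_false_of_mem fun ω _ h => ?_
      rw [mem_prefixChain, mem_prefixChain] at h
      omega
    rw [this]
    simp only [card_empty, Nat.cast_zero]
    positivity
  obtain ⟨E, hE⟩ : ∃ E : Numbering (Fin n) → Prop, E = fun f => IsPrefix f b.1 ∧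
    k ≤ #{u : {A // A ∈ F} | IsPrefix f u.1 ∧ b ≤ u} + j := ⟨_, rfl⟩
  have hR : ({ω | b ∈ prefixChain F ω ∧ k ≤ upCount (prefixChain F ω) b + j} :
      Finset (Numbering (Fin n) × Fin n)) = ({f | E f} : Finset (Numbering (Fin n))) ×ˢ univ := by
    ext ω
    simp [mem_prefixChain, upCount_prefixChain hb, hb, hE]
  rw [hR, card_product, hcn]
  push_cast
  rw [show (4 : ℝ) / n * (#{f | E f} * n) = 4 * #{f | E f} by field_simp]
  rcases Nat.lt_or_ge (4 * #v.1) n with hv | hv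
  · have hL : ({ω | v ∈ prefixChain F ω ∧ b ∈ prefixChain F ω ∧
        k ≤ upCount (prefixChain F ω) b + j} : Finset (Numbering (Fin n) × Fin n)) ⊆
        ({f | E f} : Finset (Numbering (Fin n))) ×ˢ {⟨#v.1, by omega⟩} := by
      intro ω
      simp only [mem_prefixChain, upCount_prefixChain hb, mem_filter, mem_univ, true_and, hE,
        mem_product, mem_singleton, Fin.ext_iff]
      rintro ⟨⟨-, h1⟩, ⟨h2, -⟩, h3⟩
      exact ⟨⟨h2, h3⟩, by omega⟩
    have h := card_le_card hL
    rw [card_product, card_singleton, mul_one] at h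
    have h' : (#{ω | v ∈ prefixChain F ω ∧ b ∈ prefixChain F ω ∧
        k ≤ upCount (prefixChain F ω) b + j} : ℝ) ≤ #{f | E f} := by exact_mod_cast h
    have h0 : (0 : ℝ) ≤ #{f | E f} := by positivity
    linarith
  · have hL : ({ω | v ∈ prefixChain F ω ∧ b ∈ prefixChain F ω ∧
        k ≤ upCount (prefixChain F ω) b + j} : Finset (Numbering (Fin n) × Fin n)) =
        ({f | IsPrefix f v.1 ∧ E f} : Finset (Numbering (Fin n))) ×ˢ univ := by
      ext ω
      simp [mem_prefixChain, upCount_prefixChain hb, hb, hv, hE]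
    rw [hL, card_product, hcn]
    have h := card_mul_card_prefix_le hss (card_pos.1 (by omega)) E (by
      rw [hE]
      rintro π f hπ ⟨h1, h2⟩
      have hmem : ∀ u : Finset (Fin n), b.1 ⊆ u → ∀ x, x ∈ u ↔ π x ∈ u := by
        intro u hu x
        by_cases hx : x ∈ b.1
        · have : π x ∈ b.1 := by
            by_contra hc
            exact hc ((π.injective (hπ _ hc)).symm ▸ hx)
          exact ⟨fun _ => hu this, fun _ => hu hx⟩
        · rw [hπ x hx]
      refine ⟨(isPrefix_trans rfl (hmem b.1 (Subset.refl _))).2 h1, h2.trans ?_⟩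
      refine Nat.add_le_add_right (card_le_card fun u hu => ?_) j
      simp only [mem_filter, mem_univ, true_and] at hu ⊢
      exact ⟨(isPrefix_trans rfl (hmem u.1 hu.2)).2 hu.1, hu.2⟩)
    have h4 : #{f | IsPrefix f v.1 ∧ E f} * n ≤ 4 * #{f | E f} := by
      calc _ ≤ #{f | IsPrefix f v.1 ∧ E f} * (4 * #b.1) := Nat.mul_le_mul_left _ hb
        _ = 4 * (#b.1 * #{f | IsPrefix f v.1 ∧ E f}) := by ring
        _ ≤ _ := Nat.mul_le_mul_left _ h
    exact_mod_cast h4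

end RandomChain

section Knapsack

lemma choose_le_choose_of_le_half {n i j : ℕ} (hij : i ≤ j) (hj : j ≤ n / 2) :
    n.choose i ≤ n.choose j := by
  induction j, hij using Nat.le_induction with
  | base => exact le_rfl
  | succ j _ ih => exact (ih (by omega)).trans (Nat.choose_le_succ_of_lt_half_left (by omega))

lemma two_pow_mul_choose_le {n j s : ℕ} (h : 3 * (j + s) ≤ n) :
    2 ^ s * n.choose j ≤ n.choose (j + s) := by
  induction s with
  | zero => simp
  | succ s ih =>
    have h1 := ih (by omega)
    have h2 := Nat.choose_succ_right_eq n (j + s)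
    have h3 : 2 * (j + s + 1) ≤ n - (j + s) := by omega
    have h4 : 2 * n.choose (j + s) ≤ n.choose (j + s + 1) := by
      refine Nat.le_of_mul_le_mul_right ?_ (Nat.succ_pos (j + s))
      calc 2 * n.choose (j + s) * (j + s + 1) = n.choose (j + s) * (2 * (j + s + 1)) := by ring
        _ ≤ n.choose (j + s) * (n - (j + s)) := Nat.mul_le_mul_left _ h3
        _ = _ := h2.symm
    rw [pow_succ]
    change _ ≤ n.choose (j + s + 1)
    linarith

lemma mul_choose_le_choose {n i j : ℕ} (hn : 200 ≤ n) (hj : 4 * j < n) (hi : n ≤ 3 * i + 2)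
    (hi2 : i ≤ n / 2) : n * n.choose j ≤ n.choose i := by
  obtain ⟨s, hs⟩ : ∃ s, j + s = n / 3 := ⟨n / 3 - j, by omega⟩
  have hpow : ∀ s : ℕ, 10 ≤ s → 12 * (s + 2) ≤ 2 ^ s := by
    intro s hs
    induction s, hs using Nat.le_induction with
    | base => norm_num
    | succ s _ ih => rw [pow_succ]; omega
  have h1 := hpow s (by omega)
  calc n * n.choose j ≤ 2 ^ s * n.choose j := Nat.mul_le_mul_right _ (by omega)
    _ ≤ n.choose (j + s) := two_pow_mul_choose_le (by omega)
    _ ≤ n.choose i := choose_le_choose_of_le_half (by omega) hi2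

/-- The probability that a set of size `i` lies on the random chain `prefixChain`. -/
noncomputable def levelWeight (n i : ℕ) : ℝ :=
  if n ≤ 4 * i then (n.choose i : ℝ)⁻¹ else (n * n.choose i : ℝ)⁻¹

lemma levelWeight_middle {n k i : ℕ} (hk : 2 ≤ k) (hn : 100 * k ≤ n)
    (hi : i ∈ Icc ((n - k + 2) / 2) ((n + k - 2) / 2)) :
    levelWeight n i = (n.choose i : ℝ)⁻¹ ∧
      levelWeight n i ≤ (n.choose ((n - k + 2) / 2) : ℝ)⁻¹ := by
  rw [mem_Icc] at hi
  have h1 : levelWeight n i = (n.choose i : ℝ)⁻¹ := if_pos (by omega)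
  refine ⟨h1, ?_⟩
  rw [h1]
  have hle : n.choose ((n - k + 2) / 2) ≤ n.choose i := by
    rcases Nat.lt_or_ge (n / 2) i with h | h
    · rw [← Nat.choose_symm (n := n) (k := i) (by omega)]
      exact choose_le_choose_of_le_half (by omega) (by omega)
    · exact choose_le_choose_of_le_half hi.1 h
  have h0 : 0 < n.choose ((n - k + 2) / 2) := Nat.choose_pos (by omega)
  gcongr

lemma le_levelWeight {n k i : ℕ} (hk : 2 ≤ k) (hn : 100 * k ≤ n) (hin : i ≤ n)
    (hi : i ∉ Icc ((n - k + 2) / 2) ((n + k - 2) / 2)) :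
    (n.choose ((n - k + 2) / 2) : ℝ)⁻¹ ≤ levelWeight n i := by
  rw [mem_Icc] at hi
  have h0 : 0 < n.choose i := Nat.choose_pos hin
  unfold levelWeight
  split_ifs with h
  · have hle : n.choose i ≤ n.choose ((n - k + 2) / 2) := by
      rcases Nat.lt_or_ge i ((n - k + 2) / 2) with h | h
      · exact choose_le_choose_of_le_half h.le (by omega)
      · rw [← Nat.choose_symm hin]
        exact choose_le_choose_of_le_half (by omega) (by omega)
    gcongr
  · have hle : n * n.choose i ≤ n.choose ((n - k + 2) / 2) :=
      mul_choose_le_choose (by omega) (by omega) (by omega) (by omega)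
    have h0' : 0 < n * n.choose i := Nat.mul_pos (by omega) h0
    rw [← Nat.cast_mul]
    gcongr

lemma sum_middle {n k : ℕ} (f : ℕ → ℝ) :
    ∑ A : Finset (Fin n), (if #A ∈ Icc ((n - k + 2) / 2) ((n + k - 2) / 2) then f #A else 0) =
      ∑ i ∈ Icc ((n - k + 2) / 2) ((n + k - 2) / 2), n.choose i * f i := by
  rw [← sum_filter, ← sum_fiberwise_of_maps_to (g := fun A : Finset (Fin n) => #A)
    (t := Icc ((n - k + 2) / 2) ((n + k - 2) / 2)) fun A hA => (mem_filter.1 hA).2]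
  refine sum_congr rfl fun i hi => ?_
  have : ({A ∈ ({A | #A ∈ Icc ((n - k + 2) / 2) ((n + k - 2) / 2)} : Finset (Finset (Fin n))) |
      #A = i} : Finset (Finset (Fin n))) = powersetCard i univ := by
    ext A
    simp only [mem_filter, mem_univ, true_and, mem_powersetCard, subset_univ]
    exact ⟨fun h => h.2, fun h => ⟨h ▸ hi, h⟩⟩
  rw [this, sum_congr rfl fun A hA => by rw [(mem_powersetCard.1 hA).2], sum_const,
    card_powersetCard, card_univ, Fintype.card_fin, nsmul_eq_mul]

lemma sub_mul_le_sum_levelWeight {n k : ℕ} (hk : 2 ≤ k) (hn : 100 * k ≤ n)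
    (F : Finset (Finset (Fin n))) (g : {A // A ∈ F} → ℝ) (hg : ∀ v, 0 ≤ g v ∧ g v ≤ 1) :
    (∑ v, g v - mSize n k) * (n.choose ((n - k + 2) / 2) : ℝ)⁻¹ ≤
      ∑ v, levelWeight n #v.1 * g v - (k - 1) := by
  classical
  set w := (n.choose ((n - k + 2) / 2) : ℝ)⁻¹
  set M := Icc ((n - k + 2) / 2) ((n + k - 2) / 2) with hM
  set G : Finset (Fin n) → ℝ := fun A => if h : A ∈ F then g ⟨A, h⟩ else 0 with hG
  have hext : ∀ f : Finset (Fin n) → ℝ, ∑ v : {A // A ∈ F}, f v.1 * g v = ∑ A, f A * G A := by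
    intro f
    have h1 : ∑ v : {A // A ∈ F}, f v.1 * g v = ∑ v : {A // A ∈ F}, f v.1 * G v.1 :=
      sum_congr rfl fun v _ => by simp [hG]
    rw [h1, univ_eq_attach, sum_attach F fun A => f A * G A]
    refine sum_subset (subset_univ F) fun A _ hA => by simp [hG, hA]
  have hterm : ∀ A : Finset (Fin n),
      0 ≤ (G A - if #A ∈ M then 1 else 0) * (levelWeight n #A - w) := by
    intro A
    have hG01 : 0 ≤ G A ∧ G A ≤ 1 := by
      simp only [hG]
      split_ifs
      · exact hg _
      · norm_num
    split_ifs with h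
    · exact mul_nonneg_of_nonpos_of_nonpos (by linarith)
        (sub_nonpos.2 (levelWeight_middle hk hn h).2)
    · exact mul_nonneg (by linarith)
        (sub_nonneg.2 (le_levelWeight hk hn (by simpa using card_le_univ A) h))
  have hsum := sum_nonneg fun (A : Finset (Fin n)) (_ : A ∈ univ) => hterm A
  have hexp : ∑ A : Finset (Fin n), (G A - if #A ∈ M then 1 else 0) * (levelWeight n #A - w) =
      ∑ A, levelWeight n #A * G A - w * ∑ A, G A -
        ∑ A : Finset (Fin n), (if #A ∈ M then levelWeight n #A else 0) +
        w * ∑ A : Finset (Fin n), (if #A ∈ M then 1 else 0) := by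
    rw [mul_sum, mul_sum, ← sum_sub_distrib, ← sum_sub_distrib, ← sum_add_distrib]
    refine sum_congr rfl fun A _ => ?_
    split_ifs <;> ring
  have h1 : ∑ A : Finset (Fin n), (if #A ∈ M then levelWeight n #A else 0) = k - 1 := by
    rw [sum_middle (levelWeight n)]
    have : ∀ i ∈ M, (n.choose i : ℝ) * levelWeight n i = 1 := fun i hi => by
      rw [(levelWeight_middle hk hn hi).1]
      have : 0 < n.choose i := Nat.choose_pos (by rw [hM, mem_Icc] at hi; omega)
      have : (0 : ℝ) < n.choose i := by exact_mod_cast this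
      field_simp
    rw [sum_congr rfl this, sum_const, hM, Nat.card_Icc, nsmul_eq_mul, mul_one]
    rw [show (n + k - 2) / 2 + 1 - (n - k + 2) / 2 = k - 1 by omega, Nat.cast_sub (by omega)]
    simp
  have h2 : ∑ A : Finset (Fin n), (if #A ∈ M then (1 : ℝ) else 0) = mSize n k := by
    rw [sum_middle fun _ => (1 : ℝ)]
    simp [mSize]
  have h3 := hext fun _ => 1
  simp only [one_mul] at h3
  rw [hext fun A => levelWeight n #A, h3]
  rw [hexp, h1, h2] at hsum
  linarith

end Knapsack

section Counting

variable {n k : ℕ} {F : Finset (Finset (Fin n))}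

lemma exists_strictMono_of_isChain {C : Finset {A // A ∈ F}}
    (hC : IsChain (· ≤ ·) (C : Set {A // A ∈ F})) (hk : k ≤ #C) :
    ∃ ch : Fin k → {A // A ∈ F}, (∀ i, ch i ∈ C) ∧ ∀ i j, i < j → (ch i).1 ⊂ (ch j).1 := by
  classical
  have hinj : Set.InjOn (fun A : {A // A ∈ F} => #A.1) C := by
    intro a ha b hb hab
    rcases hC.total ha hb with h | h
    · exact Subtype.ext (eq_of_subset_of_card_le h hab.ge)
    · exact Subtype.ext (eq_of_subset_of_card_le h hab.le).symm
  have hcard : k ≤ #(C.image fun A => #A.1) := by rwa [card_image_of_injOn hinj]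
  have hmem := fun i => orderEmbOfCardLe_mem _ hcard i
  simp only [mem_image] at hmem
  choose ch hch hch' using hmem
  refine ⟨ch, hch, fun i j hij => ?_⟩
  have hlt : #(ch i).1 < #(ch j).1 := by
    rw [hch', hch']
    exact (orderEmbOfCardLe _ hcard).strictMono hij
  rcases hC.total (hch i) (hch j) with h | h
  · exact ⟨h, fun h' => absurd (card_le_card h') (by omega)⟩
  · exact absurd (card_le_card (show (ch j).1 ⊆ (ch i).1 from h)) (by omega)

lemma noMonoChain_of_isRKColouring {c : {A // A ∈ F} → Fin 2} (hc : IsRKColouring k F c) :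
    NoMonoChain k fun A => decide (c A = 1) := by
  intro C hC hmono
  by_contra hlt
  obtain ⟨ch, hch, hss⟩ := exists_strictMono_of_isChain hC (not_lt.1 hlt)
  obtain ⟨i, j, hij⟩ := hc ch hss
  have := hmono _ (hch i) _ (hch j)
  rw [decide_eq_decide] at this
  omega

lemma numColourings_le_two_pow : numColourings 2 k n F ≤ 2 ^ #F := by
  have h := Finite.card_subtype_le fun c : {A // A ∈ F} → Fin 2 => IsRKColouring k F c
  simpa [numColourings] using h

lemma numColourings_eq_two_pow_iff :
    numColourings 2 k n F = 2 ^ #F ↔ kChainFree k F := by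
  constructor
  · rintro h ⟨ch, hF, hss⟩
    have hall : ∀ c : {A // A ∈ F} → Fin 2, IsRKColouring k F c := by
      by_contra! hne
      obtain ⟨c, hc⟩ := hne
      have := Finite.card_subtype_lt (p := fun c : {A // A ∈ F} → Fin 2 => IsRKColouring k F c) hc
      simp only [Nat.card_eq_fintype_card (α := {A // A ∈ F} → Fin 2), Fintype.card_fun,
        Fintype.card_fin, Fintype.card_coe] at this
      unfold numColourings at h
      omega
    obtain ⟨i, j, hij⟩ := hall (fun _ => 0) (fun i => ⟨ch i, hF i⟩) hss
    exact hij rfl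
  · intro h
    have hall : ∀ c : {A // A ∈ F} → Fin 2, IsRKColouring k F c := fun c ch hss =>
      absurd ⟨fun i => (ch i).1, fun i => (ch i).2, hss⟩ h
    unfold numColourings
    rw [Nat.card_congr (Equiv.subtypeUnivEquiv hall)]
    simp

lemma numColourings_lt_two_pow (hk : 2 ≤ k) (hn : 1000 * k ≤ n) (hF : mSize n k < #F) :
    numColourings 2 k n F < 2 ^ mSize n k := by
  classical
  have hn0 : 0 < n := by omega
  have hn0' : (0 : ℝ) < n := by exact_mod_cast hn0
  have hw : (0 : ℝ) < (n.choose ((n - k + 2) / 2) : ℝ)⁻¹ := by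
    have : 0 < n.choose ((n - k + 2) / 2) := Nat.choose_pos (by omega)
    have : (0 : ℝ) < n.choose ((n - k + 2) / 2) := by exact_mod_cast this
    positivity
  set X : Finset ({A // A ∈ F} → Bool) := {c | NoMonoChain k c} with hX
  have hZ : numColourings 2 k n F ≤ #X := by
    unfold numColourings
    rw [← Nat.card_eq_finsetCard X]
    refine Nat.card_le_card_of_injective
      (fun c => (⟨fun A => decide (c.1 A = 1), ?_⟩ : {c // c ∈ X})) ?_
    · simpa [hX] using noMonoChain_of_isRKColouring c.2
    · intro c c' h
      ext A
      have := congrFun (congrArg Subtype.val h) A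
      simp only [decide_eq_decide] at this
      omega
  rcases X.eq_empty_or_nonempty with h0 | hne
  · rw [h0, card_empty] at hZ
    exact lt_of_le_of_lt hZ (by positivity)
  have hΩ : (0 : ℝ) < Fintype.card (Numbering (Fin n) × Fin n) := by
    have : Nonempty (Numbering (Fin n) × Fin n) := ⟨(Fintype.equivFin _, ⟨0, hn0⟩)⟩
    exact_mod_cast Fintype.card_pos
  have hcm : ∀ v : {A // A ∈ F}, (#{ω | v ∈ prefixChain F ω} : ℝ) =
      Fintype.card (Numbering (Fin n) × Fin n) * levelWeight n #v.1 :=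
    fun v => card_mem_prefixChain hn0 v
  have hlw : ∀ v : {A // A ∈ F}, 0 < levelWeight n #v.1 := fun v => by
    have : 0 < n.choose #v.1 := Nat.choose_pos (by simpa using card_le_univ v.1)
    have : (0 : ℝ) < n.choose #v.1 := by exact_mod_cast this
    unfold levelWeight
    split_ifs <;> positivity
  have hlarge := sub_mul_le_sum_levelWeight hk (by omega) F (fun _ => 1) fun _ => by norm_num
  simp only [sum_const, card_univ, Fintype.card_coe, nsmul_eq_mul, mul_one] at hlarge
  have hF' : (mSize n k : ℝ) < #F := by exact_mod_cast hF
  have hpos : 0 < ((#F : ℝ) - mSize n k) * (n.choose ((n - k + 2) / 2) : ℝ)⁻¹ :=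
    mul_pos (by linarith) hw
  have hqk : 156 * (4 / (n : ℝ)) * k < 1 := by
    have : (1000 * k : ℝ) ≤ n := by exact_mod_cast hn
    have hk' : (2 : ℝ) ≤ k := by exact_mod_cast hk
    rw [show 156 * (4 / (n : ℝ)) * k = 624 * k / n by ring, div_lt_one hn0']
    linarith
  have hmem : ∀ v : {A // A ∈ F}, ∃ ω, v ∈ prefixChain F ω := fun v => by
    have h : (0 : ℝ) < #{ω | v ∈ prefixChain F ω} := by
      rw [hcm]
      exact mul_pos hΩ (hlw v)
    obtain ⟨ω, hω⟩ := card_pos.1 (Nat.cast_pos.1 h)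
    exact ⟨ω, (mem_filter.1 hω).2⟩
  have hbig : ((k : ℝ) - 1) * Fintype.card (Numbering (Fin n) × Fin n) <
      ∑ v : {A // A ∈ F}, (#{ω | v ∈ prefixChain F ω} : ℝ) := by
    simp only [hcm]
    rw [← mul_sum, mul_comm]
    exact mul_lt_mul_of_pos_left (by linarith) hΩ
  have hval : ∀ c ∈ X, NoMonoChain k c := fun c hc => by simpa [hX] using hc
  obtain ⟨g, hg, hlog, hsum⟩ := exists_weight_of_noMonoChain (k := k) (by omega) (q := 4 / n)
    (by positivity) hqk (ch := prefixChain F) isChain_prefixChain hmem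
    (fun v b hvb j => by convert card_prefixChain_pair_le hn0 hvb j) (by convert hbig) X hne hval
  have hsum' : ∑ v, levelWeight n #v.1 * g v < k - 1 := by
    refine lt_of_mul_lt_mul_left (a := (Fintype.card (Numbering (Fin n) × Fin n) : ℝ)) ?_ hΩ.le
    rw [mul_sum, mul_comm _ ((k : ℝ) - 1)]
    refine lt_of_eq_of_lt (sum_congr rfl fun v _ => ?_) hsum
    rw [← mul_assoc, ← hcm]
    congr!
  have hkn := sub_mul_le_sum_levelWeight hk (by omega) F g hg
  have hglt : ∑ v, g v < mSize n k := by
    by_contra hge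
    have := mul_nonneg (sub_nonneg.2 (not_lt.1 hge)) hw.le
    linarith
  have hX0 : (0 : ℝ) < #X := by exact_mod_cast hne.card_pos
  have hl2 : 0 < Real.log 2 := Real.log_pos (by norm_num)
  have hlt : Real.log #X < Real.log (2 ^ mSize n k) := by
    rw [Real.log_pow]
    exact hlog.trans_lt (mul_lt_mul_of_pos_right hglt hl2)
  have := (Real.log_lt_log_iff hX0 (by positivity)).1 hlt
  exact lt_of_le_of_lt hZ (by exact_mod_cast this)

end Counting

end ErdosRothschild

/-- There is an absolute constant `C > 0` such that for integers `k ≥ 2` and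
`n ≥ C·k⁴·log₂ k`, every family `𝓕 ⊆ 2^[n]` has at most `2^(m_{k-1})` `(2,k)`-colourings,
with equality iff `𝓕` is a `k`-chain-free family of maximum size `m_{k-1}`. -/
theorem erdos_rothschild_two_colours :
    ∃ C : ℝ, 0 < C ∧ ∀ n k : ℕ, 2 ≤ k → C * (k : ℝ) ^ 4 * Real.logb 2 k ≤ (n : ℝ) →
      ∀ F : Finset (Finset (Fin n)),
        numColourings 2 k n F ≤ 2 ^ (mSize n k) ∧
        (numColourings 2 k n F = 2 ^ (mSize n k) ↔
          (F.card = mSize n k ∧ kChainFree k F)) := by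
  refine ⟨1000, by norm_num, fun n k hk hn F => ?_⟩
  have hnk : 1000 * k ≤ n := by
    have hk' : (2 : ℝ) ≤ k := by exact_mod_cast hk
    have h1 : 1 ≤ Real.logb 2 k := by
      rw [Real.le_logb_iff_rpow_le (by norm_num) (by linarith)]
      simpa using hk'
    have h2 : (k : ℝ) ≤ (k : ℝ) ^ 4 := le_self_pow₀ (by linarith) (by norm_num)
    have h3 : (1000 * k : ℝ) ≤ n := by nlinarith
    exact_mod_cast h3
  rcases Nat.lt_or_ge (mSize n k) F.card with hF | hF
  · have h := ErdosRothschild.numColourings_lt_two_pow hk hnk hF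
    exact ⟨h.le, fun he => absurd he h.ne, fun he => absurd he.1 hF.ne'⟩
  · have hle := ErdosRothschild.numColourings_le_two_pow (k := k) (F := F)
    refine ⟨hle.trans (Nat.pow_le_pow_right two_pos hF), fun he => ?_, fun he => ?_⟩
    · have hcard : F.card = mSize n k :=
        le_antisymm hF ((Nat.pow_le_pow_iff_right one_lt_two).1 (he ▸ hle))
      exact ⟨hcard, ErdosRothschild.numColourings_eq_two_pow_iff.1 (hcard.symm ▸ he)⟩
    · rw [← he.1]
      exact ErdosRothschild.numColourings_eq_two_pow_iff.2 he.2
end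

section
/- For all integers k ≥ 2 and r ≥ 3 and every real ε > 0, there exists n₀ ∈ ℕ such that for all n ≥ n₀ one has f(r,k;n) ≤ 3^((1/3)·r·(k-1+ε)·C(n,⌊n/2⌋)). -/
lemma add_two_mul_factorial_mul_factorial_le (e c : ℕ) :
    (e + c + 2) * ((e + 1).factorial * (c + 1).factorial) ≤ (e + c + 2).factorial := by
  rw [Nat.factorial_succ (e + c + 1)]
  refine Nat.mul_le_mul le_rfl ?_
  induction e with
  | zero => simp
  | succ e ih =>
    have h : e + 1 + c + 1 = (e + c + 1) + 1 := by ring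
    rw [Nat.factorial_succ (e + 1), h, Nat.factorial_succ (e + c + 1), mul_assoc]
    exact Nat.mul_le_mul (by omega) ih

lemma mul_factorial_mul_factorial_le {a b : ℕ} (ha : 0 < a) (hab : a < b) :
    b * (a.factorial * (b - a).factorial) ≤ b.factorial := by
  obtain ⟨e, rfl⟩ : ∃ e, a = e + 1 := ⟨a - 1, by omega⟩
  obtain ⟨c, rfl⟩ : ∃ c, b = e + c + 2 := ⟨b - e - 2, by omega⟩
  have h : e + c + 2 - (e + 1) = c + 1 := by omega
  rw [h]
  exact add_two_mul_factorial_mul_factorial_le e c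

section Chains

open Finset Numbering

variable {X : Type*} [Fintype X] [DecidableEq X]

lemma card_prefixed_inter_le {s t : Finset X} (hst : s ⊆ t) :
    #(prefixed s ∩ prefixed t) ≤
      (#s).factorial * (#t - #s).factorial * (Fintype.card X - #t).factorial := by
  have hcard : #(s.subtype (· ∈ t)) = #s := by
    rw [card_subtype, filter_true_of_mem hst]
  have key : #(prefixed s ∩ prefixed t) ≤
      #(prefixed (s.subtype (· ∈ t)) ×ˢ (univ : Finset (Numbering ↑(tᶜ)))) := by
    refine card_le_card_of_injOn
      (fun f ↦ if h : f ∈ prefixed t then prefixedEquiv t ⟨f, h⟩ else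
        (Fintype.equivFin _, Fintype.equivFin _)) ?_ ?_
    · intro f hf
      obtain ⟨hs, ht⟩ := mem_inter.1 (mem_coe.1 hf)
      simp only [ht, dite_true, mem_coe, mem_product, mem_univ, and_true]
      rw [mem_prefixed]
      intro x
      rw [mem_subtype, hcard, mem_prefixed.1 hs x]
      rfl
    · intro f hf g hg hfg
      have hf' := (mem_inter.1 (mem_coe.1 hf)).2
      have hg' := (mem_inter.1 (mem_coe.1 hg)).2
      simp only [hf', hg', dite_true] at hfg
      simpa using (prefixedEquiv t).injective hfg
  refine key.trans (le_of_eq ?_)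
  rw [card_product, card_prefixed, hcard, card_univ, Fintype.card_numbering]
  simp

/-- If `s` is a nonempty proper subset of `t`, at most a fraction `1 / #t` of the numberings
starting with `t` also start with `s`. -/
lemma card_mul_card_prefixed_inter_le_right {s t : Finset X} (hs : s.Nonempty) (hst : s ⊂ t) :
    #t * #(prefixed s ∩ prefixed t) ≤ #(prefixed t) := by
  calc #t * #(prefixed s ∩ prefixed t)
      ≤ #t * ((#s).factorial * (#t - #s).factorial * (Fintype.card X - #t).factorial) :=
        Nat.mul_le_mul le_rfl (card_prefixed_inter_le hst.subset)
    _ = #t * ((#s).factorial * (#t - #s).factorial) * (Fintype.card X - #t).factorial := by ring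
    _ ≤ (#t).factorial * (Fintype.card X - #t).factorial :=
        Nat.mul_le_mul (mul_factorial_mul_factorial_le hs.card_pos (card_lt_card hst)) le_rfl
    _ = #(prefixed t) := (card_prefixed t).symm

/-- If `t ≠ univ` strictly contains `s`, at most a fraction `1 / #sᶜ` of the numberings starting
with `s` also start with `t`. -/
lemma card_mul_card_prefixed_inter_le_left {s t : Finset X} (ht : t ≠ univ) (hst : s ⊂ t) :
    (Fintype.card X - #s) * #(prefixed s ∩ prefixed t) ≤ #(prefixed s) := by
  have h1 := card_lt_card hst
  have h2 : #t < Fintype.card X := (card_lt_iff_ne_univ t).2 ht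
  have h3 := mul_factorial_mul_factorial_le (a := #t - #s) (b := Fintype.card X - #s)
    (by omega) (by omega)
  rw [show Fintype.card X - #s - (#t - #s) = Fintype.card X - #t by omega] at h3
  calc (Fintype.card X - #s) * #(prefixed s ∩ prefixed t)
      ≤ (Fintype.card X - #s) *
        ((#s).factorial * (#t - #s).factorial * (Fintype.card X - #t).factorial) :=
        Nat.mul_le_mul le_rfl (card_prefixed_inter_le hst.subset)
    _ = (#s).factorial * ((Fintype.card X - #s) *
        ((#t - #s).factorial * (Fintype.card X - #t).factorial)) := by ring
    _ ≤ (#s).factorial * (Fintype.card X - #s).factorial := Nat.mul_le_mul le_rfl h3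
    _ = #(prefixed s) := (card_prefixed s).symm

/-- The members of `F` that are prefixes of a given numbering form a chain, so that all but one
of them can be paired off with the smallest one. -/
lemma card_filter_prefix_le (F : Finset (Finset X)) (f : Numbering X) :
    #{s ∈ F | f ∈ prefixed s} ≤
      #{p ∈ F ×ˢ F | p.1 ⊂ p.2 ∧ f ∈ prefixed p.1 ∩ prefixed p.2} + 1 := by
  rcases ({s ∈ F | f ∈ prefixed s}).eq_empty_or_nonempty with h | h
  · rw [h]
    simp
  obtain ⟨m, hm, hmin⟩ := exists_min_image _ card h
  rw [← card_erase_add_one hm]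
  refine Nat.add_le_add_right (card_le_card_of_injOn (fun s ↦ (m, s)) ?_ ?_) 1
  · intro s hs
    obtain ⟨hsm, hs⟩ := mem_erase.1 (mem_coe.1 hs)
    have hle := hmin s hs
    obtain ⟨hsF, hs⟩ := mem_filter.1 hs
    obtain ⟨hmF, hm⟩ := mem_filter.1 hm
    simp only [mem_coe, mem_filter, mem_product, mem_inter]
    refine ⟨⟨hmF, hsF⟩, ?_, hm, hs⟩
    exact ((mem_prefixed.1 hm).subset_of_card_le_card (mem_prefixed.1 hs) hle).ssubset_of_ne
      hsm.symm
  · intro s _ t _ hst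
    exact (Prod.mk.inj hst).2

lemma sum_card_eq_sum_card_filter {ι κ : Type*} [Fintype κ] [DecidableEq κ] (S : Finset ι)
    (P : ι → Finset κ) : ∑ s ∈ S, #(P s) = ∑ f, #{s ∈ S | f ∈ P s} := by
  simp only [card_eq_sum_ones, sum_filter]
  rw [sum_comm]
  simp

lemma sum_card_prefixed_le (F : Finset (Finset X)) :
    ∑ s ∈ F, #(prefixed s) ≤
      ∑ p ∈ F ×ˢ F with p.1 ⊂ p.2, #(prefixed p.1 ∩ prefixed p.2) +
        (Fintype.card X).factorial := by
  have hN : (Fintype.card X).factorial = ∑ _f : Numbering X, 1 := by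
    simp
  rw [sum_card_eq_sum_card_filter F prefixed,
    sum_card_eq_sum_card_filter _ fun p : Finset X × Finset X ↦ prefixed p.1 ∩ prefixed p.2,
    hN, ← sum_add_distrib]
  refine sum_le_sum fun f _ ↦ ?_
  rw [filter_filter]
  exact card_filter_prefix_le F f

/-- A pair `s ⊂ t` can be charged to whichever of `s`, `t` makes `prefixed s ∩ prefixed t` a
fraction at most `2 / card X` of the numberings starting with it. -/
lemma card_mul_card_prefixed_inter_le {s t : Finset X} (hs : s.Nonempty) (ht : t ≠ univ)
    (hst : s ⊂ t) :
    Fintype.card X * #(prefixed s ∩ prefixed t) ≤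
      (if Fintype.card X ≤ 2 * #t then 2 * #(prefixed t) else 0) +
        (if Fintype.card X ≤ 2 * #s then 0 else 2 * #(prefixed s)) := by
  have h1 := card_mul_card_prefixed_inter_le_right hs hst
  have h2 := card_mul_card_prefixed_inter_le_left ht hst
  have hlt := card_lt_card hst
  have hcard := card_le_univ t
  by_cases h : Fintype.card X ≤ 2 * #t
  · rw [if_pos h]
    refine le_add_right ?_
    calc Fintype.card X * #(prefixed s ∩ prefixed t)
        ≤ 2 * #t * #(prefixed s ∩ prefixed t) := Nat.mul_le_mul h le_rfl
      _ ≤ 2 * #(prefixed t) := by rw [mul_assoc]; exact Nat.mul_le_mul le_rfl h1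
  · rw [if_neg h, if_neg (by omega), zero_add]
    calc Fintype.card X * #(prefixed s ∩ prefixed t)
        ≤ 2 * (Fintype.card X - #s) * #(prefixed s ∩ prefixed t) :=
          Nat.mul_le_mul (by omega) le_rfl
      _ ≤ 2 * #(prefixed s) := by rw [mul_assoc]; exact Nat.mul_le_mul le_rfl h2

lemma card_mul_sum_card_prefixed_inter_le {F : Finset (Finset X)} {d : ℕ} (h0 : ∅ ∉ F)
    (h1 : univ ∉ F) (hd : ∀ s ∈ F, #{t ∈ F | t ⊂ s ∨ s ⊂ t} ≤ d) :
    Fintype.card X * ∑ p ∈ F ×ˢ F with p.1 ⊂ p.2, #(prefixed p.1 ∩ prefixed p.2) ≤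
      2 * d * ∑ s ∈ F, #(prefixed s) := by
  have step : Fintype.card X * ∑ p ∈ F ×ˢ F with p.1 ⊂ p.2, #(prefixed p.1 ∩ prefixed p.2) ≤
      ∑ p ∈ F ×ˢ F with p.1 ⊂ p.2,
        ((if Fintype.card X ≤ 2 * #p.2 then 2 * #(prefixed p.2) else 0) +
        (if Fintype.card X ≤ 2 * #p.1 then 0 else 2 * #(prefixed p.1))) := by
    rw [mul_sum]
    refine sum_le_sum fun p hp ↦ ?_
    obtain ⟨hp, hlt⟩ := mem_filter.1 hp
    obtain ⟨hp1, hp2⟩ := mem_product.1 hp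
    exact card_mul_card_prefixed_inter_le
      (nonempty_iff_ne_empty.2 fun h ↦ h0 (h ▸ hp1)) (fun h ↦ h1 (h ▸ hp2)) hlt
  refine step.trans ?_
  rw [sum_add_distrib, sum_filter, sum_filter, sum_product_right, sum_product, ← sum_add_distrib,
    mul_sum]
  refine sum_le_sum fun s hs ↦ ?_
  by_cases h : Fintype.card X ≤ 2 * #s
  · simp only [if_pos h, ite_self, sum_const_zero, add_zero]
    rw [← sum_filter, sum_const, smul_eq_mul, mul_comm 2 d, mul_assoc]
    refine Nat.mul_le_mul ((card_le_card fun t ht ↦ ?_).trans (hd s hs)) le_rfl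
    simp only [mem_filter] at ht ⊢
    exact ⟨ht.1, Or.inl ht.2⟩
  · simp only [if_neg h, ite_self, sum_const_zero, zero_add]
    rw [← sum_filter, sum_const, smul_eq_mul, mul_comm 2 d, mul_assoc]
    refine Nat.mul_le_mul ((card_le_card fun t ht ↦ ?_).trans (hd s hs)) le_rfl
    simp only [mem_filter] at ht ⊢
    exact ⟨ht.1, Or.inr ht.2⟩

/-- Supersaturation for Sperner's theorem: a family in which every member is comparable to at most
`d` others is not much larger than the middle layer. -/
lemma card_mul_le_of_comparable_le {F : Finset (Finset X)} {d : ℕ} (h0 : ∅ ∉ F)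
    (h1 : univ ∉ F) (hd : ∀ s ∈ F, #{t ∈ F | t ⊂ s ∨ s ⊂ t} ≤ d) :
    (Fintype.card X - 2 * d) * #F ≤
      Fintype.card X * (Fintype.card X).choose (Fintype.card X / 2) := by
  set n := Fintype.card X with hn
  set W := ∑ s ∈ F, #(prefixed s) with hW
  set N := n.choose (n / 2) with hN
  have hlow : #F * n.factorial ≤ N * W := by
    rw [hW, mul_sum, card_eq_sum_ones, sum_mul]
    refine sum_le_sum fun s _ ↦ ?_
    rw [card_prefixed, one_mul, ← Nat.choose_mul_factorial_mul_factorial (card_le_univ s),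
      mul_assoc]
    exact Nat.mul_le_mul (Nat.choose_le_middle _ _) le_rfl
  have hup : (n - 2 * d) * W ≤ n * n.factorial := by
    have e1 : n * W ≤ n * (_ + n.factorial) := Nat.mul_le_mul le_rfl (sum_card_prefixed_le F)
    have e2 : n * _ ≤ 2 * d * W := card_mul_sum_card_prefixed_inter_le h0 h1 hd
    rw [Nat.sub_mul, Nat.sub_le_iff_le_add]
    rw [mul_add] at e1
    linarith
  refine Nat.le_of_mul_le_mul_right ?_ n.factorial_pos
  calc (n - 2 * d) * #F * n.factorial = (n - 2 * d) * (#F * n.factorial) := by ring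
    _ ≤ (n - 2 * d) * (N * W) := Nat.mul_le_mul le_rfl hlow
    _ = N * ((n - 2 * d) * W) := by ring
    _ ≤ N * (n * n.factorial) := Nat.mul_le_mul le_rfl hup
    _ = n * N * n.factorial := by ring

end Chains

section Containers

open Finset

/-- A graph container lemma, in the style of Kleitman and Winston: if every set of more than `m`
vertices of `U` contains a vertex with at least `d` neighbours in that set, then the independent
subsets of `U` are covered by a small collection of sets of size at most `m + #U / d`. -/
lemma exists_independent_containers {V : Type*} [DecidableEq V] (R : V → V → Prop)
    [DecidableRel R] (hR : ∀ v, ¬ R v v) {d : ℕ} {m x : ℝ} (hx : 1 ≤ x)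
    (hxd : 1 ≤ x ^ d * (x - 1)) (U : Finset V)
    (hdeg : ∀ F ⊆ U, m < #F → ∃ v ∈ F, d ≤ #{w ∈ F | R v w}) :
    ∃ 𝒢 : Finset (Finset V), (#𝒢 : ℝ) ≤ x ^ #U ∧
      (∀ G ∈ 𝒢, (#G : ℝ) * d ≤ m * d + #U) ∧
      ∀ I ⊆ U, (∀ a ∈ I, ∀ b ∈ I, ¬ R a b) → ∃ G ∈ 𝒢, I ⊆ G := by
  induction U using Finset.strongInduction with
  | H U ih =>
  rcases le_or_gt (#U : ℝ) m with hU | hU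
  · refine ⟨{U}, by simpa using one_le_pow₀ hx, ?_, fun I hI _ ↦ ⟨U, by simp, hI⟩⟩
    intro G hG
    rw [mem_singleton.1 hG]
    have := mul_le_mul_of_nonneg_right hU (Nat.cast_nonneg (α := ℝ) d)
    have : (0 : ℝ) ≤ #U := Nat.cast_nonneg _
    linarith
  obtain ⟨v, hv, hvd⟩ := hdeg U subset_rfl hU
  set U₁ := U.erase v with hU₁
  set U₂ := {w ∈ U₁ | ¬ R v w} with hU₂
  have hsub₁ : U₁ ⊂ U := erase_ssubset hv
  have hsub₂ : U₂ ⊂ U := (filter_subset _ _).trans_ssubset hsub₁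
  obtain ⟨𝒢₁, hc₁, hs₁, hI₁⟩ := ih U₁ hsub₁ fun F hF ↦ hdeg F (hF.trans hsub₁.subset)
  obtain ⟨𝒢₂, hc₂, hs₂, hI₂⟩ := ih U₂ hsub₂ fun F hF ↦ hdeg F (hF.trans hsub₂.subset)
  have hcard₁ : #U₁ + 1 = #U := card_erase_add_one hv
  have hcard₂ : #U₂ + d + 1 ≤ #U := by
    have h1 : #{w ∈ U₁ | R v w} = #{w ∈ U | R v w} := by
      rw [hU₁, filter_erase, erase_eq_of_notMem]
      simp [hR]
    have h2 := card_filter_add_card_filter_not (s := U₁) (R v)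
    rw [← hU₂, h1] at h2
    omega
  refine ⟨𝒢₁ ∪ 𝒢₂.image (insert v), ?_, ?_, ?_⟩
  · have hx0 : 0 ≤ x := by linarith
    have h2 : x ^ #U₂ * x ^ d ≤ x ^ #U₁ := by
      rw [← pow_add]
      exact pow_le_pow_right₀ hx (by omega)
    have h3 : (#(𝒢₁ ∪ 𝒢₂.image (insert v)) : ℝ) ≤ #𝒢₁ + #𝒢₂ := by
      exact_mod_cast (card_union_le _ _).trans (Nat.add_le_add_left card_image_le _)
    have h4 : x ^ #U₂ ≤ x ^ #U₁ * (x - 1) := by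
      calc x ^ #U₂ = x ^ #U₂ * 1 := (mul_one _).symm
        _ ≤ x ^ #U₂ * (x ^ d * (x - 1)) := mul_le_mul_of_nonneg_left hxd (by positivity)
        _ = x ^ #U₂ * x ^ d * (x - 1) := by ring
        _ ≤ x ^ #U₁ * (x - 1) := mul_le_mul_of_nonneg_right h2 (by linarith)
    rw [← hcard₁, pow_succ]
    linarith
  · intro G hG
    have hd₁ : (#U₁ : ℝ) + 1 = #U := by exact_mod_cast hcard₁
    have hd₂ : (#U₂ : ℝ) + d + 1 ≤ #U := by exact_mod_cast hcard₂
    rcases mem_union.1 hG with hG | hG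
    · linarith [hs₁ G hG]
    · obtain ⟨G', hG', rfl⟩ := mem_image.1 hG
      have h1 : (#(insert v G') : ℝ) ≤ #G' + 1 := by exact_mod_cast card_insert_le v G'
      have h2 := mul_le_mul_of_nonneg_right h1 (Nat.cast_nonneg (α := ℝ) d)
      linarith [hs₂ G' hG']
  · intro I hI hind
    by_cases hvI : v ∈ I
    · obtain ⟨G, hG, hIG⟩ := hI₂ (I.erase v)
        (fun w hw ↦ mem_filter.2 ⟨erase_subset_erase v hI hw, hind v hvI w (mem_of_mem_erase hw)⟩)
        fun a ha b hb ↦ hind a (mem_of_mem_erase ha) b (mem_of_mem_erase hb)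
      exact ⟨insert v G, mem_union_right _ (mem_image_of_mem _ hG), subset_insert_iff.2 hIG⟩
    · obtain ⟨G, hG, hIG⟩ := hI₁ I (subset_erase.2 ⟨hI, hvI⟩) hind
      exact ⟨G, mem_union_left _ hG, hIG⟩

end Containers

/-- The minimal members of a `(k + 1)`-chain-free family can be removed to leave a `k`-chain-free
one. -/
lemma kChainFree_filter_exists_ssubset {n k : ℕ} (hk : 0 < k) {F : Finset (Finset (Fin n))}
    (hF : kChainFree (k + 1) F) : kChainFree k {A ∈ F | ∃ B ∈ F, B ⊂ A} := by
  rintro ⟨ch, hmem, hch⟩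
  obtain ⟨-, B, hB, hlt⟩ := Finset.mem_filter.1 (hmem ⟨0, hk⟩)
  refine hF ⟨Fin.cons B ch, ?_, ?_⟩
  · intro i
    refine Fin.cases hB (fun i ↦ ?_) i
    rw [Fin.cons_succ]
    exact (Finset.mem_filter.1 (hmem i)).1
  · intro i j hij
    obtain ⟨j, rfl⟩ := Fin.exists_succ_eq.2 (Fin.ne_zero_of_lt hij)
    rw [Fin.cons_succ]
    induction i using Fin.cases with
    | zero =>
      rw [Fin.cons_zero]
      rcases eq_or_ne j ⟨0, hk⟩ with rfl | hj
      · exact hlt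
      · exact hlt.trans (hch _ _ (Nat.pos_of_ne_zero fun h ↦ hj (Fin.ext h)))
    | succ i =>
      rw [Fin.cons_succ]
      exact hch _ _ (Fin.succ_lt_succ_iff.1 hij)

open Finset in
/-- Containers for antichains yield containers for `(k + 1)`-chain-free families, since such a
family is a union of `k` antichains. -/
lemma exists_kChainFree_containers {n : ℕ} {𝒢 : Finset (Finset (Finset (Fin n)))} {s : ℝ}
    (hs : ∀ G ∈ 𝒢, (#G : ℝ) ≤ s)
    (h𝒢 : ∀ I : Finset (Finset (Fin n)), (∀ A ∈ I, ∀ B ∈ I, ¬ A ⊂ B) → ∃ G ∈ 𝒢, I ⊆ G) (k : ℕ) :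
    ∃ ℋ : Finset (Finset (Finset (Fin n))), #ℋ ≤ #𝒢 ^ k ∧ (∀ H ∈ ℋ, (#H : ℝ) ≤ k * s) ∧
      ∀ F, kChainFree (k + 1) F → ∃ H ∈ ℋ, F ⊆ H := by
  induction k with
  | zero =>
    refine ⟨{∅}, by simp, by simp, fun F hF ↦ ⟨∅, by simp, fun A hA ↦ ?_⟩⟩
    refine absurd ⟨fun _ ↦ A, fun _ ↦ hA, fun i j hij ↦ ?_⟩ hF
    omega
  | succ k ih =>
    obtain ⟨ℋ, hcard, hsize, hcov⟩ := ih
    refine ⟨image₂ (· ∪ ·) ℋ 𝒢, ?_, ?_, fun F hF ↦ ?_⟩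
    · rw [pow_succ]
      exact (card_image₂_le _ _ _).trans (Nat.mul_le_mul hcard le_rfl)
    · intro H hH
      obtain ⟨H', hH', G, hG, rfl⟩ := mem_image₂.1 hH
      have h : (#(H' ∪ G) : ℝ) ≤ #H' + #G := by exact_mod_cast card_union_le H' G
      push_cast
      linarith [hsize H' hH', hs G hG]
    · obtain ⟨H, hH, hFH⟩ := hcov _ (kChainFree_filter_exists_ssubset k.succ_pos hF)
      obtain ⟨G, hG, hFG⟩ := h𝒢 {A ∈ F | ¬ ∃ B ∈ F, B ⊂ A} fun A hA B hB hlt ↦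
        (mem_filter.1 hB).2 ⟨A, (mem_filter.1 hA).1, hlt⟩
      refine ⟨H ∪ G, mem_image₂_of_mem hH hG, ?_⟩
      rw [← filter_union_filter_not_eq (fun A ↦ ∃ B ∈ F, B ⊂ A) F]
      exact union_subset_union hFH hFG

lemma Nat.pow_three_le_three_pow (d : ℕ) : d ^ 3 ≤ 3 ^ d := by
  rcases Nat.lt_or_ge d 3 with h | h
  · interval_cases d <;> norm_num
  · induction d, h using Nat.le_induction with
    | base => norm_num
    | succ d hd ih =>
      rw [pow_succ 3 d]
      nlinarith [Nat.mul_le_mul hd hd, Nat.mul_le_mul (Nat.mul_le_mul hd hd) hd,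
        Nat.mul_le_mul hd (le_refl (d * d)), Nat.mul_le_mul hd (le_refl d)]

lemma natCast_le_three_rpow_div_three (d : ℕ) : (d : ℝ) ≤ (3 : ℝ) ^ ((d : ℝ) / 3) := by
  refine le_of_pow_le_pow_left₀ (n := 3) (by norm_num) (by positivity) ?_
  rw [← Real.rpow_natCast (_ ^ _) 3, ← Real.rpow_mul (by norm_num)]
  have h : (d : ℝ) / 3 * (3 : ℕ) = d := by
    push_cast
    ring
  rw [h, Real.rpow_natCast]
  exact_mod_cast Nat.pow_three_le_three_pow d

section Colourings

open Finset

/-- The number of ways to choose, for each element of `F`, one of `r` sets containing it. -/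
lemma prod_card_filter_mem_le {V : Type*} [DecidableEq V] [Fintype V] {r : ℕ} {s : ℝ}
    (F : Finset V) (h : Fin r → Finset V) (hs : ∀ i, (#(h i) : ℝ) ≤ s) :
    ((∏ a : {A // A ∈ F}, #{i | a.1 ∈ h i} : ℕ) : ℝ) ≤ (3 : ℝ) ^ (r * s / 3) := by
  have hsum : ∑ A ∈ F, #{i | A ∈ h i} ≤ ∑ i, #(h i) := by
    calc ∑ A ∈ F, #{i | A ∈ h i} ≤ ∑ A, #{i | A ∈ h i} :=
          sum_le_sum_of_subset (subset_univ F)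
      _ = ∑ i, #(h i) := by
          simp only [card_eq_sum_ones, sum_filter]
          rw [sum_comm]
          simp
  have hsum' : ((∑ A ∈ F, #{i | A ∈ h i} : ℕ) : ℝ) ≤ r * s := by
    calc ((∑ A ∈ F, #{i | A ∈ h i} : ℕ) : ℝ) ≤ ∑ i, (#(h i) : ℝ) := by exact_mod_cast hsum
      _ ≤ ∑ _i : Fin r, s := sum_le_sum fun i _ ↦ hs i
      _ = r * s := by simp
  rw [prod_coe_sort F fun A ↦ #{i | A ∈ h i}, Nat.cast_prod]
  calc ∏ A ∈ F, (#{i | A ∈ h i} : ℝ) ≤ ∏ A ∈ F, (3 : ℝ) ^ ((#{i | A ∈ h i} : ℝ) / 3) :=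
        prod_le_prod (fun _ _ ↦ Nat.cast_nonneg _) fun _ _ ↦ natCast_le_three_rpow_div_three _
    _ = (3 : ℝ) ^ (((∑ A ∈ F, #{i | A ∈ h i} : ℕ) : ℝ) / 3) := by
        rw [← Real.rpow_sum_of_pos (by norm_num), Nat.cast_sum, sum_div]
    _ ≤ (3 : ℝ) ^ (r * s / 3) :=
        Real.rpow_le_rpow_of_exponent_le (by norm_num) (by linarith)

lemma IsRKColouring.kChainFree_colourClass {n r k : ℕ} {F : Finset (Finset (Fin n))}
    {c : {A // A ∈ F} → Fin r} (hc : IsRKColouring k F c) (i : Fin r) :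
    kChainFree k (({a | c a = i} : Finset {A // A ∈ F}).map (Function.Embedding.subtype _)) := by
  rintro ⟨ch, hmem, hch⟩
  have h : ∀ j, ∃ hj : ch j ∈ F, c ⟨ch j, hj⟩ = i := by
    intro j
    simpa using hmem j
  obtain ⟨j₁, j₂, hne⟩ := hc (fun j ↦ ⟨ch j, (h j).1⟩) hch
  exact hne ((h j₁).2.trans (h j₂).2.symm)

lemma numColourings_le {r k n : ℕ} {ℋ : Finset (Finset (Finset (Fin n)))} {s : ℝ}
    (hs : ∀ H ∈ ℋ, (#H : ℝ) ≤ s)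
    (hℋ : ∀ F : Finset (Finset (Fin n)), kChainFree k F → ∃ H ∈ ℋ, F ⊆ H)
    (F : Finset (Finset (Fin n))) :
    (numColourings r k n F : ℝ) ≤ (#ℋ : ℝ) ^ r * (3 : ℝ) ^ (r * s / 3) := by
  classical
  have hcount : numColourings r k n F ≤
      ∑ h ∈ Fintype.piFinset fun _ : Fin r ↦ ℋ, ∏ a : {A // A ∈ F}, #{i | a.1 ∈ h i} := by
    rw [numColourings, Nat.card_eq_fintype_card, Fintype.card_subtype]
    calc #{c : {A // A ∈ F} → Fin r | IsRKColouring k F c}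
        ≤ #((Fintype.piFinset fun _ : Fin r ↦ ℋ).biUnion fun h ↦
            Fintype.piFinset fun a : {A // A ∈ F} ↦ ({i | a.1 ∈ h i} : Finset (Fin r))) := by
          refine card_le_card fun c hc ↦ ?_
          have hc' := (mem_filter.1 hc).2
          choose h hh hsub using fun i ↦ hℋ _ (hc'.kChainFree_colourClass i)
          refine mem_biUnion.2 ⟨h, Fintype.mem_piFinset.2 hh, Fintype.mem_piFinset.2 fun a ↦ ?_⟩
          refine mem_filter.2 ⟨mem_univ _, hsub (c a) ?_⟩
          simp
      _ ≤ _ := card_biUnion_le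
      _ = _ := by simp only [Fintype.card_piFinset]
  calc (numColourings r k n F : ℝ)
      ≤ ∑ h ∈ Fintype.piFinset fun _ : Fin r ↦ ℋ,
          ((∏ a : {A // A ∈ F}, #{i | a.1 ∈ h i} : ℕ) : ℝ) := by exact_mod_cast hcount
    _ ≤ ∑ _h ∈ Fintype.piFinset fun _ : Fin r ↦ ℋ, (3 : ℝ) ^ (r * s / 3) :=
        sum_le_sum fun h hh ↦
          prod_card_filter_mem_le F h fun i ↦ hs _ (Fintype.mem_piFinset.1 hh i)
    _ = (#ℋ : ℝ) ^ r * (3 : ℝ) ^ (r * s / 3) := by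
        rw [sum_const, Fintype.card_piFinset, nsmul_eq_mul]
        simp

end Colourings

section CentralBinomial

lemma Nat.sixteen_pow_le_four_mul_centralBinom_sq {m : ℕ} (hm : 0 < m) :
    16 ^ m ≤ 4 * m * m.centralBinom ^ 2 := by
  induction m, hm using Nat.le_induction with
  | base => simp [Nat.centralBinom, Nat.choose]
  | succ m hm ih =>
    have h := Nat.succ_mul_centralBinom_succ m
    refine Nat.le_of_mul_le_mul_left ?_ m.succ_pos
    calc (m + 1) * 16 ^ (m + 1) = 16 * (m + 1) * 16 ^ m := by ring
      _ ≤ 16 * (m + 1) * (4 * m * m.centralBinom ^ 2) := Nat.mul_le_mul le_rfl ih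
      _ ≤ 4 * (2 * (2 * m + 1) * m.centralBinom) ^ 2 := by nlinarith [sq_nonneg m.centralBinom]
      _ = (m + 1) * (4 * (m + 1) * (m + 1).centralBinom ^ 2) := by rw [← h]; ring

lemma Nat.four_pow_le_four_mul_choose_half_sq {n : ℕ} (hn : 0 < n) :
    4 ^ n ≤ 4 * n * (n.choose (n / 2)) ^ 2 := by
  rcases Nat.even_or_odd' n with ⟨m, rfl | rfl⟩
  · have h := Nat.sixteen_pow_le_four_mul_centralBinom_sq (m := m) (by omega)
    rw [Nat.centralBinom_eq_two_mul_choose] at h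
    rw [pow_mul, Nat.mul_div_cancel_left m two_pos]
    norm_num
    nlinarith [Nat.zero_le (m * (2 * m).choose m ^ 2)]
  · have h := Nat.sixteen_pow_le_four_mul_centralBinom_sq m.succ_pos
    have hc : (m + 1).centralBinom = 2 * (2 * m + 1).choose m := by
      rw [Nat.centralBinom_eq_two_mul_choose, show 2 * (m + 1) = 2 * m + 1 + 1 by ring,
        Nat.choose_succ_succ, Nat.choose_symm_half]
      ring
    rw [Nat.succ_eq_add_one, hc] at h
    rw [show (2 * m + 1) / 2 = m by omega]
    have e : (4 : ℕ) ^ (2 * m + 1) * 4 = 16 ^ (m + 1) := by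
      rw [← pow_succ, show 2 * m + 1 + 1 = 2 * (m + 1) by ring, pow_mul]
      norm_num
    nlinarith [Nat.zero_le (m * (2 * m + 1).choose m ^ 2)]

lemma two_pow_le_two_mul_sqrt_mul_choose_half {n : ℕ} (hn : 0 < n) :
    (2 : ℝ) ^ n ≤ 2 * √n * n.choose (n / 2) := by
  refine le_of_pow_le_pow_left₀ (n := 2) (by norm_num) (by positivity) ?_
  rw [mul_pow, mul_pow, Real.sq_sqrt (Nat.cast_nonneg n), ← pow_mul, mul_comm n 2, pow_mul]
  norm_num
  exact_mod_cast Nat.four_pow_le_four_mul_choose_half_sq hn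

end CentralBinomial

open Finset in
lemma exists_comparable_of_lt_card {n : ℕ} {η : ℝ} (hn : 0 < n) (hη : 0 < η) (hη4 : η ≤ 1 / 4)
    {F : Finset (Finset (Fin n))} (hF : F ⊆ univ \ {∅, univ})
    (hcard : (1 + 4 * η) * n.choose (n / 2) < #F) :
    ∃ A ∈ F, ⌊η * n⌋₊ + 1 ≤ #{B ∈ F | B ⊂ A ∨ A ⊂ B} := by
  by_contra! h
  have h0 : (∅ : Finset (Fin n)) ∉ F := fun h ↦ by simpa using hF h
  have h1 : (univ : Finset (Fin n)) ∉ F := fun h ↦ by simpa using hF h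
  have key := card_mul_le_of_comparable_le h0 h1 fun A hA ↦ Nat.lt_succ_iff.1 (h A hA)
  rw [Fintype.card_fin] at key
  have hfloor : (⌊η * n⌋₊ : ℝ) ≤ η * n := Nat.floor_le (by positivity)
  have hsub : (n : ℝ) ≤ (n - 2 * ⌊η * n⌋₊ : ℕ) + 2 * ⌊η * n⌋₊ := by
    exact_mod_cast Nat.sub_le_iff_le_add.1 le_rfl
  have key' : ((n - 2 * ⌊η * n⌋₊ : ℕ) : ℝ) * #F ≤ n * n.choose (n / 2) := by exact_mod_cast key
  have hn' : (0 : ℝ) < n := by exact_mod_cast hn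
  have hN : (0 : ℝ) < n.choose (n / 2) := by
    exact_mod_cast Nat.choose_pos (Nat.div_le_self n 2)
  have h2 : n * ((1 - 2 * η) * #F) ≤ n * (n.choose (n / 2) : ℝ) := by
    refine le_trans ?_ key'
    rw [← mul_assoc]
    exact mul_le_mul_of_nonneg_right (by linarith) (Nat.cast_nonneg _)
  have h3 := le_of_mul_le_mul_left h2 hn'
  nlinarith [mul_lt_mul_of_pos_left hcard (show 0 < 1 - 2 * η by linarith), mul_pos hη hN,
    mul_nonneg (mul_pos hη hN).le (show 0 ≤ 1 / 4 - η by linarith)]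

open Finset in
/-- Containers for antichains in the Boolean lattice. -/
lemma exists_antichain_containers {n : ℕ} {η : ℝ} (hη : 0 < η) (hη4 : η ≤ 1 / 4)
    (hn : 2 / η ^ 5 ≤ √n) :
    ∃ 𝒢 : Finset (Finset (Finset (Fin n))),
      (#𝒢 : ℝ) ≤ (3 : ℝ) ^ (4 * η * n.choose (n / 2)) ∧
      (∀ G ∈ 𝒢, (#G : ℝ) ≤ (1 + 6 * η) * n.choose (n / 2)) ∧
      ∀ I : Finset (Finset (Fin n)), (∀ A ∈ I, ∀ B ∈ I, ¬ A ⊂ B) → ∃ G ∈ 𝒢, I ⊆ G := by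
  have hη5 : 2 ≤ √n * η ^ 5 := (div_le_iff₀ (by positivity)).1 hn
  have hs0 : 0 < √(n : ℝ) := (by positivity : (0 : ℝ) < 2 / η ^ 5).trans_le hn
  have hn0 : (0 : ℝ) < n := Real.sqrt_pos.1 hs0
  have hn0' : 0 < n := by exact_mod_cast hn0
  have hsq : √(n : ℝ) * √n = n := Real.mul_self_sqrt hn0.le
  set N := (n.choose (n / 2) : ℝ) with hN
  have hnN : (n : ℝ) ≤ N := by
    have := Nat.choose_le_middle 1 n
    rw [Nat.choose_one_right] at this
    rw [hN]
    exact_mod_cast this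
  have hη2 : 2 ≤ √n * η ^ 2 := by
    have : η ^ 5 ≤ η ^ 2 := pow_le_pow_of_le_one hη.le (by linarith) (by norm_num)
    nlinarith
  have hη1 : 2 ≤ η * n := by
    have h1 : 1 ≤ √(n : ℝ) := Real.one_le_sqrt.2 (by exact_mod_cast hn0')
    have h2 : η ^ 2 ≤ η := by nlinarith
    calc 2 ≤ √n * η ^ 2 := hη2
      _ ≤ √n * η := mul_le_mul_of_nonneg_left h2 hs0.le
      _ ≤ (√n * √n) * η := by nlinarith [mul_pos hs0 hη]
      _ = η * n := by rw [hsq, mul_comm]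
  have hpow : (2 : ℝ) ^ n ≤ 2 * √n * N := two_pow_le_two_mul_sqrt_mul_choose_half hn0'
  set d := ⌊η * n⌋₊ + 1 with hd
  have hdn : η * n ≤ d := by
    rw [hd]
    push_cast
    exact (Nat.lt_floor_add_one _).le
  have hd0 : (0 : ℝ) < d := (by positivity : 0 < η * n).trans_le hdn
  set u : ℝ := η / √n with hu
  have hu0 : 0 < u := by positivity
  have hus : u * √n = η := div_mul_cancel₀ _ hs0.ne'
  set x : ℝ := (1 + u) ^ 2 with hx
  have hx1 : u ≤ x - 1 := by
    rw [hx]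
    nlinarith
  have hxd : 1 ≤ x ^ d * (x - 1) := by
    have h1 : d * u ≤ (1 + u) ^ d := by
      have := one_add_mul_le_pow (a := u) (by linarith) d
      linarith
    have h2 : η ^ 2 * √n ≤ d * u := by
      calc η ^ 2 * √n = η * (√n * √n) * u := by rw [← hus]; ring
        _ ≤ d * u := by
          rw [hsq]
          exact mul_le_mul_of_nonneg_right hdn hu0.le
    have h3 : (η ^ 2 * √n) ^ 2 ≤ x ^ d := by
      rw [hx, ← pow_mul, mul_comm 2 d, pow_mul]
      exact pow_le_pow_left₀ (by positivity) (h2.trans h1) 2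
    calc (1 : ℝ) ≤ √n * η ^ 5 := by linarith
      _ = (η ^ 2 * √n) ^ 2 * u := by rw [← hus]; ring
      _ ≤ x ^ d * (x - 1) := mul_le_mul h3 hx1 hu0.le (by positivity)
  obtain ⟨𝒢, hcard, hsize, hcov⟩ := exists_independent_containers
    (fun A B : Finset (Fin n) ↦ B ⊂ A ∨ A ⊂ B) (by simp) (d := d) (m := (1 + 4 * η) * N)
    (by linarith) hxd (univ \ {∅, univ})
    fun F hF ↦ exists_comparable_of_lt_card hn0' hη hη4 hF
  have hU : #((univ : Finset (Finset (Fin n))) \ {∅, univ}) ≤ 2 ^ n := by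
    simpa using card_le_univ ((univ : Finset (Finset (Fin n))) \ {∅, univ})
  refine ⟨𝒢.image (· ∪ {∅, univ}), ?_, ?_, ?_⟩
  · have hx3 : x ≤ (3 : ℝ) ^ (2 * u) := by
      have h1 : 1 + u ≤ (3 : ℝ) ^ u := by
        calc 1 + u ≤ Real.exp u := by linarith [Real.add_one_le_exp u]
          _ = Real.exp 1 ^ u := (Real.exp_one_rpow u).symm
          _ ≤ (3 : ℝ) ^ u :=
            Real.rpow_le_rpow (Real.exp_pos 1).le (by linarith [Real.exp_one_lt_d9]) hu0.le
      rw [hx, mul_comm 2 u, Real.rpow_mul (by norm_num), Real.rpow_two]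
      exact pow_le_pow_left₀ (by positivity) h1 2
    calc (#(𝒢.image (· ∪ {∅, univ})) : ℝ) ≤ #𝒢 := by exact_mod_cast card_image_le
      _ ≤ x ^ #((univ : Finset (Finset (Fin n))) \ {∅, univ}) := hcard
      _ ≤ x ^ (2 ^ n) := pow_le_pow_right₀ (by linarith) hU
      _ ≤ ((3 : ℝ) ^ (2 * u)) ^ (2 ^ n) := pow_le_pow_left₀ (by positivity) hx3 _
      _ = (3 : ℝ) ^ (2 * u * 2 ^ n) := by
        rw [← Real.rpow_natCast, ← Real.rpow_mul (by norm_num)]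
        norm_num
      _ ≤ (3 : ℝ) ^ (4 * η * N) := by
        refine Real.rpow_le_rpow_of_exponent_le (by norm_num) ?_
        calc 2 * u * 2 ^ n ≤ 2 * u * (2 * √n * N) :=
              mul_le_mul_of_nonneg_left hpow (by positivity)
          _ = 4 * η * N := by rw [← hus]; ring
  · intro G hG
    obtain ⟨G', hG', rfl⟩ := mem_image.1 hG
    have h1 : (#(G' ∪ {∅, univ}) : ℝ) ≤ #G' + 2 := by
      exact_mod_cast (card_union_le _ _).trans (Nat.add_le_add_left card_le_two _)
    have h2 : (#((univ : Finset (Finset (Fin n))) \ {∅, univ}) : ℝ) ≤ η * N * d := by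
      calc (#((univ : Finset (Finset (Fin n))) \ {∅, univ}) : ℝ) ≤ 2 ^ n := by exact_mod_cast hU
        _ ≤ 2 * √n * N := hpow
        _ ≤ (√n * η ^ 2) * √n * N := by gcongr
        _ = η * N * (η * (√n * √n)) := by ring
        _ ≤ η * N * d := by
          rw [hsq]
          exact mul_le_mul_of_nonneg_left hdn (by positivity)
    have h3 : (#G' : ℝ) ≤ (1 + 5 * η) * N := by
      refine le_of_mul_le_mul_right ?_ hd0
      linarith [hsize G' hG']
    have h4 : 2 ≤ η * N := hη1.trans (mul_le_mul_of_nonneg_left hnN hη.le)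
    linarith
  · intro I hI
    obtain ⟨G, hG, hIG⟩ := hcov (I \ {∅, univ}) (sdiff_subset_sdiff (subset_univ I) subset_rfl)
      fun A hA B hB h ↦ h.elim (hI B (mem_sdiff.1 hB).1 A (mem_sdiff.1 hA).1)
        (hI A (mem_sdiff.1 hA).1 B (mem_sdiff.1 hB).1)
    refine ⟨G ∪ {∅, univ}, mem_image_of_mem _ hG, ?_⟩
    rw [union_comm]
    exact sdiff_le_iff.1 hIG

/-- For integers `k ≥ 2`, `r ≥ 3` and real `ε > 0`, for all sufficiently
large `n` one has `f(r,k;n) ≤ 3^((1/3)·r·(k-1+ε)·C(n,⌊n/2⌋))`. -/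
theorem fMax_upper_bound (k r : ℕ) (hk : 2 ≤ k) (hr : 3 ≤ r) (ε : ℝ) (hε : 0 < ε) :
    ∃ n₀ : ℕ, ∀ n : ℕ, n₀ ≤ n →
      (fMax r k n : ℝ) ≤
        (3 : ℝ) ^ ((1 / 3 : ℝ) * r * ((k : ℝ) - 1 + ε) * (n.choose (n / 2) : ℝ)) := by
  obtain ⟨k, rfl⟩ : ∃ l, k = l + 1 := ⟨k - 1, by omega⟩
  have hk0 : (0 : ℝ) < k := by exact_mod_cast (by omega : 0 < k)
  obtain ⟨η, hη, hη4, hηε⟩ : ∃ η : ℝ, 0 < η ∧ η ≤ 1 / 4 ∧ 18 * η * k ≤ ε := by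
    refine ⟨min (1 / 4) (ε / (18 * k)), by positivity, min_le_left _ _, ?_⟩
    have h := (le_div_iff₀ (by positivity)).1 (min_le_right (1 / 4) (ε / (18 * k)))
    linarith
  refine ⟨⌈(2 / η ^ 5) ^ 2⌉₊, fun n hn ↦ ?_⟩
  obtain ⟨𝒢, hcard, hsize, hcov⟩ := exists_antichain_containers hη hη4
    (Real.le_sqrt_of_sq_le ((Nat.le_ceil _).trans (by exact_mod_cast hn)))
  obtain ⟨ℋ, hcard', hsize', hcov'⟩ := exists_kChainFree_containers hsize hcov k
  obtain ⟨F, -, hF⟩ := Finset.exists_mem_eq_sup Finset.univ Finset.univ_nonempty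
    fun F : Finset (Finset (Fin n)) ↦ numColourings r (k + 1) n F
  set N := (n.choose (n / 2) : ℝ)
  have hℋ : (ℋ.card : ℝ) ^ r ≤ (3 : ℝ) ^ (4 * η * N * k * r) := by
    rw [Real.rpow_mul (by norm_num), Real.rpow_natCast, Real.rpow_mul (by norm_num),
      Real.rpow_natCast]
    refine pow_le_pow_left₀ (Nat.cast_nonneg _) ?_ r
    calc (ℋ.card : ℝ) ≤ (𝒢.card : ℝ) ^ k := by exact_mod_cast hcard'
      _ ≤ _ := pow_le_pow_left₀ (Nat.cast_nonneg _) hcard k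
  calc (fMax r (k + 1) n : ℝ) = numColourings r (k + 1) n F := by rw [fMax, hF]
    _ ≤ (ℋ.card : ℝ) ^ r * (3 : ℝ) ^ (r * (k * ((1 + 6 * η) * N)) / 3) :=
      numColourings_le hsize' hcov' F
    _ ≤ (3 : ℝ) ^ (4 * η * N * k * r) * (3 : ℝ) ^ (r * (k * ((1 + 6 * η) * N)) / 3) :=
      mul_le_mul_of_nonneg_right hℋ (by positivity)
    _ = (3 : ℝ) ^ (1 / 3 * r * (k + 18 * η * k) * N) := by
      rw [← Real.rpow_add (by norm_num)]
      congr 1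
      ring
    _ ≤ (3 : ℝ) ^ ((1 / 3 : ℝ) * r * (((k + 1 : ℕ) : ℝ) - 1 + ε) * N) := by
      refine Real.rpow_le_rpow_of_exponent_le (by norm_num) ?_
      push_cast
      gcongr
      linarith
end
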